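/- Let a_1,…,a_q be q distinct non-zero complex numbers, let l_1,…,l_q be positive integers (or +∞) with q ≥ 1, let n be a non-negative integer, and let n_1,…,n_k, t_1,…,t_k be positive integers (k ≥ 1). Let F be a family of holomorphic functions on a domain D such that for every f ∈ F and every i = 1,…,q, all zeros of f^n (f^{n_1})^{(t_1)} ⋯ (f^{n_k})^{(t_k)} − a_i have multiplicity at least l_i. Assume (a) n_j ≥ t_j for all 1 ≤ j ≤ k and l_i ≥ 2 for all 1 ≤ i ≤ q, and (b) Σ_{i=1}^q 1/l_i < (qn − 1 + Σ_{j=1}^k q(n_j − t_j)) / (n + Σ_{j=1}^k n_j). Then F is normal in D. -/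

import Mathlib

open Complex Topology Filter Set MeasureTheory
open scoped ENNReal NNReal Classical

noncomputable section


/-- The chordal (spherical) distance on the Riemann sphere `ℂ ∪ {∞}`. -/
def sphDist (a b : OnePoint ℂ) : ℝ :=
  Option.elim a (Option.elim b 0 fun w => 1 / Real.sqrt (1 + ‖w‖ ^ 2))
    fun z => Option.elim b (1 / Real.sqrt (1 + ‖z‖ ^ 2))
      fun w => ‖z - w‖ / (Real.sqrt (1 + ‖z‖ ^ 2) * Real.sqrt (1 + ‖w‖ ^ 2))

/-- The natural Riemann-sphere-valued version of a meromorphic function: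
at points where the function blows up (poles) the value is `∞`. -/
def toSphere (f : ℂ → ℂ) : ℂ → OnePoint ℂ := fun z =>
  if Tendsto (fun w => ‖f w‖) (𝓝[≠] z) atTop then OnePoint.infty else (f z : OnePoint ℂ)

/-- A meromorphic function given by an honest representative: at each point of `D` it is
either continuous (analytic points) or blows up (a pole). -/
def MeromorphicNiceOn (f : ℂ → ℂ) (D : Set ℂ) : Prop :=
  MeromorphicOn f D ∧ ∀ z ∈ D, ContinuousAt f z ∨ Tendsto (fun w => ‖f w‖) (𝓝[≠] z) atTop

/-- The order (multiplicity) of a meromorphic function at a point: positive for a zero of that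
multiplicity, negative of the multiplicity for a pole, `⊤` if the function vanishes identically
near the point, and junk value `0` when not defined. -/
def merOrder (f : ℂ → ℂ) (z : ℂ) : WithTop ℤ :=
  if ∀ᶠ w in 𝓝[≠] z, f w = 0 then ⊤
  else if h : ∃ n : ℤ, ∃ g : ℂ → ℂ, AnalyticAt ℂ g z ∧ g z ≠ 0 ∧
      ∀ᶠ w in 𝓝[≠] z, f w = (w - z) ^ n * g w
    then (h.choose : WithTop ℤ) else 0

/-- `F j → g` spherically uniformly on compact subsets of `D`. -/
def ConvSphLocUnif (F : ℕ → ℂ → ℂ) (g : ℂ → ℂ) (D : Set ℂ) : Prop :=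
  ∀ K ⊆ D, IsCompact K → ∀ ε > 0, ∀ᶠ j in atTop, ∀ z ∈ K,
    sphDist (toSphere (F j) z) (toSphere g z) < ε

/-- `F j → ∞` spherically uniformly on compact subsets of `D`. -/
def ConvInftyLocUnif (F : ℕ → ℂ → ℂ) (D : Set ℂ) : Prop :=
  ∀ K ⊆ D, IsCompact K → ∀ ε > 0, ∀ᶠ j in atTop, ∀ z ∈ K,
    sphDist (toSphere (F j) z) OnePoint.infty < ε

/-- A family of meromorphic functions is normal in `D` if every sequence from the family has a
subsequence converging spherically uniformly on compact subsets of `D` to a meromorphic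
function or to `∞`. -/
def NormalFamilyOn (𝓕 : Set (ℂ → ℂ)) (D : Set ℂ) : Prop :=
  ∀ f : ℕ → ℂ → ℂ, (∀ j, f j ∈ 𝓕) → ∃ φ : ℕ → ℕ, StrictMono φ ∧
    ((∃ g : ℂ → ℂ, MeromorphicNiceOn g D ∧ ConvSphLocUnif (fun j => f (φ j)) g D) ∨
      ConvInftyLocUnif (fun j => f (φ j)) D)

/-- A sequence of meromorphic functions is normal in `D` if every subsequence has a further
subsequence converging spherically uniformly on compact subsets of `D` to a meromorphic
function or to `∞`. -/
def NormalSeqOn (f : ℕ → ℂ → ℂ) (D : Set ℂ) : Prop :=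
  ∀ φ : ℕ → ℕ, StrictMono φ → ∃ σ : ℕ → ℕ, StrictMono σ ∧
    ((∃ g : ℂ → ℂ, MeromorphicNiceOn g D ∧ ConvSphLocUnif (fun j => f (φ (σ j))) g D) ∨
      ConvInftyLocUnif (fun j => f (φ (σ j))) D)

/-- A family of holomorphic functions is normal in `D` if every sequence from the family has a
subsequence converging locally uniformly on `D` to a holomorphic function, or converging to `∞`
uniformly on compact subsets of `D`. -/
def NormalFamilyOnHolo (𝓕 : Set (ℂ → ℂ)) (D : Set ℂ) : Prop :=
  ∀ f : ℕ → ℂ → ℂ, (∀ j, f j ∈ 𝓕) → ∃ φ : ℕ → ℕ, StrictMono φ ∧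
    ((∃ g : ℂ → ℂ, DifferentiableOn ℂ g D ∧
        TendstoLocallyUniformlyOn (fun j => f (φ j)) g atTop D) ∨
      ConvInftyLocUnif (fun j => f (φ j)) D)

/-- Continuous convergence of a sequence of functions at every point of a set. -/
def ContConv (F : ℕ → ℂ → ℂ) (f : ℂ → ℂ) (U : Set ℂ) : Prop :=
  ∀ z ∈ U, Tendsto (fun p : ℕ × ℂ => F p.1 p.2) (atTop ×ˢ 𝓝 z) (𝓝 (f z))

/-- Each point of `U` has a neighbourhood on which the functions are eventually holomorphic. -/
def EvHolo (F : ℕ → ℂ → ℂ) (U : Set ℂ) : Prop :=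
  ∀ z ∈ U, ∀ᶠ p in (atTop : Filter ℕ) ×ˢ 𝓝 z, DifferentiableAt ℂ (F p.1) p.2

lemma eventually_atTop_prod_nhds_iff {Q : ℕ × ℂ → Prop} {z : ℂ} :
    (∀ᶠ p in (atTop : Filter ℕ) ×ˢ 𝓝 z, Q p) ↔
      ∃ N : ℕ, ∃ r > 0, ∀ j ≥ N, ∀ w ∈ Metric.ball z r, Q (j, w) := by
  rw [((atTop_basis (α := ℕ)).prod Metric.nhds_basis_ball).eventually_iff]
  constructor
  · rintro ⟨⟨N, r⟩, ⟨-, hr⟩, h⟩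
    exact ⟨N, r, hr, fun j hj w hw => h ⟨hj, hw⟩⟩
  · rintro ⟨N, r, hr, h⟩
    exact ⟨⟨N, r⟩, ⟨trivial, hr⟩, fun p hp => h p.1 hp.1 p.2 hp.2⟩

lemma tendsto_atTop_prod_nhds_left (z : ℂ) :
    Tendsto (fun j : ℕ => (j, z)) atTop (atTop ×ˢ 𝓝 z) :=
  tendsto_id.prodMk tendsto_const_nhds

lemma ContConv.tendsto_apply {F : ℕ → ℂ → ℂ} {f : ℂ → ℂ} {U : Set ℂ} (h : ContConv F f U)
    {z : ℂ} (hz : z ∈ U) : Tendsto (fun j => F j z) atTop (𝓝 (f z)) :=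
  (h z hz).comp (tendsto_atTop_prod_nhds_left z)

lemma ContConv.mono {F : ℕ → ℂ → ℂ} {f : ℂ → ℂ} {U V : Set ℂ} (h : ContConv F f U)
    (hV : V ⊆ U) : ContConv F f V := fun z hz => h z (hV hz)

lemma ContConv.tendstoLocallyUniformlyOn {F : ℕ → ℂ → ℂ} {f : ℂ → ℂ} {U : Set ℂ}
    (hU : IsOpen U) (h : ContConv F f U) : TendstoLocallyUniformlyOn F f atTop U := by
  rw [Metric.tendstoLocallyUniformlyOn_iff]
  intro ε hε z hz
  have h1 := (h z hz).eventually (Metric.ball_mem_nhds _ (half_pos hε))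
  rw [eventually_atTop_prod_nhds_iff] at h1
  obtain ⟨N, r, hr, h1⟩ := h1
  refine ⟨Metric.ball z r ∩ U, mem_nhdsWithin_of_mem_nhds
    (inter_mem (Metric.ball_mem_nhds z hr) (hU.mem_nhds hz)), ?_⟩
  filter_upwards [eventually_ge_atTop N] with j hj w hw
  have h2 : dist (f w) (f z) ≤ ε / 2 := by
    refine le_of_tendsto ((h.tendsto_apply hw.2).dist tendsto_const_nhds) ?_
    filter_upwards [eventually_ge_atTop N] with i hi
    exact (Metric.mem_ball.1 (h1 i hi w hw.1)).le
  have h3 : dist (F j w) (f z) < ε / 2 := h1 j hj w hw.1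
  linarith [dist_triangle_right (f w) (F j w) (f z)]

lemma TendstoLocallyUniformlyOn.contConv {F : ℕ → ℂ → ℂ} {f : ℂ → ℂ} {U : Set ℂ}
    (hU : IsOpen U) (h : TendstoLocallyUniformlyOn F f atTop U) (hf : ContinuousOn f U) :
    ContConv F f U := by
  intro z hz
  rw [Metric.tendsto_nhds]
  intro ε hε
  rw [Metric.tendstoLocallyUniformlyOn_iff] at h
  obtain ⟨t, ht, hj⟩ := h (ε / 2) (half_pos hε) z hz
  rw [hU.nhdsWithin_eq hz] at ht
  have hc := ((hf.continuousAt (hU.mem_nhds hz)).eventually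
    (Metric.ball_mem_nhds _ (half_pos hε)))
  filter_upwards [hj.prod_mk (hc.and ht)] with p hp
  have h1 := hp.1 p.2 hp.2.2
  have h2 : dist (f p.2) (f z) < ε / 2 := hp.2.1
  linarith [dist_triangle_left (F p.1 p.2) (f z) (f p.2)]

lemma EvHolo.exists_ball {F : ℕ → ℂ → ℂ} {U : Set ℂ} (hU : IsOpen U) (h : EvHolo F U) {z : ℂ}
    (hz : z ∈ U) : ∃ r > 0, Metric.ball z r ⊆ U ∧
      ∀ᶠ j in atTop, DifferentiableOn ℂ (F j) (Metric.ball z r) := by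
  obtain ⟨N, r, hr, h1⟩ := eventually_atTop_prod_nhds_iff.1 (h z hz)
  obtain ⟨s, hs, h2⟩ := Metric.isOpen_iff.1 hU z hz
  refine ⟨min r s, lt_min hr hs, (Metric.ball_subset_ball (min_le_right _ _)).trans h2, ?_⟩
  filter_upwards [eventually_ge_atTop N] with j hj w hw
  exact (h1 j hj w (Metric.ball_subset_ball (min_le_left _ _) hw)).differentiableWithinAt

lemma ContConv.differentiableOn {F : ℕ → ℂ → ℂ} {f : ℂ → ℂ} {U : Set ℂ} (hU : IsOpen U)
    (h : ContConv F f U) (hd : EvHolo F U) : DifferentiableOn ℂ f U := by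
  intro z hz
  obtain ⟨r, hr, hrU, h1⟩ := hd.exists_ball hU hz
  have h2 := ((h.mono hrU).tendstoLocallyUniformlyOn Metric.isOpen_ball).differentiableOn h1
    Metric.isOpen_ball
  exact ((h2 z (Metric.mem_ball_self hr)).differentiableAt
    (Metric.ball_mem_nhds z hr)).differentiableWithinAt

lemma EvHolo.deriv {F : ℕ → ℂ → ℂ} {U : Set ℂ} (hU : IsOpen U) (h : EvHolo F U) :
    EvHolo (fun j => deriv (F j)) U := by
  intro z hz
  obtain ⟨r, hr, -, h1⟩ := h.exists_ball hU hz
  filter_upwards [h1.prod_mk (Metric.ball_mem_nhds z hr)] with p hp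
  exact ((hp.1.deriv Metric.isOpen_ball) p.2 hp.2).differentiableAt
    (Metric.isOpen_ball.mem_nhds hp.2)

lemma ContConv.deriv {F : ℕ → ℂ → ℂ} {f : ℂ → ℂ} {U : Set ℂ} (hU : IsOpen U)
    (h : ContConv F f U) (hd : EvHolo F U) :
    ContConv (fun j => deriv (F j)) (deriv f) U := by
  intro z hz
  obtain ⟨r, hr, hrU, h1⟩ := hd.exists_ball hU hz
  have h0 := (h.mono hrU).tendstoLocallyUniformlyOn Metric.isOpen_ball
  have h2 := h0.deriv h1 Metric.isOpen_ball
  have h3 := (h0.differentiableOn h1 Metric.isOpen_ball).deriv Metric.isOpen_ball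
  exact TendstoLocallyUniformlyOn.contConv Metric.isOpen_ball h2 h3.continuousOn z
    (Metric.mem_ball_self hr)

lemma ContConv.iteratedDeriv {F : ℕ → ℂ → ℂ} {f : ℂ → ℂ} {U : Set ℂ} (hU : IsOpen U)
    (h : ContConv F f U) (hd : EvHolo F U) (t : ℕ) :
    ContConv (fun j => iteratedDeriv t (F j)) (iteratedDeriv t f) U ∧
      EvHolo (fun j => iteratedDeriv t (F j)) U := by
  induction t with
  | zero => simpa using ⟨h, hd⟩
  | succ t ih =>
    simp only [iteratedDeriv_succ]
    exact ⟨ih.1.deriv hU ih.2, ih.2.deriv hU⟩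

lemma ContConv.exists_zero {F : ℕ → ℂ → ℂ} {f : ℂ → ℂ} {U : Set ℂ} (hU : IsOpen U)
    (h : ContConv F f U) (hd : EvHolo F U) {z : ℂ} (hz : z ∈ U) (hfz : f z = 0)
    (hne : ¬ ∀ᶠ w in 𝓝 z, f w = 0) {ε : ℝ} (hε : 0 < ε) :
    ∀ᶠ j in atTop, ∃ w ∈ Metric.ball z ε, F j w = 0 := by
  have hdf := h.differentiableOn hU hd
  have han : AnalyticAt ℂ f z := hdf.analyticAt (hU.mem_nhds hz)
  have h1 := han.eventually_eq_zero_or_eventually_ne_zero.resolve_left hne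
  obtain ⟨s, hs, h2⟩ := Metric.eventually_nhds_iff_ball.1 (eventually_nhdsWithin_iff.1 h1)
  obtain ⟨r, hr, hrU, h3⟩ := hd.exists_ball hU hz
  set t := min (min r s) ε / 2 with ht
  have htp : 0 < min (min r s) ε := lt_min (lt_min hr hs) hε
  have ht0 : 0 < t := half_pos htp
  have htlt : t < min (min r s) ε := half_lt_self htp
  have htr : t < r := htlt.trans_le ((min_le_left _ _).trans (min_le_left _ _))
  have hts : t < s := htlt.trans_le ((min_le_left _ _).trans (min_le_right _ _))
  have hte : t < ε := htlt.trans_le (min_le_right _ _)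
  have hcU : Metric.closedBall z t ⊆ U := (Metric.closedBall_subset_ball htr).trans hrU
  obtain ⟨x, hx, hxm⟩ := (isCompact_sphere z t).exists_isMinOn
    (NormedSpace.sphere_nonempty.2 ht0.le)
    ((hdf.continuousOn.mono (Metric.sphere_subset_closedBall.trans hcU)).norm)
  have hxp : 0 < ‖f x‖ := norm_pos_iff.2 <| h2 x
    (Metric.closedBall_subset_ball hts (Metric.sphere_subset_closedBall hx))
    (fun hxz => by
      have := Metric.mem_sphere.1 hx
      rw [show x = z from hxz, dist_self] at this
      exact ht0.ne this)
  have hunif := (tendstoLocallyUniformlyOn_iff_forall_isCompact hU).1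
    (h.tendstoLocallyUniformlyOn hU) _ hcU (isCompact_closedBall z t)
  rw [Metric.tendstoUniformlyOn_iff] at hunif
  filter_upwards [hunif (‖f x‖ / 2) (half_pos hxp), h3] with j hj hdj
  by_contra! hno
  have hnz : ∀ w ∈ Metric.closedBall z t, F j w ≠ 0 := fun w hw =>
    hno w (Metric.closedBall_subset_ball hte hw)
  have hdiff : DiffContOnCl ℂ (fun w => (F j w)⁻¹) (Metric.ball z t) := by
    apply DifferentiableOn.diffContOnCl
    rw [closure_ball z ht0.ne']
    exact (hdj.mono (Metric.closedBall_subset_ball htr)).inv hnz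
  have hmax := Complex.norm_le_of_forall_mem_frontier_norm_le Metric.isBounded_ball hdiff
    (C := (‖f x‖ / 2)⁻¹) (fun w hw => by
      rw [frontier_ball z ht0.ne'] at hw
      have hb := hj w (Metric.sphere_subset_closedBall hw)
      have hm : ‖f x‖ ≤ ‖f w‖ := hxm hw
      rw [dist_eq_norm] at hb
      have h5 : ‖f w‖ ≤ ‖f w - F j w‖ + ‖F j w‖ := by
        simpa using norm_add_le (f w - F j w) (F j w)
      rw [norm_inv]
      exact inv_anti₀ (half_pos hxp) (by linarith))
    (subset_closure (Metric.mem_ball_self ht0))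
  have hb := hj z (Metric.mem_closedBall_self ht0.le)
  rw [hfz, dist_zero_left] at hb
  rw [norm_inv] at hmax
  have h6 : 0 < ‖F j z‖ := norm_pos_iff.2 (hnz z (Metric.mem_closedBall_self ht0.le))
  exact absurd ((inv_le_inv₀ h6 (half_pos hxp)).1 hmax) (not_le.2 hb)

lemma iteratedDeriv_eq_zero_of_contConv {F : ℕ → ℂ → ℂ} {f : ℂ → ℂ} {U : Set ℂ} (hU : IsOpen U)
    (h : ContConv F f U) (hd : EvHolo F U) {z : ℂ} (hz : z ∈ U) (hfz : f z = 0) {s : ℕ}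
    (hF : ∀ᶠ p in (atTop : Filter ℕ) ×ˢ 𝓝 z, F p.1 p.2 = 0 → iteratedDeriv s (F p.1) p.2 = 0) :
    iteratedDeriv s f z = 0 := by
  by_cases hne : ∀ᶠ w in 𝓝 z, f w = 0
  · have : f =ᶠ[𝓝 z] fun _ => 0 := hne
    rw [Filter.EventuallyEq.iteratedDeriv_eq s this]
    simp
  by_contra hs
  have h1 := ((ContConv.iteratedDeriv hU h hd s).1 z hz).eventually_ne hs
  obtain ⟨N, r, hr, h2⟩ := eventually_atTop_prod_nhds_iff.1 (h1.and hF)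
  obtain ⟨j, ⟨w, hw, hw0⟩, hj⟩ :=
    ((h.exists_zero hU hd hz hfz hne hr).and (eventually_ge_atTop N)).exists
  exact (h2 j hj w hw).1 ((h2 j hj w hw).2 hw0)

lemma lipschitz_of_norm_le {F : ℂ → ℂ} {z : ℂ} {δ K : ℝ} (hδ : 0 < δ)
    (hF : DifferentiableOn ℂ F (Metric.ball z (2 * δ)))
    (hK : ∀ w ∈ Metric.ball z (2 * δ), ‖F w‖ ≤ K) {x y : ℂ} (hx : x ∈ Metric.ball z δ)
    (hy : y ∈ Metric.ball z δ) : ‖F y - F x‖ ≤ K / (δ / 2) * ‖y - x‖ := by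
  have hsub : Metric.ball z δ ⊆ Metric.ball z (2 * δ) := Metric.ball_subset_ball (by linarith)
  refine Convex.norm_image_sub_le_of_norm_deriv_le (𝕜 := ℂ) (s := Metric.ball z δ)
    (fun w hw => hF.differentiableAt (Metric.isOpen_ball.mem_nhds (hsub hw))) (fun w hw => ?_)
    (convex_ball z δ) hx hy
  have hcb : Metric.closedBall w (δ / 2) ⊆ Metric.ball z (2 * δ) := fun v hv => by
    have h1 := Metric.mem_closedBall.1 hv
    have h2 := Metric.mem_ball.1 hw
    exact Metric.mem_ball.2 (by linarith [dist_triangle v w z])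
  refine Complex.norm_deriv_le_of_forall_mem_sphere_norm_le (half_pos hδ) ?_
    (fun v hv => hK v (hcb (Metric.sphere_subset_closedBall hv)))
  apply DifferentiableOn.diffContOnCl
  rw [closure_ball w (half_pos hδ).ne']
  exact hF.mono hcb

/-- A locally bounded sequence of holomorphic functions converging pointwise on a dense set
converges locally uniformly. -/
lemma exists_contConv_of_bounded {F : ℕ → ℂ → ℂ} {z : ℂ} {δ K : ℝ} (hδ : 0 < δ)
    (hF : ∀ᶠ j in atTop, DifferentiableOn ℂ (F j) (Metric.ball z (2 * δ)) ∧
      ∀ w ∈ Metric.ball z (2 * δ), ‖F j w‖ ≤ K) {S : Set ℂ} (hS : Dense S)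
    (hc : ∀ s ∈ S, s ∈ Metric.ball z δ → ∃ c, Tendsto (fun j => F j s) atTop (𝓝 c)) :
    ∃ g : ℂ → ℂ, ContConv F g (Metric.ball z δ) := by
  set L : ℝ := |K / (δ / 2)| + 1 with hL
  have hLp : 0 < L := by positivity
  have hlip : ∀ᶠ j in atTop, ∀ x ∈ Metric.ball z δ, ∀ y ∈ Metric.ball z δ,
      ‖F j y - F j x‖ ≤ L * ‖y - x‖ := by
    filter_upwards [hF] with j hj x hx y hy
    refine (lipschitz_of_norm_le hδ hj.1 hj.2 hx hy).trans ?_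
    gcongr
    linarith [le_abs_self (K / (δ / 2))]
  have hlim : ∀ w ∈ Metric.ball z δ, ∃ c, Tendsto (fun j => F j w) atTop (𝓝 c) := by
    intro w hw
    apply cauchySeq_tendsto_of_complete
    rw [Metric.cauchySeq_iff']
    intro ε hε
    obtain ⟨s, hsS, hs⟩ := hS.exists_mem_open (Metric.isOpen_ball.inter
      (Metric.isOpen_ball (x := w) (ε := ε / (4 * L))))
      ⟨w, hw, Metric.mem_ball_self (by positivity)⟩
    obtain ⟨c, hcs⟩ := hc s hsS hs.1
    have h1 := hcs.eventually (Metric.ball_mem_nhds c (show 0 < ε / 8 by positivity))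
    obtain ⟨N, hN⟩ := eventually_atTop.1 (h1.and hlip)
    have hsw : L * ‖s - w‖ < ε / 4 := by
      have := Metric.mem_ball.1 hs.2
      rw [dist_eq_norm] at this
      calc L * ‖s - w‖ < L * (ε / (4 * L)) := by gcongr
        _ = ε / 4 := by field_simp
    refine ⟨N, fun j hj => ?_⟩
    have a1 := (hN j hj).2 w hw s hs.1
    have a2 := (hN N le_rfl).2 w hw s hs.1
    have a3 : dist (F j s) c < ε / 8 := (hN j hj).1
    have a4 : dist (F N s) c < ε / 8 := (hN N le_rfl).1
    rw [← dist_eq_norm] at a1 a2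
    linarith [dist_triangle_left (F j w) (F N w) (F j s), dist_triangle (F j s) (F N s) (F N w),
      dist_triangle_right (F j s) (F N s) c]
  choose! g hg using hlim
  refine ⟨g, fun w hw => ?_⟩
  rw [Metric.tendsto_nhds]
  intro ε hε
  have h1 := (hg w hw).eventually (Metric.ball_mem_nhds (g w) (half_pos hε))
  filter_upwards [(h1.and hlip).prod_mk (inter_mem
    (Metric.isOpen_ball.mem_nhds hw)
    (Metric.ball_mem_nhds w (show 0 < ε / (2 * L) by positivity)))] with p hp
  have a1 := hp.1.2 w hw p.2 hp.2.1
  have a2 : dist (F p.1 w) (g w) < ε / 2 := hp.1.1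
  have a3 : ‖p.2 - w‖ < ε / (2 * L) := by
    rw [← dist_eq_norm]; exact hp.2.2
  have a4 : L * ‖p.2 - w‖ < ε / 2 := by
    calc L * ‖p.2 - w‖ < L * (ε / (2 * L)) := by gcongr
        _ = ε / 2 := by field_simp
  rw [← dist_eq_norm] at a1
  linarith [dist_triangle (F p.1 p.2) (F p.1 w) (g w)]

/-- Growth control along segments coming from a bound on the spherical derivative. -/
lemma norm_le_add_of_spherical_deriv_le {f : ℂ → ℂ} {V : Set ℂ} (hV : Convex ℝ V) {C : ℝ}
    (hf : ∀ w ∈ V, DifferentiableAt ℂ f w ∧ ‖deriv f w‖ ≤ C * (1 + ‖f w‖ ^ 2)) (hC : 0 < C)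
    {x y : ℂ} (hx : x ∈ V) (hy : y ∈ V) (hxy : 24 * C * ‖y - x‖ ≤ 1) {s : ℝ}
    (hs : s ≤ 1) (hfx : ‖f x‖ ≤ s) : ‖f y‖ ≤ s + 1 / 8 := by
  have hs0 : 0 ≤ s := (norm_nonneg _).trans hfx
  have hseg : ∀ t ∈ Icc (0:ℝ) 1, x + t * (y - x) ∈ V := fun t ht => by
    have := hV.add_smul_sub_mem hx hy ht
    simpa using this
  have hline : ∀ t : ℝ, HasDerivAt (fun t : ℝ => x + (t : ℂ) * (y - x)) (y - x) t := fun t => by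
    simpa using ((Complex.ofRealCLM.hasDerivAt (x := t)).mul_const (y - x)).const_add x
  have hder : ∀ t ∈ Icc (0:ℝ) 1, HasDerivAt (fun t : ℝ => f (x + t * (y - x)))
      (deriv f (x + t * (y - x)) * (y - x)) t := fun t ht => by
    have h1 := (hf _ (hseg t ht)).1.hasDerivAt
    exact h1.comp (𝕜 := ℝ) (𝕜' := ℂ) t (hline t)
  have := image_norm_le_of_norm_deriv_right_lt_deriv_boundary
    (f := fun t : ℝ => f (x + t * (y - x))) (a := 0) (b := 1)
    (f' := fun t => deriv f (x + t * (y - x)) * (y - x))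
    (fun t ht => (hder t ht).continuousAt.continuousWithinAt)
    (fun t ht => (hder t ⟨ht.1, ht.2.le⟩).hasDerivWithinAt)
    (B := fun t => s + t / 8) (B' := fun _ => 1 / 8) (by simpa using hfx)
    (fun t => by simpa using ((hasDerivAt_id t).div_const 8).const_add s)
    (fun t ht heq => by
      have h1 := (hf _ (hseg t ⟨ht.1, ht.2.le⟩)).2
      rw [heq] at h1
      rw [norm_mul]
      have h2 : 1 + (s + t / 8) ^ 2 ≤ 1 + (9 / 8) ^ 2 := by
        have := ht.1; have := ht.2
        gcongr; linarith
      have h3 := mul_le_mul_of_nonneg_right (h1.trans (mul_le_mul_of_nonneg_left h2 hC.le))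
        (norm_nonneg (y - x))
      nlinarith [norm_nonneg (y - x)])
  have h2 := this (x := 1) (by simp)
  simpa using h2

/-- Every sequence of maps has a subsequence that converges in `ℂ ∪ {∞}` at each point of a given
countable set. -/
lemma exists_subseq_tendsto_or_atTop (x : ℕ → ℕ → ℂ) :
    ∃ φ : ℕ → ℕ, StrictMono φ ∧ ∀ i, (∃ c, Tendsto (fun j => x (φ j) i) atTop (𝓝 c)) ∨
      Tendsto (fun j => ‖x (φ j) i‖) atTop atTop := by
  set τ : ℂ → ℂ × ℝ := fun w => (w / ((1 + ‖w‖ ^ 2 : ℝ) : ℂ), (1 + ‖w‖ ^ 2)⁻¹) with hτ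
  have hpos : ∀ w : ℂ, 0 < 1 + ‖w‖ ^ 2 := fun w => by positivity
  have hmem : ∀ w, τ w ∈ Metric.closedBall (0 : ℂ × ℝ) 1 := by
    intro w
    rw [mem_closedBall_zero_iff, Prod.norm_def]
    refine max_le ?_ ?_
    · simp only [hτ, norm_div, Complex.norm_real, Real.norm_eq_abs, abs_of_pos (hpos w)]
      rw [div_le_one (hpos w)]
      nlinarith [sq_nonneg (‖w‖ - 1)]
    · simp only [hτ, norm_inv, Real.norm_eq_abs, abs_of_pos (hpos w)]
      exact inv_le_one_of_one_le₀ (by nlinarith [sq_nonneg ‖w‖])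
  have hcomp : IsCompact (Set.univ.pi fun _ : ℕ => Metric.closedBall (0 : ℂ × ℝ) 1) :=
    isCompact_univ_pi fun _ => isCompact_closedBall _ _
  obtain ⟨y, -, φ, hφ, hlim⟩ := hcomp.tendsto_subseq (x := fun j i => τ (x j i))
    (fun j i _ => hmem _)
  refine ⟨φ, hφ, fun i => ?_⟩
  have h1 : Tendsto (fun j => τ (x (φ j) i)) atTop (𝓝 (y i)) := (tendsto_pi_nhds.1 hlim) i
  have h2 := (continuous_fst.tendsto _).comp h1
  have h3 : Tendsto (fun j => (1 + ‖x (φ j) i‖ ^ 2)⁻¹) atTop (𝓝 (y i).2) :=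
    (continuous_snd.tendsto _).comp h1
  by_cases hy : (y i).2 = 0
  · right
    rw [hy] at h3
    have h4 : Tendsto (fun j => (1 + ‖x (φ j) i‖ ^ 2)) atTop atTop := by
      have h5 : Tendsto (fun j => (1 + ‖x (φ j) i‖ ^ 2)⁻¹) atTop (𝓝[>] 0) :=
        tendsto_nhdsWithin_iff.2 ⟨h3, Eventually.of_forall fun j => inv_pos.2 (hpos _)⟩
      exact h5.inv_tendsto_nhdsGT_zero.congr fun j => by simp
    refine tendsto_atTop.2 fun b => ?_
    filter_upwards [h4.eventually_gt_atTop (1 + b ^ 2)] with j hj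
    exact (abs_le_of_sq_le_sq' (by linarith) (norm_nonneg _)).2
  · left
    refine ⟨(y i).1 / ((y i).2 : ℂ), ?_⟩
    have h4 := h2.div ((Complex.continuous_ofReal.tendsto _).comp h3)
      (by simpa using hy)
    refine h4.congr fun j => ?_
    have := hpos (x (φ j) i)
    have h5 : ((1 + ‖x (φ j) i‖ ^ 2 : ℝ) : ℂ) ≠ 0 := by exact_mod_cast this.ne'
    simp only [hτ, Function.comp, Pi.div_apply, Complex.ofReal_inv]
    field_simp

lemma tendsto_norm_atTop_of_inv_tendsto_zero {α : Type*} {l : Filter α} {x : α → ℂ}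
    (h : Tendsto (fun p => (x p)⁻¹) l (𝓝 0)) (h0 : ∀ᶠ p in l, x p ≠ 0) :
    Tendsto (fun p => ‖x p‖) l atTop := by
  have h1 : Tendsto (fun p => ‖(x p)⁻¹‖) l (𝓝[>] 0) := tendsto_nhdsWithin_iff.2
    ⟨by simpa using h.norm, h0.mono fun p hp => norm_pos_iff.2 (inv_ne_zero hp)⟩
  exact h1.inv_tendsto_nhdsGT_zero.congr fun p => by simp

lemma marty_local {F : ℕ → ℂ → ℂ} {z : ℂ} {C : ℝ} (hC : 0 < C)
    (h : ∀ᶠ p in (atTop : Filter ℕ) ×ˢ 𝓝 z, DifferentiableAt ℂ (F p.1) p.2 ∧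
      ‖deriv (F p.1) p.2‖ ≤ C * (1 + ‖F p.1 p.2‖ ^ 2)) {S : Set ℂ} (hS : Dense S)
    (hlim : ∀ s ∈ S, (∃ c, Tendsto (fun j => F j s) atTop (𝓝 c)) ∨
      Tendsto (fun j => ‖F j s‖) atTop atTop) :
    (∀ᶠ w in 𝓝 z, ∃ c, Tendsto (fun p : ℕ × ℂ => F p.1 p.2) (atTop ×ˢ 𝓝 w) (𝓝 c)) ∨
      (∀ᶠ w in 𝓝 z, Tendsto (fun p : ℕ × ℂ => ‖F p.1 p.2‖) (atTop ×ˢ 𝓝 w) atTop) := by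
  obtain ⟨N, r, hr, hN⟩ := eventually_atTop_prod_nhds_iff.1 h
  set δ := min (r / 2) (1 / (96 * C)) with hδdef
  have hδ : 0 < δ := by positivity
  have hδr : 2 * δ ≤ r := by linarith [min_le_left (r / 2) (1 / (96 * C))]
  have hδC : 24 * C * (4 * δ) ≤ 1 := by
    have : δ ≤ 1 / (96 * C) := min_le_right _ _
    rw [le_div_iff₀ (by positivity)] at this
    linarith
  set V := Metric.ball z (2 * δ) with hV
  have hN' : ∀ j ≥ N, ∀ w ∈ V, DifferentiableAt ℂ (F j) w ∧
      ‖deriv (F j) w‖ ≤ C * (1 + ‖F j w‖ ^ 2) := fun j hj w hw =>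
    hN j hj w (Metric.ball_subset_ball hδr hw)
  have hgrow : ∀ j ≥ N, ∀ x ∈ V, ∀ y ∈ V, ∀ s ≤ (1:ℝ), ‖F j x‖ ≤ s → ‖F j y‖ ≤ s + 1 / 8 := by
    intro j hj x hx y hy s hs hfx
    refine norm_le_add_of_spherical_deriv_le (convex_ball z _) (hN' j hj) hC hx hy ?_ hs hfx
    refine le_trans ?_ hδC
    gcongr
    have h1 := Metric.mem_ball.1 hx
    have h2 := Metric.mem_ball.1 hy
    rw [← dist_eq_norm]
    linarith [dist_triangle_right y x z]
  have hsub : Metric.ball z δ ⊆ V := Metric.ball_subset_ball (by linarith)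
  obtain ⟨s, hsS, hs⟩ := hS.exists_mem_open (Metric.isOpen_ball (x := z) (ε := δ))
    ⟨z, Metric.mem_ball_self hδ⟩
  have hcase : (∀ᶠ j in atTop, ‖F j s‖ ≤ 1) ∨ (∀ᶠ j in atTop, 1 / 2 < ‖F j s‖) := by
    rcases hlim s hsS with ⟨c, hc⟩ | hinf
    · rcases le_or_gt ‖c‖ (3 / 4) with h1 | h1
      · exact Or.inl ((hc.norm.eventually_lt_const (show ‖c‖ < 1 by linarith)).mono
          fun j hj => hj.le)
      · exact Or.inr (hc.norm.eventually_const_lt (show 1 / 2 < ‖c‖ by linarith))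
    · exact Or.inr (hinf.eventually_gt_atTop _)
  have hmemδ : ∀ᶠ w in 𝓝 z, w ∈ Metric.ball z δ := Metric.ball_mem_nhds z hδ
  rcases hcase with hle | hgt
  · left
    have hb : ∀ᶠ j in atTop, ∀ w ∈ V, ‖F j w‖ ≤ 9 / 8 := by
      filter_upwards [hle, eventually_ge_atTop N] with j hj hjN w hw
      have := hgrow j hjN s (hsub hs) w hw 1 le_rfl hj
      linarith
    obtain ⟨g, hg⟩ := exists_contConv_of_bounded hδ (F := F) (K := 9 / 8) (z := z) (by
      filter_upwards [hb, eventually_ge_atTop N] with j hj hjN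
      exact ⟨fun w hw => (hN' j hjN w hw).1.differentiableWithinAt, hj⟩) hS (by
      intro t htS ht
      refine (hlim t htS).resolve_right fun hinf => ?_
      obtain ⟨j, h1, h2⟩ := ((hinf.eventually_gt_atTop (9 / 8)).and hb).exists
      exact absurd (h2 t (hsub ht)) (not_le.2 h1))
    exact hmemδ.mono fun w hw => ⟨g w, hg w hw⟩
  · have hb : ∀ᶠ j in atTop, ∀ w ∈ V, 3 / 8 < ‖F j w‖ := by
      filter_upwards [hgt, eventually_ge_atTop N] with j hj hjN w hw
      by_contra! hw'
      have := hgrow j hjN w hw s (hsub hs) (3 / 8) (by norm_num) hw'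
      linarith
    have hb0 : ∀ᶠ j in atTop, ∀ w ∈ V, F j w ≠ 0 := hb.mono fun j hj w hw => by
      have := hj w hw
      exact norm_pos_iff.1 (by linarith)
    have hbd : ∀ᶠ j in atTop, DifferentiableOn ℂ (fun w => (F j w)⁻¹) V := by
      filter_upwards [hb0, eventually_ge_atTop N] with j hj hjN
      exact fun w hw => ((hN' j hjN w hw).1.inv (hj w hw)).differentiableWithinAt
    obtain ⟨g, hg⟩ := exists_contConv_of_bounded hδ (F := fun j w => (F j w)⁻¹) (K := 8 / 3)
      (z := z) (by
        filter_upwards [hb, hbd] with j hj hjd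
        refine ⟨hjd, fun w hw => ?_⟩
        rw [norm_inv, inv_le_comm₀ (by linarith [hj w hw]) (by norm_num)]
        linarith [hj w hw]) hS (by
        intro t htS ht
        rcases hlim t htS with ⟨c, hc⟩ | hinf
        · refine ⟨c⁻¹, hc.inv₀ ?_⟩
          have h1 : 3 / 8 ≤ ‖c‖ := ge_of_tendsto hc.norm (hb.mono fun j hj => (hj t (hsub ht)).le)
          exact norm_pos_iff.1 (by linarith)
        · refine ⟨0, tendsto_zero_iff_norm_tendsto_zero.2 ?_⟩
          exact hinf.inv_tendsto_atTop.congr fun j => by simp)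
    have hne : ∀ w ∈ V, ∀ᶠ p in (atTop : Filter ℕ) ×ˢ 𝓝 w, F p.1 p.2 ≠ 0 := fun w hw =>
      (hb0.prod_mk (Metric.isOpen_ball.mem_nhds hw)).mono fun p hp => hp.1 p.2 hp.2
    have hev : EvHolo (fun j w => (F j w)⁻¹) (Metric.ball z δ) := fun w hw =>
      (hbd.prod_mk (Metric.isOpen_ball.mem_nhds (hsub hw))).mono fun p hp =>
        hp.1.differentiableAt (Metric.isOpen_ball.mem_nhds hp.2)
    by_cases hgz : g z = 0
    · right
      have hloc : ∀ᶠ w in 𝓝 z, g w = 0 := by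
        by_contra hnot
        obtain ⟨j, ⟨w, hw, hw0⟩, hj⟩ := ((hg.exists_zero Metric.isOpen_ball hev
          (Metric.mem_ball_self hδ) hgz hnot hδ).and hb0).exists
        exact hj w (hsub hw) (inv_eq_zero.1 hw0)
      filter_upwards [hloc, hmemδ] with w hw hwδ
      have h1 := hg w hwδ
      rw [hw] at h1
      exact tendsto_norm_atTop_of_inv_tendsto_zero h1 (hne w (hsub hwδ))
    · left
      have hcont := (hg.differentiableOn Metric.isOpen_ball hev).continuousOn.continuousAt
        (Metric.ball_mem_nhds z hδ)
      filter_upwards [hcont.eventually_ne hgz, hmemδ] with w hw hwδ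
      exact ⟨(g w)⁻¹, by simpa using (hg w hwδ).inv₀ hw⟩

/-- **Marty's criterion** (sequential form). -/
theorem marty {F : ℕ → ℂ → ℂ} {U : Set ℂ} (hconn : IsPreconnected U)
    (h : ∀ z ∈ U, ∃ C : ℝ, 0 < C ∧ ∀ᶠ p in (atTop : Filter ℕ) ×ˢ 𝓝 z,
      DifferentiableAt ℂ (F p.1) p.2 ∧ ‖deriv (F p.1) p.2‖ ≤ C * (1 + ‖F p.1 p.2‖ ^ 2)) :
    ∃ φ : ℕ → ℕ, StrictMono φ ∧ ((∃ g, ContConv (fun j => F (φ j)) g U) ∨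
      ∀ z ∈ U, Tendsto (fun p : ℕ × ℂ => ‖F (φ p.1) p.2‖) (atTop ×ˢ 𝓝 z) atTop) := by
  obtain ⟨φ, hφ, hlim⟩ := exists_subseq_tendsto_or_atTop
    (fun j i => F j (TopologicalSpace.denseSeq ℂ i))
  refine ⟨φ, hφ, ?_⟩
  set A : Set ℂ := {z | ∀ᶠ w in 𝓝 z, ∃ c,
    Tendsto (fun p : ℕ × ℂ => F (φ p.1) p.2) (atTop ×ˢ 𝓝 w) (𝓝 c)} with hA
  set B : Set ℂ := {z | ∀ᶠ w in 𝓝 z,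
    Tendsto (fun p : ℕ × ℂ => ‖F (φ p.1) p.2‖) (atTop ×ˢ 𝓝 w) atTop} with hB
  have hcover : U ⊆ A ∪ B := by
    intro z hz
    obtain ⟨C, hC, hev⟩ := h z hz
    refine marty_local (F := fun j => F (φ j)) hC ?_ (TopologicalSpace.denseRange_denseSeq ℂ) ?_
    · exact (hφ.tendsto_atTop.prodMap tendsto_id).eventually hev
    · rintro _ ⟨i, rfl⟩
      exact hlim i
  have hdisj : Disjoint A B := by
    rw [Set.disjoint_left]
    intro z hzA hzB
    obtain ⟨c, hc⟩ := hzA.self_of_nhds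
    exact not_tendsto_nhds_of_tendsto_atTop hzB.self_of_nhds _ hc.norm
  rcases hconn.subset_or_subset isOpen_setOfPred_eventually_nhds isOpen_setOfPred_eventually_nhds hdisj
    hcover with h1 | h1
  · left
    have h2 : ∀ z ∈ U, ∃ c, Tendsto (fun p : ℕ × ℂ => F (φ p.1) p.2) (atTop ×ˢ 𝓝 z) (𝓝 c) :=
      fun z hz => (h1 hz).self_of_nhds
    choose! g hg using h2
    exact ⟨g, hg⟩
  · right
    exact fun z hz => (h1 hz).self_of_nhds

/-- The rescaling of `h` at `w` with scale `ρ` and exponent `α`. -/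
def pangRescale (α : ℝ) (h : ℂ → ℂ) (w : ℂ) (ρ : ℝ) : ℂ → ℂ :=
  fun ξ => ((ρ ^ (-α) : ℝ) : ℂ) * h (w + ρ * ξ)

/-- The rescaled function has spherical derivative at least one at the origin. -/
def PangLarge (α : ℝ) (h : ℂ → ℂ) (w : ℂ) (ρ : ℝ) : Prop :=
  1 + (ρ ^ (-α) * ‖h w‖) ^ 2 ≤ ρ ^ (1 - α) * ‖deriv h w‖

lemma hasDerivAt_pangRescale {α : ℝ} {h : ℂ → ℂ} {w : ℂ} {ρ : ℝ} (hρ : 0 < ρ) {ξ : ℂ}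
    (hd : DifferentiableAt ℂ h (w + ρ * ξ)) :
    HasDerivAt (pangRescale α h w ρ) (((ρ ^ (1 - α) : ℝ) : ℂ) * deriv h (w + ρ * ξ)) ξ := by
  have h1 : HasDerivAt (fun ξ : ℂ => w + ρ * ξ) (ρ : ℂ) ξ := by
    simpa using ((hasDerivAt_id ξ).const_mul (ρ : ℂ)).const_add w
  have h2 := (hd.hasDerivAt.comp ξ h1).const_mul ((ρ ^ (-α) : ℝ) : ℂ)
  refine h2.congr_deriv ?_
  have : ρ ^ (1 - α) = ρ ^ (-α) * ρ := by
    rw [← Real.rpow_add_one hρ.ne']; ring_nf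
  rw [this]; push_cast; ring

lemma norm_pangRescale {α : ℝ} {h : ℂ → ℂ} {w : ℂ} {ρ : ℝ} (hρ : 0 < ρ) (ξ : ℂ) :
    ‖pangRescale α h w ρ ξ‖ = ρ ^ (-α) * ‖h (w + ρ * ξ)‖ := by
  simp [pangRescale, abs_of_pos (Real.rpow_pos_of_pos hρ _)]

lemma norm_deriv_pangRescale {α : ℝ} {h : ℂ → ℂ} {w : ℂ} {ρ : ℝ} (hρ : 0 < ρ) {ξ : ℂ}
    (hd : DifferentiableAt ℂ h (w + ρ * ξ)) :
    ‖deriv (pangRescale α h w ρ) ξ‖ = ρ ^ (1 - α) * ‖deriv h (w + ρ * ξ)‖ := by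
  rw [(hasDerivAt_pangRescale hρ hd).deriv]
  simp [abs_of_pos (Real.rpow_pos_of_pos hρ _)]

lemma le_of_not_pangLarge {α : ℝ} (hα0 : 0 ≤ α) (hα1 : α < 1) {h : ℂ → ℂ} {w : ℂ} {ρ : ℝ}
    (hρ : 0 < ρ) (hE : ¬ PangLarge α h w (ρ / 5)) :
    ρ ^ (1 - α) * ‖deriv h w‖ ≤ 25 * (1 + (ρ ^ (-α) * ‖h w‖) ^ 2) := by
  rw [PangLarge, not_le, Real.div_rpow hρ.le (by norm_num), Real.div_rpow hρ.le (by norm_num)] at hE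
  have e1 : (5:ℝ) ^ (-α) = (5 ^ α)⁻¹ := Real.rpow_neg (by norm_num) _
  have e2 : (5:ℝ) ^ (1 - α) = 5 / 5 ^ α := by
    rw [Real.rpow_sub (by norm_num), Real.rpow_one]
  set s := (5:ℝ) ^ α with hs
  have hs1 : 1 ≤ s := Real.one_le_rpow (by norm_num) hα0
  have hs5 : s ≤ 5 := by
    calc s ≤ 5 ^ (1:ℝ) := Real.rpow_le_rpow_of_exponent_le (by norm_num) hα1.le
      _ = 5 := by simp
  rw [e1, e2] at hE
  set A := ρ ^ (1 - α) * ‖deriv h w‖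
  set B := ρ ^ (-α) * ‖h w‖
  have hs0 : 0 < s := by linarith
  have h1 : A * s / 5 < 1 + (s * B) ^ 2 := by
    have l1 : ρ ^ (1 - α) / (5 / s) * ‖deriv h w‖ = A * s / 5 := by
      simp only [A]; field_simp
    have l2 : ρ ^ (-α) / s⁻¹ * ‖h w‖ = s * B := by
      simp only [B]; field_simp
    rw [← l1, ← l2]; exact hE
  have h2 : A * s / 5 < s ^ 2 * (1 + B ^ 2) := by nlinarith
  have h3 : A / 5 < s * (1 + B ^ 2) := by
    by_contra! hcon
    nlinarith
  nlinarith [sq_nonneg B]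

/-- Selection of the centre and the scale in the rescaling argument. -/
lemma exists_pangLarge_minimal {α : ℝ} (hα1 : α < 1) {h : ℂ → ℂ} {z₀ : ℂ} {r : ℝ} (hr : 0 < r)
    {D : Set ℂ} (hD : IsOpen D) (hsub : Metric.closedBall z₀ r ⊆ D) (hd : DifferentiableOn ℂ h D)
    {w₁ : ℂ} {ρ₁ : ℝ} (hρ₁ : 0 < ρ₁) (hw₁ : dist w₁ z₀ ≤ r / 2) (hE : PangLarge α h w₁ ρ₁) :
    ∃ w ρ, 0 < ρ ∧ dist w z₀ < r ∧ ρ ≤ 4 * ρ₁ / r * (r - dist w z₀) ∧ PangLarge α h w ρ ∧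
      ∀ z, dist z w ≤ (r - dist w z₀) / 2 → ¬ PangLarge α h z (ρ / 5) := by
  obtain ⟨B, hB⟩ := (isCompact_closedBall z₀ r).exists_bound_of_continuousOn
    ((hd.deriv hD).continuousOn.mono hsub)
  have hB0 : 0 ≤ B := (norm_nonneg _).trans (hB z₀ (Metric.mem_closedBall_self hr.le))
  set S : Set ℝ := {t | ∃ z ρ, 0 < ρ ∧ dist z z₀ < r ∧ PangLarge α h z ρ ∧ t = ρ / (r - dist z z₀)}
  set β : ℝ := ((B + 1)⁻¹) ^ (1 / (1 - α)) with hβ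
  have hβ0 : 0 < β := by positivity
  have hlow : ∀ t ∈ S, β / r ≤ t := by
    rintro t ⟨z, ρ, hρ, hz, hzE, rfl⟩
    have h1 : 1 ≤ ρ ^ (1 - α) * (B + 1) := by
      have h2 := hB z hz.le
      have h3 : 0 < ρ ^ (1 - α) := Real.rpow_pos_of_pos hρ _
      have h4 : 1 ≤ ρ ^ (1 - α) * ‖deriv h z‖ := le_trans (by nlinarith [sq_nonneg (ρ ^ (-α) * ‖h z‖)]) hzE
      nlinarith
    have h2 : β ≤ ρ := by
      have h3 : (B + 1)⁻¹ ≤ ρ ^ (1 - α) := by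
        rw [inv_le_iff_one_le_mul₀ (by linarith)]; exact h1
      have h4 := Real.rpow_le_rpow (by positivity) h3
        (show 0 ≤ 1 / (1 - α) from one_div_nonneg.2 (by linarith))
      rwa [← Real.rpow_mul hρ.le, mul_one_div_cancel (by linarith), Real.rpow_one] at h4
    have h5 : 0 < r - dist z z₀ := by linarith
    have h6 : r - dist z z₀ ≤ r := by linarith [dist_nonneg (x := z) (y := z₀)]
    gcongr
  have hbdd : BddBelow S := ⟨_, hlow⟩
  have hmem₁ : ρ₁ / (r - dist w₁ z₀) ∈ S := ⟨w₁, ρ₁, hρ₁, by linarith, hE, rfl⟩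
  have hlam : 0 < sInf S := lt_of_lt_of_le (by positivity) (le_csInf ⟨_, hmem₁⟩ hlow)
  obtain ⟨t, ⟨w, ρ, hρ, hw, hwE, rfl⟩, ht⟩ :=
    exists_lt_of_csInf_lt ⟨_, hmem₁⟩ (show sInf S < 2 * sInf S by linarith)
  have hdw : 0 < r - dist w z₀ := by linarith
  have hmem₁' := csInf_le hbdd hmem₁
  refine ⟨w, ρ, hρ, hw, ?_, hwE, fun z hz hzE => ?_⟩
  · have h1 : ρ₁ / (r - dist w₁ z₀) ≤ ρ₁ / (r / 2) := by
      gcongr; linarith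
    have h2 : ρ / (r - dist w z₀) ≤ 4 * ρ₁ / r := by
      have : ρ₁ / (r / 2) = 2 * ρ₁ / r := by field_simp
      have h3 : 4 * ρ₁ / r = 2 * (2 * ρ₁ / r) := by ring
      linarith
    rwa [div_le_iff₀ hdw] at h2
  · have hdz : (r - dist w z₀) / 2 ≤ r - dist z z₀ := by
      linarith [dist_triangle z w z₀]
    have h1 := csInf_le hbdd (show ρ / 5 / (r - dist z z₀) ∈ S from
      ⟨z, ρ / 5, by positivity, by linarith, hzE, rfl⟩)
    have h2 : ρ / 5 / (r - dist z z₀) ≤ ρ / 5 / ((r - dist w z₀) / 2) := by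
      gcongr
    have h3 : ρ / 5 / ((r - dist w z₀) / 2) = 2 / 5 * (ρ / (r - dist w z₀)) := by
      field_simp
    linarith

/-- **Zalcman–Pang rescaling** for sequences of holomorphic functions. -/
theorem zalcman_pang {α : ℝ} (hα0 : 0 ≤ α) (hα1 : α < 1) {D : Set ℂ} (hD : IsOpen D)
    (hconn : IsPreconnected D) {f : ℕ → ℂ → ℂ} (hf : ∀ j, DifferentiableOn ℂ (f j) D)
    (hnot : ¬ ∃ φ : ℕ → ℕ, StrictMono φ ∧ ((∃ g, ContConv (fun j => f (φ j)) g D) ∨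
      ∀ z ∈ D, Tendsto (fun p : ℕ × ℂ => ‖f (φ p.1) p.2‖) (atTop ×ˢ 𝓝 z) atTop)) :
    ∃ (h : ℕ → ℂ → ℂ) (w : ℕ → ℂ) (ρ : ℕ → ℝ) (g : ℂ → ℂ), (∀ m, h m ∈ Set.range f) ∧
      (∀ m, 0 < ρ m) ∧ (∀ R : ℝ, ∀ᶠ m in atTop, ∀ ξ : ℂ, ‖ξ‖ ≤ R → w m + ρ m * ξ ∈ D) ∧
      ContConv (fun m => pangRescale α (h m) (w m) (ρ m)) g univ ∧
      EvHolo (fun m => pangRescale α (h m) (w m) (ρ m)) univ ∧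
      deriv g 0 ≠ 0 ∧ ∀ ξ, ‖deriv g ξ‖ ≤ 25 * (1 + ‖g ξ‖ ^ 2) := by
  have hmarty : ∃ z₀ ∈ D, ∀ ρ₀ : ℝ, 0 < ρ₀ → ∃ᶠ p in (atTop : Filter ℕ) ×ˢ 𝓝 z₀,
      ∃ ρ, 0 < ρ ∧ ρ < ρ₀ ∧ PangLarge α (f p.1) p.2 ρ := by
    by_contra! hcon
    refine hnot (marty hconn fun z hz => ?_)
    obtain ⟨ρ₀, hρ₀, hev⟩ := hcon z hz
    set t := ρ₀ / 2 with ht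
    have ht0 : 0 < t := by positivity
    have h1 : 0 < t ^ (1 - α) := Real.rpow_pos_of_pos ht0 _
    have h2 : 0 < t ^ (-α) := Real.rpow_pos_of_pos ht0 _
    refine ⟨(1 + (t ^ (-α)) ^ 2) / t ^ (1 - α), by positivity, ?_⟩
    filter_upwards [hev, (Eventually.of_forall (fun j : ℕ => trivial) :
      ∀ᶠ _ in (atTop : Filter ℕ), True).prod_mk (hD.mem_nhds hz)] with p hp hpD
    refine ⟨(hf p.1).differentiableAt (hD.mem_nhds hpD.2), ?_⟩
    have h3 := hp t ht0 (by linarith)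
    rw [PangLarge, not_le] at h3
    rw [div_mul_eq_mul_div, le_div_iff₀ h1]
    nlinarith [sq_nonneg (t ^ (-α)), sq_nonneg ‖f p.1 p.2‖, mul_pow (t ^ (-α)) ‖f p.1 p.2‖ 2]
  obtain ⟨z₀, hz₀, hfreq⟩ := hmarty
  obtain ⟨r, hr, hrD⟩ := Metric.nhds_basis_closedBall.mem_iff.1 (hD.mem_nhds hz₀)
  have hstep : ∀ m : ℕ, ∃ (h : ℂ → ℂ) (w : ℂ) (ρ : ℝ), h ∈ Set.range f ∧ 0 < ρ ∧
      dist w z₀ < r ∧ ρ * (m + 1) ≤ (r - dist w z₀) / 2 ∧ PangLarge α h w ρ ∧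
      ∀ z, dist z w ≤ (r - dist w z₀) / 2 → ¬ PangLarge α h z (ρ / 5) := by
    intro m
    have hm : (0:ℝ) < m + 1 := by positivity
    obtain ⟨p, ⟨ρ₁, hρ₁, hρlt, hE⟩, -, hp⟩ := ((hfreq (r / (8 * (m + 1))) (by positivity)).and_eventually
      ((Eventually.of_forall (fun j : ℕ => trivial) : ∀ᶠ _ in (atTop : Filter ℕ), True).prod_mk
        (Metric.closedBall_mem_nhds z₀ (half_pos hr)))).exists
    obtain ⟨w, ρ, h1, h2, h3, h4, h5⟩ := exists_pangLarge_minimal hα1 hr hD hrD (hf p.1) hρ₁ hp hE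
    refine ⟨f p.1, w, ρ, ⟨_, rfl⟩, h1, h2, ?_, h4, h5⟩
    have h6 : 4 * ρ₁ / r ≤ 1 / (2 * (m + 1)) := by
      rw [lt_div_iff₀ (by positivity)] at hρlt
      rw [div_le_div_iff₀ hr (by positivity)]
      nlinarith
    have h7 : ρ ≤ 1 / (2 * (m + 1)) * (r - dist w z₀) :=
      h3.trans (mul_le_mul_of_nonneg_right h6 (by linarith))
    calc ρ * (m + 1) ≤ 1 / (2 * (m + 1)) * (r - dist w z₀) * (m + 1) := by gcongr
      _ = (r - dist w z₀) / 2 := by field_simp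
  choose h w ρ hh hρ hw hρm hE hnE using hstep
  set G : ℕ → ℂ → ℂ := fun m => pangRescale α (h m) (w m) (ρ m) with hG
  have hdist : ∀ (m : ℕ) (ξ : ℂ), ‖ξ‖ ≤ m + 1 → dist (w m + ρ m * ξ) (w m) ≤ (r - dist (w m) z₀) / 2 := by
    intro m ξ hξ
    rw [dist_eq_norm, add_sub_cancel_left, norm_mul, Complex.norm_real, Real.norm_eq_abs,
      abs_of_pos (hρ m)]
    exact (mul_le_mul_of_nonneg_left hξ (hρ m).le).trans (hρm m)
  have hinD : ∀ (m : ℕ) (ξ : ℂ), ‖ξ‖ ≤ m + 1 → w m + ρ m * ξ ∈ D := fun m ξ hξ => by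
    refine hrD (Metric.mem_closedBall.2 ?_)
    linarith [dist_triangle (w m + ρ m * ξ) (w m) z₀, hdist m ξ hξ, hw m]
  have hdiff : ∀ (m : ℕ) (ξ : ℂ), ‖ξ‖ ≤ m + 1 → DifferentiableAt ℂ (h m) (w m + ρ m * ξ) := by
    intro m ξ hξ
    obtain ⟨j, hj⟩ := hh m
    rw [← hj]
    exact (hf j).differentiableAt (hD.mem_nhds (hinD m ξ hξ))
  have hGd : ∀ (m : ℕ) (ξ : ℂ), ‖ξ‖ ≤ m + 1 → DifferentiableAt ℂ (G m) ξ := fun m ξ hξ =>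
    (hasDerivAt_pangRescale (hρ m) (hdiff m ξ hξ)).differentiableAt
  have hGb : ∀ (m : ℕ) (ξ : ℂ), ‖ξ‖ ≤ m + 1 → ‖deriv (G m) ξ‖ ≤ 25 * (1 + ‖G m ξ‖ ^ 2) := by
    intro m ξ hξ
    rw [hG]
    simp only
    rw [norm_deriv_pangRescale (hρ m) (hdiff m ξ hξ), norm_pangRescale (hρ m)]
    exact le_of_not_pangLarge hα0 hα1 (hρ m) (hnE m _ (hdist m ξ hξ))
  have hG0 : ∀ m, 1 + ‖G m 0‖ ^ 2 ≤ ‖deriv (G m) 0‖ := by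
    intro m
    have h0 : ‖(0:ℂ)‖ ≤ m + 1 := by simp; positivity
    rw [hG]
    simp only
    rw [norm_deriv_pangRescale (hρ m) (hdiff m 0 h0), norm_pangRescale (hρ m)]
    simpa [PangLarge] using hE m
  have hbig : ∀ z : ℂ, ∀ᶠ p in (atTop : Filter ℕ) ×ˢ 𝓝 z, ‖p.2‖ ≤ (p.1 : ℝ) + 1 := by
    intro z
    have h1 : ∀ᶠ j : ℕ in atTop, ‖z‖ + 1 ≤ (j : ℝ) :=
      tendsto_natCast_atTop_atTop.eventually_ge_atTop _
    have h2 : ∀ᶠ v in 𝓝 z, ‖v‖ < ‖z‖ + 1 := continuous_norm.continuousAt.eventually_lt_const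
      (by linarith)
    filter_upwards [h1.prod_mk h2] with p hp
    linarith [hp.1, hp.2]
  obtain ⟨φ, hφ, hcase⟩ := marty (F := G) (U := univ) isPreconnected_univ (fun z _ =>
    ⟨25, by norm_num, (hbig z).mono fun p hp => ⟨hGd _ _ hp, hGb _ _ hp⟩⟩)
  have hφt := hφ.tendsto_atTop
  have hpt : ∀ z : ℂ, Tendsto (Prod.map φ id : ℕ × ℂ → ℕ × ℂ) (atTop ×ˢ 𝓝 z) (atTop ×ˢ 𝓝 z) :=
    fun z => hφt.prodMap tendsto_id
  have hev : EvHolo (fun m => G (φ m)) univ := fun z _ =>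
    (hpt z).eventually ((hbig z).mono fun p hp => hGd _ _ hp)
  rcases hcase with ⟨g, hg⟩ | hinf
  · have hg' := ContConv.deriv isOpen_univ hg hev
    refine ⟨fun m => h (φ m), fun m => w (φ m), fun m => ρ (φ m), g, fun m => hh _, fun m => hρ _,
      fun R => ?_, hg, hev, ?_, fun ξ => ?_⟩
    · filter_upwards [(tendsto_natCast_atTop_atTop.comp hφt).eventually_ge_atTop R] with m hm ξ hξ
      refine hinD _ _ (hξ.trans ?_)
      simp only [Function.comp] at hm
      linarith
    · have h1 : 1 ≤ ‖deriv g 0‖ := ge_of_tendsto (hg'.tendsto_apply (mem_univ 0)).norm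
        (Eventually.of_forall fun m => by nlinarith [hG0 (φ m), sq_nonneg ‖G (φ m) 0‖])
      intro h0
      rw [h0, norm_zero] at h1
      linarith
    · refine le_of_tendsto_of_tendsto (hg'.tendsto_apply (mem_univ ξ)).norm
        ((((hg.tendsto_apply (mem_univ ξ)).norm.pow 2).const_add 1).const_mul 25) ?_
      have := (tendsto_atTop_prod_nhds_left ξ).eventually ((hpt ξ).eventually (hbig ξ))
      exact this.mono fun m hm => hGb _ _ hm
  · exfalso
    have hne : ∀ z : ℂ, ∀ᶠ p in (atTop : Filter ℕ) ×ˢ 𝓝 z, G (φ p.1) p.2 ≠ 0 := fun z =>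
      ((hinf z (mem_univ z)).eventually_gt_atTop 0).mono fun p hp => norm_pos_iff.1 hp
    have hinv : ContConv (fun m ξ => (G (φ m) ξ)⁻¹) (fun _ => 0) univ := fun z hz => by
      refine tendsto_zero_iff_norm_tendsto_zero.2 ?_
      exact (hinf z hz).inv_tendsto_atTop.congr fun p => by simp
    have hevi : EvHolo (fun m ξ => (G (φ m) ξ)⁻¹) univ := fun z hz => by
      filter_upwards [hne z, hev z hz] with p h1 h2 using h2.inv h1
    have h1 := (ContConv.deriv isOpen_univ hinv hevi).tendsto_apply (mem_univ 0)
    simp only [deriv_const] at h1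
    have h2 : ∀ᶠ m in atTop, 1 ≤ ‖deriv (fun ξ => (G (φ m) ξ)⁻¹) 0‖ := by
      filter_upwards [(tendsto_atTop_prod_nhds_left 0).eventually (hne 0)] with m hm
      rw [deriv_fun_inv'' (hGd _ _ (by simp; positivity)) hm, norm_div, norm_neg, norm_pow]
      have := hG0 (φ m)
      rw [one_le_div (pow_pos (norm_pos_iff.2 hm) 2)]
      linarith
    have h3 := ge_of_tendsto h1.norm h2
    simp at h3
    linarith

/-- The differential monomial `fⁿ (f^{n₁})^{(t₁)} ⋯ (f^{n_k})^{(t_k)}`. -/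
def diffMonomial (n : ℕ) {k : ℕ} (nn tt : Fin k → ℕ) (f : ℂ → ℂ) : ℂ → ℂ :=
  fun z => (f z) ^ n * ∏ j, iteratedDeriv (tt j) (f ^ (nn j)) z

lemma iteratedDeriv_eq_zero_of_le_merOrder {f : ℂ → ℂ} {z : ℂ} {l : ℕ∞} (hf : AnalyticAt ℂ f z)
    (hfz : f z = 0) (hl : 2 ≤ l) (h : l.map (fun x : ℕ => (x : ℤ)) ≤ merOrder f z) {s : ℕ}
    (hs : (s : ℕ∞) < l) : iteratedDeriv s f z = 0 := by
  rw [merOrder] at h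
  split_ifs at h with h1 h2
  · have h3 : f =ᶠ[𝓝 z] fun _ => 0 := by
      rw [eventually_nhdsWithin_iff] at h1
      filter_upwards [h1] with w hw
      by_cases hwz : w = z
      · rw [hwz, hfz]
      · exact hw hwz
    rw [h3.iteratedDeriv_eq s]
    simp
  · obtain ⟨g, hg, hgz, hev⟩ := h2.choose_spec
    set N := h2.choose
    have hlt : l ≠ ⊤ := by
      rintro rfl
      simp at h
    lift l to ℕ using hlt
    have h3 : (l : ℤ) ≤ N := WithTop.coe_le_coe.1 h
    have hl2 : 2 ≤ l := by exact_mod_cast hl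
    have hsl : s < l := by exact_mod_cast hs
    have hev' : ∀ᶠ w in 𝓝 z, f w = (w - z) ^ (N.toNat) • g w := by
      rw [eventually_nhdsWithin_iff] at hev
      filter_upwards [hev] with w hw
      by_cases hwz : w = z
      · rw [hwz, hfz, sub_self, zero_pow (by omega), zero_smul]
      · have := hw hwz
        rw [this, smul_eq_mul, ← zpow_natCast, Int.toNat_of_nonneg (by omega)]
    have h4 := (natCast_le_analyticOrderAt hf).2 ⟨g, hg, hev'⟩
    exact (natCast_le_analyticOrderAt_iff_iteratedDeriv_eq_zero hf).1 h4 s (by omega)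
  · exfalso
    induction l with
    | top => simp at h
    | coe l =>
      have hl2 : 2 ≤ l := by exact_mod_cast hl
      have h3 : (l : ℤ) ≤ 0 := by simpa using h
      omega

lemma iteratedDeriv_const_mul_comp_affine (F : ℂ → ℂ) (C w ρ : ℂ) (t : ℕ) :
    iteratedDeriv t (fun ξ => C * F (w + ρ * ξ)) =
      fun ξ => C * ρ ^ t * iteratedDeriv t F (w + ρ * ξ) := by
  induction t with
  | zero => simp
  | succ t ih =>
    rw [iteratedDeriv_succ, ih]
    ext ξ
    rw [deriv_const_mul_field, deriv_comp_mul_left ρ (fun v => iteratedDeriv t F (w + v)) ξ,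
      deriv_comp_const_add, iteratedDeriv_succ]
    simp only [smul_eq_mul]
    ring

lemma diffMonomial_pangRescale {n k : ℕ} {nn tt : Fin k → ℕ} {α ρ : ℝ} (hρ : 0 < ρ)
    (hα : α * (n + ∑ j, (nn j : ℝ)) = ∑ j, (tt j : ℝ)) (h : ℂ → ℂ) (w : ℂ) :
    diffMonomial n nn tt (pangRescale α h w ρ) =
      fun ξ => 1 * diffMonomial n nn tt h (w + ρ * ξ) := by
  ext ξ
  set c : ℂ := ((ρ ^ (-α) : ℝ) : ℂ) with hc
  have h1 : ∀ j, iteratedDeriv (tt j) (pangRescale α h w ρ ^ nn j) ξ =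
      c ^ nn j * (ρ : ℂ) ^ tt j * iteratedDeriv (tt j) (h ^ nn j) (w + ρ * ξ) := by
    intro j
    have : pangRescale α h w ρ ^ nn j = fun ξ => c ^ nn j * (h ^ nn j) (w + ρ * ξ) := by
      ext v
      simp [pangRescale, mul_pow, hc]
    rw [this, iteratedDeriv_const_mul_comp_affine]
  have h2 : c ^ n * ∏ j, (c ^ nn j * (ρ : ℂ) ^ tt j) = 1 := by
    have : (ρ ^ (-α)) ^ n * ∏ j, ((ρ ^ (-α)) ^ nn j * ρ ^ tt j) = 1 := by
      rw [Finset.prod_mul_distrib, Finset.prod_pow_eq_pow_sum, Finset.prod_pow_eq_pow_sum,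
        ← mul_assoc, ← pow_add, ← Real.rpow_natCast, ← Real.rpow_natCast, ← Real.rpow_mul hρ.le,
        ← Real.rpow_add hρ]
      push_cast
      rw [neg_mul, hα, neg_add_cancel, Real.rpow_zero]
    rw [hc]
    exact_mod_cast this
  simp only [diffMonomial, h1]
  rw [Finset.prod_mul_distrib]
  simp only [pangRescale]
  rw [← hc]
  linear_combination (h (w + ρ * ξ) ^ n * ∏ j, iteratedDeriv (tt j) (h ^ nn j) (w + ρ * ξ)) * h2

lemma ContConv.pow {F : ℕ → ℂ → ℂ} {f : ℂ → ℂ} {U : Set ℂ} (hF : ContConv F f U) (n : ℕ) :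
    ContConv (fun m => F m ^ n) (f ^ n) U :=
  fun z hz => (hF z hz).pow n

lemma EvHolo.pow {F : ℕ → ℂ → ℂ} {U : Set ℂ} (hF : EvHolo F U) (n : ℕ) :
    EvHolo (fun m => F m ^ n) U :=
  fun z hz => (hF z hz).mono fun _ hp => hp.pow n

lemma ContConv.diffMonomial {F : ℕ → ℂ → ℂ} {f : ℂ → ℂ} {U : Set ℂ} (hU : IsOpen U)
    (hF : ContConv F f U) (hd : EvHolo F U) (n : ℕ) {k : ℕ} (nn tt : Fin k → ℕ) :
    ContConv (fun m => diffMonomial n nn tt (F m)) (diffMonomial n nn tt f) U ∧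
      EvHolo (fun m => diffMonomial n nn tt (F m)) U := by
  have h1 := fun j => ContConv.iteratedDeriv hU (hF.pow (nn j)) (hd.pow (nn j)) (tt j)
  refine ⟨fun z hz => ?_, fun z hz => ?_⟩
  · exact ((hF z hz).pow n).mul (tendsto_finsetProd _ fun j _ => (h1 j).1 z hz)
  · filter_upwards [hd z hz, eventually_all.2 fun j => (h1 j).2 z hz] with p h2 h3
    exact (h2.pow n).mul (DifferentiableAt.fun_finsetProd fun j _ => h3 j)

lemma differentiableOn_iteratedDeriv {f : ℂ → ℂ} {D : Set ℂ} (hD : IsOpen D)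
    (hf : DifferentiableOn ℂ f D) (t : ℕ) : DifferentiableOn ℂ (iteratedDeriv t f) D := by
  induction t with
  | zero => simpa using hf
  | succ t ih => rw [iteratedDeriv_succ]; exact ih.deriv hD

lemma differentiableOn_diffMonomial {f : ℂ → ℂ} {D : Set ℂ} (hD : IsOpen D)
    (hf : DifferentiableOn ℂ f D) (n : ℕ) {k : ℕ} (nn tt : Fin k → ℕ) :
    DifferentiableOn ℂ (diffMonomial n nn tt f) D :=
  (hf.pow n).mul (DifferentiableOn.fun_finsetProd fun _ _ =>
    differentiableOn_iteratedDeriv hD (hf.pow _) _)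

/-- If a sequence of holomorphic functions has no subsequence converging locally uniformly or
to `∞`, there is a nonconstant entire function with bounded spherical derivative inheriting the
multiplicity conditions on the differential monomial. -/
lemma exists_entire_of_not_normal {q : ℕ} (a : Fin q → ℂ) (l : Fin q → ℕ∞) (hl : ∀ i, 2 ≤ l i)
    {n k : ℕ} {nn tt : Fin k → ℕ} (hlt : ∑ j, (tt j : ℝ) < n + ∑ j, (nn j : ℝ))
    {D : Set ℂ} (hD : IsOpen D) (hconn : IsPreconnected D) {f : ℕ → ℂ → ℂ}
    (hf : ∀ j, DifferentiableOn ℂ (f j) D)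
    (hmult : ∀ m, ∀ i : Fin q, ∀ z ∈ D, diffMonomial n nn tt (f m) z - a i = 0 →
      (l i).map (fun x : ℕ => (x : ℤ)) ≤ merOrder (fun w => diffMonomial n nn tt (f m) w - a i) z)
    (hnot : ¬ ∃ φ : ℕ → ℕ, StrictMono φ ∧ ((∃ g, ContConv (fun j => f (φ j)) g D) ∨
      ∀ z ∈ D, Tendsto (fun p : ℕ × ℂ => ‖f (φ p.1) p.2‖) (atTop ×ˢ 𝓝 z) atTop)) :
    ∃ g : ℂ → ℂ, Differentiable ℂ g ∧ deriv g 0 ≠ 0 ∧ (∀ ξ, ‖deriv g ξ‖ ≤ 25 * (1 + ‖g ξ‖ ^ 2)) ∧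
      ∀ i ξ, diffMonomial n nn tt g ξ = a i → ∀ s : ℕ, (s : ℕ∞) < l i →
        iteratedDeriv s (fun w => diffMonomial n nn tt g w - a i) ξ = 0 := by
  have hT : 0 ≤ ∑ j, (tt j : ℝ) := Finset.sum_nonneg fun _ _ => Nat.cast_nonneg _
  set M : ℝ := n + ∑ j, (nn j : ℝ) with hM
  have hM0 : 0 < M := hT.trans_lt hlt
  set α : ℝ := (∑ j, (tt j : ℝ)) / M with hα
  have hαM : α * M = ∑ j, (tt j : ℝ) := div_mul_cancel₀ _ hM0.ne'
  obtain ⟨h, w, ρ, g, hh, hρ, hinD, hg, hev, hg0, hgb⟩ := zalcman_pang (α := α) (by positivity)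
    ((div_lt_one hM0).2 hlt) hD hconn hf hnot
  refine ⟨g, differentiableOn_univ.1 (hg.differentiableOn isOpen_univ hev), hg0, hgb, ?_⟩
  intro i ξ hξ s hs
  obtain ⟨hP, hPev⟩ := hg.diffMonomial isOpen_univ hev n nn tt
  have hPa : ContConv (fun m v => diffMonomial n nn tt (pangRescale α (h m) (w m) (ρ m)) v - a i)
      (fun v => diffMonomial n nn tt g v - a i) univ :=
    fun z hz => (hP z hz).sub_const (a i)
  refine iteratedDeriv_eq_zero_of_contConv isOpen_univ hPa
    (fun z hz => (hPev z hz).mono fun p hp => hp.sub_const (a i)) (mem_univ ξ)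
    (sub_eq_zero.2 hξ) ?_
  have hmem : ∀ᶠ p in (atTop : Filter ℕ) ×ˢ 𝓝 ξ, w p.1 + ρ p.1 * p.2 ∈ D := by
    filter_upwards [(hinD (‖ξ‖ + 1)).prod_mk
      (continuous_norm.continuousAt.eventually_lt_const (show ‖ξ‖ < ‖ξ‖ + 1 by linarith))]
      with p hp
    exact hp.1 _ hp.2.le
  filter_upwards [hmem] with p hp hp0
  obtain ⟨m, hm⟩ := hh p.1
  have heq : (fun v => diffMonomial n nn tt (pangRescale α (h p.1) (w p.1) (ρ p.1)) v - a i) =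
      fun v => 1 * (fun u => diffMonomial n nn tt (h p.1) u - a i) (w p.1 + ρ p.1 * v) := by
    rw [diffMonomial_pangRescale (hρ _) hαM]
    ext v
    simp
  rw [heq, iteratedDeriv_const_mul_comp_affine (fun u => diffMonomial n nn tt (h p.1) u - a i)]
  simp only [diffMonomial_pangRescale (hρ _) hαM, one_mul, ← hm] at hp0 ⊢
  have han : AnalyticAt ℂ (fun u => diffMonomial n nn tt (f m) u - a i) (w p.1 + ρ p.1 * p.2) :=
    ((differentiableOn_diffMonomial hD (hf m) n nn tt).sub_const (a i)).analyticAt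
      (hD.mem_nhds hp)
  rw [iteratedDeriv_eq_zero_of_le_merOrder han hp0 (hl i) (hmult m i _ hp hp0) hs, mul_zero]

lemma toSphere_of_continuousAt {f : ℂ → ℂ} {z : ℂ} (hf : ContinuousAt f z) :
    toSphere f z = (f z : OnePoint ℂ) := by
  rw [toSphere, if_neg]
  intro h
  exact not_tendsto_nhds_of_tendsto_atTop h _ (hf.norm.mono_left nhdsWithin_le_nhds)

lemma convInftyLocUnif_of_tendsto_norm {F : ℕ → ℂ → ℂ} {D : Set ℂ}
    (hc : ∀ j, ∀ z ∈ D, ContinuousAt (F j) z)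
    (h : ∀ z ∈ D, Tendsto (fun p : ℕ × ℂ => ‖F p.1 p.2‖) (atTop ×ˢ 𝓝 z) atTop) :
    ConvInftyLocUnif F D := by
  intro K hKD hK ε hε
  have key : ∀ᶠ j in atTop, ∀ z ∈ K, 1 / ε < ‖F j z‖ := by
    refine hK.induction_on (p := fun S => ∀ᶠ j in atTop, ∀ z ∈ S, 1 / ε < ‖F j z‖) (by simp)
      (fun s t hst ht => ht.mono fun j hj z hz => hj z (hst hz))
      (fun s t hs ht => by
        filter_upwards [hs, ht] with j h1 h2 z hz using hz.elim (h1 z) (h2 z)) ?_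
    intro z hz
    obtain ⟨N, r, hr, hN⟩ := eventually_atTop_prod_nhds_iff.1
      ((h z (hKD hz)).eventually_gt_atTop (1 / ε))
    refine ⟨Metric.ball z r, mem_nhdsWithin_of_mem_nhds (Metric.ball_mem_nhds z hr), ?_⟩
    filter_upwards [eventually_ge_atTop N] with j hj w hw using hN j hj w hw
  filter_upwards [key] with j hj z hz
  rw [toSphere_of_continuousAt (hc j z (hKD hz))]
  change 1 / Real.sqrt (1 + ‖F j z‖ ^ 2) < ε
  have h1 := hj z hz
  have h2 : 1 / ε < Real.sqrt (1 + ‖F j z‖ ^ 2) :=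
    h1.trans (Real.lt_sqrt_of_sq_lt (by linarith))
  rw [one_div_lt (by positivity) hε]
  exact h2

lemma normalFamilyOnHolo_of_seq {𝓕 : Set (ℂ → ℂ)} {D : Set ℂ} (hD : IsOpen D)
    (hholo : ∀ f ∈ 𝓕, DifferentiableOn ℂ f D)
    (h : ∀ f : ℕ → ℂ → ℂ, (∀ j, f j ∈ 𝓕) → ∃ φ : ℕ → ℕ, StrictMono φ ∧
      ((∃ g, ContConv (fun j => f (φ j)) g D) ∨
      ∀ z ∈ D, Tendsto (fun p : ℕ × ℂ => ‖f (φ p.1) p.2‖) (atTop ×ˢ 𝓝 z) atTop)) :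
    NormalFamilyOnHolo 𝓕 D := by
  intro f hf
  have hd : ∀ j, ∀ z ∈ D, DifferentiableAt ℂ (f j) z := fun j z hz =>
    (hholo _ (hf j)).differentiableAt (hD.mem_nhds hz)
  obtain ⟨φ, hφ, ⟨g, hg⟩ | hinf⟩ := h f hf
  · refine ⟨φ, hφ, Or.inl ⟨g, hg.differentiableOn hD fun z hz => ?_,
      hg.tendstoLocallyUniformlyOn hD⟩⟩
    filter_upwards [(Eventually.of_forall (fun _ : ℕ => trivial) :
      ∀ᶠ _ in (atTop : Filter ℕ), True).prod_mk (hD.mem_nhds hz)] with p hp using hd _ _ hp.2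
  · exact ⟨φ, hφ, Or.inr (convInftyLocUnif_of_tendsto_norm
      (fun j z hz => (hd _ z hz).continuousAt) hinf)⟩

/-- Functions of at most exponential growth. -/
def ExpGrowth (f : ℂ → ℂ) : Prop := ∃ A : ℝ, 0 ≤ A ∧ ∀ z, ‖f z‖ ≤ Real.exp (A * (1 + ‖z‖))

lemma expGrowth_const (c : ℂ) : ExpGrowth fun _ => c := by
  refine ⟨‖c‖, norm_nonneg c, fun z => ?_⟩
  have h1 := Real.add_one_le_exp (‖c‖ * (1 + ‖z‖))
  have h2 : ‖c‖ ≤ ‖c‖ * (1 + ‖z‖) := le_mul_of_one_le_right (norm_nonneg c)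
    (by linarith [norm_nonneg z])
  linarith

lemma ExpGrowth.mul {f g : ℂ → ℂ} (hf : ExpGrowth f) (hg : ExpGrowth g) :
    ExpGrowth fun z => f z * g z := by
  obtain ⟨A, hA, h1⟩ := hf
  obtain ⟨B, hB, h2⟩ := hg
  refine ⟨A + B, by positivity, fun z => ?_⟩
  rw [norm_mul, add_mul, Real.exp_add]
  gcongr
  exacts [h1 z, h2 z]

lemma ExpGrowth.sub {f g : ℂ → ℂ} (hf : ExpGrowth f) (hg : ExpGrowth g) :
    ExpGrowth fun z => f z - g z := by
  obtain ⟨A, hA, h1⟩ := hf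
  obtain ⟨B, hB, h2⟩ := hg
  refine ⟨A + B + 1, by positivity, fun z => ?_⟩
  have hz := norm_nonneg z
  have e1 : Real.exp (A * (1 + ‖z‖)) ≤ Real.exp ((A + B) * (1 + ‖z‖)) :=
    Real.exp_le_exp.2 (by nlinarith)
  have e2 : Real.exp (B * (1 + ‖z‖)) ≤ Real.exp ((A + B) * (1 + ‖z‖)) :=
    Real.exp_le_exp.2 (by nlinarith)
  have e3 : (2 : ℝ) ≤ Real.exp (1 * (1 + ‖z‖)) := by
    linarith [Real.add_one_le_exp (1 * (1 + ‖z‖))]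
  rw [add_mul (A + B), Real.exp_add]
  have e4 := norm_sub_le (f z) (g z)
  nlinarith [h1 z, h2 z, Real.exp_pos ((A + B) * (1 + ‖z‖))]

lemma ExpGrowth.pow {f : ℂ → ℂ} (hf : ExpGrowth f) (n : ℕ) : ExpGrowth (f ^ n) := by
  induction n with
  | zero => rw [pow_zero]; exact expGrowth_const 1
  | succ n ih => rw [pow_succ]; exact ih.mul hf

lemma ExpGrowth.prod {ι : Type*} (s : Finset ι) {f : ι → ℂ → ℂ} (hf : ∀ i ∈ s, ExpGrowth (f i)) :
    ExpGrowth fun z => ∏ i ∈ s, f i z := by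
  induction s using Finset.induction_on with
  | empty => simpa using expGrowth_const 1
  | insert i s hi ih =>
    simp only [Finset.prod_insert hi]
    exact (hf i (by simp)).mul (ih fun j hj => hf j (by simp [hj]))

lemma ExpGrowth.deriv {f : ℂ → ℂ} (hd : Differentiable ℂ f) (hf : ExpGrowth f) :
    ExpGrowth (deriv f) := by
  obtain ⟨A, hA, h1⟩ := hf
  refine ⟨2 * A, by positivity, fun z => ?_⟩
  have := Complex.norm_deriv_le_of_forall_mem_sphere_norm_le (c := z) one_pos
    hd.diffContOnCl (C := Real.exp (2 * A * (1 + ‖z‖))) (fun w hw => (h1 w).trans ?_)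
  · simpa using this
  · have h2 : ‖w‖ ≤ ‖z‖ + 1 := by
      have := mem_sphere_iff_norm.1 hw
      linarith [norm_le_norm_add_norm_sub' w z]
    exact Real.exp_le_exp.2 (by nlinarith [norm_nonneg z])

lemma Differentiable.iteratedDeriv_complex {f : ℂ → ℂ} (hd : Differentiable ℂ f) (t : ℕ) :
    Differentiable ℂ (iteratedDeriv t f) :=
  hd.contDiff.differentiable_iteratedDeriv t (n := ⊤) (WithTop.coe_lt_top _)

lemma ExpGrowth.iteratedDeriv {f : ℂ → ℂ} (hd : Differentiable ℂ f) (hf : ExpGrowth f) (t : ℕ) :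
    ExpGrowth (iteratedDeriv t f) := by
  induction t with
  | zero => simpa using hf
  | succ t ih => rw [iteratedDeriv_succ]; exact ih.deriv (hd.iteratedDeriv_complex t)

open InnerProductSpace in
/-- Lower Harnack inequality. -/
lemma harnack_le {u : ℂ → ℝ} {c w : ℂ} {R : ℝ} (hu : HarmonicOnNhd u (Metric.closedBall c R))
    (hpos : ∀ z ∈ Metric.sphere c R, 0 ≤ u z) (hw : w ∈ Metric.ball c R) :
    (R - ‖w - c‖) / (R + ‖w - c‖) * u c ≤ u w := by
  have hR : 0 < R := Metric.pos_of_mem_ball hw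
  have h1 := hu.circleAverage_re_herglotzRieszKernel_smul hw
  have h2 : Real.circleAverage u c R = u c :=
    InnerProductSpace.HarmonicOnNhd.circleAverage_eq (by rwa [abs_of_pos hR])
  have hc : ContinuousOn u (Metric.sphere c |R|) := by
    rw [abs_of_pos hR]
    exact hu.continuousOn.mono Metric.sphere_subset_closedBall
  have hk : ContinuousOn (re ∘ herglotzRieszKernel c w) (Metric.sphere c |R|) :=
    Complex.continuous_re.comp_continuousOn (continuousOn_herglotzRieszKernel_sphere hw)
  rw [← h1, ← h2, ← smul_eq_mul, ← Real.circleAverage_smul]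
  refine Real.circleAverage_mono (hc.const_smul _).circleIntegrable' (hk.smul hc).circleIntegrable'
    fun z hz => ?_
  rw [abs_of_pos hR] at hz
  exact mul_le_mul_of_nonneg_right (le_re_herglotzRieszKernel hz hw) (hpos z hz)

lemma exists_norm_le_one_of_spherical_deriv {g : ℂ → ℂ} (hg : Differentiable ℂ g)
    (h0 : deriv g 0 ≠ 0) : ∃ p, ‖g p‖ ≤ 1 := by
  by_contra! hcon
  have hne : ∀ z, g z ≠ 0 := fun z => norm_pos_iff.1 (by linarith [hcon z])
  have hb : Bornology.IsBounded (Set.range fun z => (g z)⁻¹) := by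
    refine isBounded_iff_forall_norm_le.2 ⟨1, ?_⟩
    rintro _ ⟨z, rfl⟩
    simp only [norm_inv]
    exact inv_le_one_of_one_le₀ (hcon z).le
  have hconst : ∀ z, g z = g 0 := fun z => inv_injective
    ((hg.fun_inv hne).apply_eq_apply_of_bounded hb z 0)
  apply h0
  rw [show g = fun _ => g 0 from funext hconst]
  simp

open InnerProductSpace in
/-- Entire functions with bounded spherical derivative are of exponential type. -/
lemma expGrowth_of_spherical_deriv_le {g : ℂ → ℂ} (hg : Differentiable ℂ g)
    (h0 : deriv g 0 ≠ 0) {C : ℝ} (hC : 0 < C)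
    (hb : ∀ z, ‖deriv g z‖ ≤ C * (1 + ‖g z‖ ^ 2)) : ExpGrowth g := by
  obtain ⟨p, hp⟩ := exists_norm_le_one_of_spherical_deriv hg h0
  set K : Set ℂ := {z | ‖g z‖ ≤ 1} with hK
  have hKc : IsClosed K := isClosed_le hg.continuous.norm continuous_const
  have hlog : ∀ z, 1 < ‖g z‖ → Real.log ‖g z‖ ≤ 8 * C * (‖z‖ + ‖p‖) := by
    intro z hz
    obtain ⟨b, hbK, hbd⟩ := hKc.exists_infDist_eq_dist ⟨p, hp⟩ z
    set d := dist z b with hd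
    have hdp : d ≤ ‖z‖ + ‖p‖ := by
      rw [← hbd]
      exact (Metric.infDist_le_dist_of_mem (show p ∈ K from hp)).trans (dist_le_norm_add_norm z p)
    have hd0 : 0 < d := dist_pos.2 fun h => by
      rw [← h] at hbK
      exact absurd hbK (not_le.2 hz)
    have hout : ∀ w ∈ Metric.ball z d, 1 < ‖g w‖ := fun w hw => by
      by_contra! hcon
      have := Metric.infDist_le_dist_of_mem (x := z) (show w ∈ K from hcon)
      rw [hbd] at this
      exact absurd (Metric.mem_ball'.1 hw) (not_lt.2 this)
    set γ : ℝ → ℂ := fun s => z + s * (b - z) with hγ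
    have hγd : ∀ s : ℝ, 0 ≤ s → ‖γ s - z‖ = s * d := fun s hs => by
      simp [hγ, abs_of_nonneg hs, hd, dist_comm z b, dist_eq_norm]
    have hγb : ∀ s : ℝ, s ≤ 1 → ‖γ s - b‖ = (1 - s) * d := fun s hs => by
      have : γ s - b = ((1 - s : ℝ) : ℂ) * (z - b) := by simp only [hγ]; push_cast; ring
      rw [this, norm_mul, Complex.norm_real, Real.norm_eq_abs, abs_of_nonneg (by linarith), hd,
        dist_eq_norm]
    have hγt : Tendsto γ (𝓝[<] 1) (𝓝[≠] b) := by
      refine tendsto_nhdsWithin_iff.2 ⟨?_, ?_⟩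
      · have : ContinuousAt γ 1 := by fun_prop
        have h2 := this.tendsto
        rw [show γ 1 = b by simp [hγ]] at h2
        exact h2.mono_left nhdsWithin_le_nhds
      · filter_upwards [self_mem_nhdsWithin] with s hs h
        have h1 := hγb s (le_of_lt hs)
        rw [show γ s = b from h, sub_self, norm_zero] at h1
        have : 0 < (1 - s) * d := mul_pos (sub_pos.2 hs) hd0
        linarith
    have hb1 : ‖g b‖ = 1 := by
      refine le_antisymm hbK (ge_of_tendsto ((hg.continuous.norm.tendsto b).comp
        (hγt.mono_right nhdsWithin_le_nhds)) ?_)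
      filter_upwards [self_mem_nhdsWithin, mem_nhdsWithin_of_mem_nhds
        (Ioi_mem_nhds (show (0:ℝ) < 1 by norm_num))] with s hs hs0
      refine (hout _ ?_).le
      rw [mem_ball_iff_norm, hγd s (le_of_lt hs0)]
      have : s < 1 := hs
      nlinarith
    have hslope : Tendsto (fun s => ‖slope g b (γ s)‖) (𝓝[<] 1) (𝓝 ‖deriv g b‖) :=
      ((hasDerivAt_iff_tendsto_slope.1 hg.differentiableAt.hasDerivAt).comp hγt).norm
    have hkey : ∀ᶠ s in 𝓝[<] (1:ℝ), Real.log ‖g z‖ / (4 * d) ≤ ‖slope g b (γ s)‖ := by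
      filter_upwards [self_mem_nhdsWithin, mem_nhdsWithin_of_mem_nhds
        (Ioi_mem_nhds (show (0:ℝ) < 1 by norm_num))] with s hs hs0
      have hs1 : s < 1 := hs
      have hs0' : 0 < s := hs0
      set R := (1 + s) / 2 * d with hR
      have hRd : R < d := by rw [hR]; nlinarith
      have hsub : Metric.closedBall z R ⊆ Metric.ball z d := Metric.closedBall_subset_ball hRd
      have hw : γ s ∈ Metric.ball z R := by
        rw [mem_ball_iff_norm, hγd s hs0'.le, hR]; nlinarith
      have hharm : HarmonicOnNhd (fun w => Real.log ‖g w‖) (Metric.closedBall z R) := fun w hw =>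
        (hg.analyticAt w).harmonicAt_log_norm (norm_pos_iff.1 (by linarith [hout w (hsub hw)]))
      have h1 := harnack_le hharm (fun w hw => Real.log_nonneg
        (hout w (hsub (Metric.sphere_subset_closedBall hw))).le) hw
      have h2 : Real.log ‖g (γ s)‖ ≤ ‖g (γ s) - g b‖ := by
        have h3 := Real.log_le_sub_one_of_pos (show 0 < ‖g (γ s)‖ by
          linarith [hout _ (hsub (Metric.ball_subset_closedBall hw))])
        have h4 := norm_sub_norm_le (g (γ s)) (g b)
        rw [hb1] at h4
        linarith
      have h5 : (1 - s) / 4 ≤ (R - ‖γ s - z‖) / (R + ‖γ s - z‖) := by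
        rw [hγd s hs0'.le, le_div_iff₀ (by positivity), hR]
        nlinarith [mul_pos (sub_pos.2 hs1) hd0]
      have h6 : 0 ≤ Real.log ‖g z‖ := Real.log_nonneg hz.le
      have h7 : (1 - s) / 4 * Real.log ‖g z‖ ≤ ‖g (γ s) - g b‖ :=
        (mul_le_mul_of_nonneg_right h5 h6).trans (h1.trans h2)
      rw [slope_def_field, norm_div, hγb s hs1.le, div_le_div_iff₀ (by positivity)
        (mul_pos (sub_pos.2 hs1) hd0)]
      nlinarith
    have h8 := ge_of_tendsto hslope hkey
    have h9 := hb b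
    rw [hb1] at h9
    have h10 := h8.trans h9
    rw [div_le_iff₀ (by positivity)] at h10
    calc Real.log ‖g z‖ ≤ 8 * C * d := by linarith
      _ ≤ _ := by gcongr
  refine ⟨8 * C * (1 + ‖p‖), by positivity, fun z => ?_⟩
  rcases le_or_gt ‖g z‖ 1 with h1 | h1
  · exact h1.trans (Real.one_le_exp (by positivity))
  · rw [← Real.log_le_iff_le_exp (by linarith)]
    refine (hlog z h1).trans ?_
    have : ‖z‖ + ‖p‖ ≤ (1 + ‖p‖) * (1 + ‖z‖) := by nlinarith [norm_nonneg z, norm_nonneg p, mul_nonneg (norm_nonneg z) (norm_nonneg p)]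
    calc _ ≤ 8 * C * ((1 + ‖p‖) * (1 + ‖z‖)) := by gcongr
      _ = _ := by ring

lemma circleAverage_log_norm_eq_sum {f : ℂ → ℂ} (hf : Differentiable ℂ f) (h0 : f 0 ≠ 0) {r : ℝ}
    (hr : 0 < r) :
    ∃ Z : Finset ℂ, (∀ u ∈ Z, ‖u‖ ≤ r) ∧ ∀ Z' : Finset ℂ, Z ⊆ Z' → (∀ u ∈ Z', ‖u‖ ≤ r) →
      Real.circleAverage (fun z => Real.log ‖f z‖) 0 r =
        ∑ u ∈ Z', (analyticOrderNatAt f u : ℝ) * Real.log (r * ‖u‖⁻¹) + Real.log ‖f 0‖ := by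
  have hfa : AnalyticOnNhd ℂ f (Metric.closedBall 0 |r|) := fun z _ => hf.analyticAt z
  have hfin := (MeromorphicOn.divisor f (Metric.closedBall 0 |r|)).finiteSupport
    (isCompact_closedBall (0:ℂ) |r|)
  have hb : ∀ u ∈ hfin.toFinset, u ∈ Metric.closedBall (0:ℂ) |r| := by
    intro u hu
    rw [Set.Finite.mem_toFinset] at hu
    exact (MeromorphicOn.divisor f (Metric.closedBall 0 |r|)).supportWithinDomain hu
  have hmem : ∀ u : ℂ, u ∈ Metric.closedBall (0:ℂ) |r| ↔ ‖u‖ ≤ r := by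
    intro u; simp [abs_of_pos hr]
  refine ⟨hfin.toFinset, fun u hu => (hmem u).1 (hb u hu), fun Z' hZ hZ' => ?_⟩
  rw [hfa.circleAverage_log_norm hr.ne' h0, finsum_eq_sum_of_support_subset (s := Z')]
  · congr 1
    refine Finset.sum_congr rfl fun u hu => ?_
    rw [MeromorphicOn.AnalyticOnNhd.divisor_apply hfa ((hmem u).2 (hZ' u hu))]
    simp only [zero_sub, norm_neg]
    congr 1
    unfold analyticOrderNatAt
    cases analyticOrderAt f u <;> simp
  · intro u hu
    apply hZ
    rw [Set.Finite.mem_toFinset]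
    intro h
    apply hu
    have h' : (MeromorphicOn.divisor f (Metric.closedBall 0 |r|)) u = 0 := h
    simp [h']

/-- A linear combination of divisors of entire functions which is effective gives an inequality
between the logarithmic means. -/
lemma sum_circleAverage_log_norm_ge {ι : Type*} (s : Finset ι) {f : ι → ℂ → ℂ} {c : ι → ℝ}
    (hf : ∀ i, Differentiable ℂ (f i)) (h0 : ∀ i, f i 0 ≠ 0)
    (hord : ∀ z, 0 ≤ ∑ i ∈ s, c i * (analyticOrderNatAt (f i) z : ℝ)) {r : ℝ} (hr : 0 < r) :
    ∑ i ∈ s, c i * Real.log ‖f i 0‖ ≤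
      ∑ i ∈ s, c i * Real.circleAverage (fun z => Real.log ‖f i z‖) 0 r := by
  choose Z hZ hZeq using fun i => circleAverage_log_norm_eq_sum (hf i) (h0 i) hr
  have h1 : ∀ i ∈ s, c i * Real.circleAverage (fun z => Real.log ‖f i z‖) 0 r =
      ∑ u ∈ s.biUnion Z, c i * (analyticOrderNatAt (f i) u : ℝ) * Real.log (r * ‖u‖⁻¹)
        + c i * Real.log ‖f i 0‖ := by
    intro i hi
    rw [hZeq i (s.biUnion Z) (Finset.subset_biUnion_of_mem Z hi), mul_add, Finset.mul_sum]
    · simp only [mul_assoc]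
    · intro u hu
      obtain ⟨j, -, hj⟩ := Finset.mem_biUnion.1 hu
      exact hZ j u hj
  rw [Finset.sum_congr rfl h1, Finset.sum_add_distrib, Finset.sum_comm]
  refine le_add_of_nonneg_left (Finset.sum_nonneg fun u hu => ?_)
  rw [← Finset.sum_mul]
  refine mul_nonneg (hord u) ?_
  obtain ⟨j, -, hj⟩ := Finset.mem_biUnion.1 hu
  have hu' := hZ j u hj
  rcases eq_or_ne u 0 with rfl | hne
  · simp
  · apply Real.log_nonneg
    rw [← div_eq_mul_inv, one_le_div (norm_pos_iff.2 hne)]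
    exact hu'

lemma log_norm_le_circleAverage {f : ℂ → ℂ} (hf : Differentiable ℂ f) (h0 : f 0 ≠ 0) {r : ℝ}
    (hr : 0 < r) :
    Real.log ‖f 0‖ ≤ Real.circleAverage (fun z => Real.log ‖f z‖) 0 r := by
  have := sum_circleAverage_log_norm_ge {()} (f := fun _ => f) (c := fun _ => 1) (fun _ => hf)
    (fun _ => h0) (fun z => by simp) hr
  simpa using this

lemma differentiable_multiset_prod_sub (S : Multiset ℂ) :
    Differentiable ℂ fun z : ℂ => (S.map fun a => z - a).prod := by
  induction S using Multiset.induction with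
  | empty => simp
  | cons a S ih =>
    simp only [Multiset.map_cons, Multiset.prod_cons]
    exact (differentiable_id.sub_const a).mul ih

lemma Differentiable.dslope_complex {h : ℂ → ℂ} (hh : Differentiable ℂ h) (a : ℂ) :
    Differentiable ℂ (dslope h a) :=
  differentiableOn_univ.1 ((Complex.differentiableOn_dslope Filter.univ_mem).2 hh.differentiableOn)

/-- If the number of linear factors that can be split off is bounded, then all zeros in `U` can be
split off. -/
lemma exists_factorization {f : ℂ → ℂ} (hf : Differentiable ℂ f) {U : Set ℂ} {K : ℝ}
    (hK : ∀ (S : Multiset ℂ) (h : ℂ → ℂ), Differentiable ℂ h → (∀ a ∈ S, a ∈ U) →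
      (∀ z, f z = (S.map fun a => z - a).prod * h z) → (S.card : ℝ) ≤ K) :
    ∃ (S : Multiset ℂ) (h : ℂ → ℂ), Differentiable ℂ h ∧ (∀ a ∈ S, a ∈ U) ∧
      (∀ z, f z = (S.map fun a => z - a).prod * h z) ∧ ∀ z ∈ U, h z ≠ 0 := by
  by_contra! hcon
  have key : ∀ n : ℕ, ∃ (S : Multiset ℂ) (h : ℂ → ℂ), Differentiable ℂ h ∧ (∀ a ∈ S, a ∈ U) ∧
      (∀ z, f z = (S.map fun a => z - a).prod * h z) ∧ S.card = n := by
    intro n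
    induction n with
    | zero => exact ⟨0, f, hf, by simp, by simp, rfl⟩
    | succ n ih =>
      obtain ⟨S, h, hh, hS, hfac, hcard⟩ := ih
      obtain ⟨a, haU, ha⟩ := hcon S h hh hS hfac
      refine ⟨a ::ₘ S, dslope h a, hh.dslope_complex a, ?_, ?_, by simp [hcard]⟩
      · intro b hb
        rcases Multiset.mem_cons.1 hb with rfl | hb
        exacts [haU, hS b hb]
      · intro z
        have h1 : (z - a) * dslope h a z = h z := by
          have := sub_smul_dslope h a z
          simpa [ha] using this
        rw [hfac z, Multiset.map_cons, Multiset.prod_cons, ← h1]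
        ring
  obtain ⟨S, h, hh, hS, hfac, hcard⟩ := key (⌊K⌋₊ + 1)
  have := hK S h hh hS hfac
  rw [hcard] at this
  have h2 := Nat.lt_floor_add_one K
  push_cast at this
  linarith

lemma analyticOrderAt_ne_top_of_entire {f : ℂ → ℂ} (hf : Differentiable ℂ f) {z₀ : ℂ}
    (h0 : f z₀ ≠ 0) (z : ℂ) : analyticOrderAt f z ≠ ⊤ := by
  intro h
  apply h0
  have := AnalyticOnNhd.eqOn_zero_of_preconnected_of_eventuallyEq_zero
    (f := f) (U := univ) (fun w _ => hf.analyticAt w) isPreconnected_univ (mem_univ z)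
    (analyticOrderAt_eq_top.1 h)
  exact this (mem_univ z₀)

lemma log_norm_add_sum_le_circleAverage (S : Multiset ℂ) {r : ℝ} (hr : 0 < r)
    (hS : ∀ a ∈ S, ‖a‖ ≤ r) {f h : ℂ → ℂ} (hf : Differentiable ℂ f) (h0 : f 0 ≠ 0)
    (hh : Differentiable ℂ h) (hfac : ∀ z, f z = (S.map fun a => z - a).prod * h z) :
    Real.log ‖f 0‖ + (S.map fun a => Real.log r - Real.log ‖a‖).sum ≤
      Real.circleAverage (fun z => Real.log ‖f z‖) 0 r := by
  induction S using Multiset.induction generalizing f with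
  | empty => simpa using log_norm_le_circleAverage hf h0 hr
  | cons a S ih =>
    set f₁ : ℂ → ℂ := fun z => (S.map fun a => z - a).prod * h z with hf₁
    have hf₁d : Differentiable ℂ f₁ := (differentiable_multiset_prod_sub S).mul hh
    have hff : ∀ z, f z = (z - a) * f₁ z := fun z => by
      rw [hfac z, Multiset.map_cons, Multiset.prod_cons, hf₁]; ring
    have h00 := h0
    rw [hff 0] at h00
    have hf₁0 : f₁ 0 ≠ 0 := right_ne_zero_of_mul h00
    have ha0 : (fun z : ℂ => z - a) 0 ≠ 0 := left_ne_zero_of_mul h00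
    have h1 := ih (fun b hb => hS b (Multiset.mem_cons_of_mem hb)) hf₁d hf₁0 (fun _ => rfl)
    have hda : Differentiable ℂ fun z : ℂ => z - a := differentiable_id.sub_const a
    have h2 := sum_circleAverage_log_norm_ge (Finset.univ : Finset (Fin 3))
      (f := ![f, fun z => z - a, f₁]) (c := ![1, -1, -1])
      (by intro i; fin_cases i; exacts [hf, hda, hf₁d])
      (by intro i; fin_cases i; exacts [h0, ha0, hf₁0])
      (by
        intro z
        have : f = (fun z : ℂ => z - a) * f₁ := funext hff
        have h3 : analyticOrderNatAt f z =
            analyticOrderNatAt (fun z : ℂ => z - a) z + analyticOrderNatAt f₁ z := by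
          rw [this, analyticOrderNatAt_mul (hda.analyticAt z) (hf₁d.analyticAt z)
            (analyticOrderAt_ne_top_of_entire hda ha0 z)
            (analyticOrderAt_ne_top_of_entire hf₁d hf₁0 z)]
        simp [Fin.sum_univ_three, h3]) hr
    have h4 : Real.circleAverage (fun z => Real.log ‖z - a‖) 0 r = Real.log r := by
      rw [circleAverage_log_norm_sub_const_eq_log_radius_add_posLog hr.ne', add_eq_left,
        Real.posLog_eq_zero_iff]
      have := hS a (Multiset.mem_cons_self a S)
      rw [zero_sub, norm_neg, abs_mul, abs_norm, abs_inv, abs_of_pos hr, inv_mul_le_iff₀ hr]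
      simpa using this
    have h5 : Real.log ‖f 0‖ = Real.log ‖a‖ + Real.log ‖f₁ 0‖ := by
      rw [hff 0, norm_mul, Real.log_mul]
      · simp
      · exact norm_ne_zero_iff.2 ha0
      · exact norm_ne_zero_iff.2 hf₁0
    simp only [Fin.sum_univ_three, Matrix.cons_val_zero, Matrix.cons_val_one, Matrix.cons_val,
      h4, zero_sub, norm_neg] at h2
    rw [Multiset.map_cons, Multiset.sum_cons]
    linarith

lemma norm_logDeriv_le_of_factorization (S : Multiset ℂ) {z : ℂ} {δ : ℝ} (hδ : 0 < δ)
    (hS : ∀ a ∈ S, δ ≤ ‖z - a‖) {f h : ℂ → ℂ}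
    (hh : Differentiable ℂ h) (hfac : ∀ z, f z = (S.map fun a => z - a).prod * h z)
    (hz : h z ≠ 0) :
    f z ≠ 0 ∧ ‖deriv f z / f z‖ ≤ S.card / δ + ‖deriv h z / h z‖ := by
  induction S using Multiset.induction generalizing f with
  | empty =>
    have : f = h := funext fun z => by simpa using hfac z
    subst this
    simpa using hz
  | cons a S ih =>
    set f₁ : ℂ → ℂ := fun z => (S.map fun a => z - a).prod * h z with hf₁
    have hf₁d : Differentiable ℂ f₁ := (differentiable_multiset_prod_sub S).mul hh
    have hff : f = fun z => (z - a) * f₁ z := funext fun z => by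
      rw [hfac z, Multiset.map_cons, Multiset.prod_cons, hf₁]; ring
    obtain ⟨h1, h2⟩ := ih (f := f₁) (fun b hb => hS b (Multiset.mem_cons_of_mem hb)) (fun _ => rfl)
    have h3 := hS a (Multiset.mem_cons_self a S)
    have hza : z - a ≠ 0 := norm_pos_iff.1 (hδ.trans_le h3)
    refine ⟨by rw [hff]; exact mul_ne_zero hza h1, ?_⟩
    have h4 : deriv f z / f z = (z - a)⁻¹ + deriv f₁ z / f₁ z := by
      have h5 : HasDerivAt (fun z => (z - a) * f₁ z) (1 * f₁ z + (z - a) * deriv f₁ z) z :=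
        ((hasDerivAt_id z).sub_const a).mul (hf₁d z).hasDerivAt
      rw [hff, h5.deriv]
      field_simp
    rw [h4]
    refine (norm_add_le _ _).trans ?_
    rw [norm_inv]
    have h5 : ‖z - a‖⁻¹ ≤ 1 / δ := by rw [one_div]; exact inv_anti₀ hδ h3
    rw [Multiset.card_cons]
    push_cast
    rw [add_div]
    linarith

/-- Logarithmic derivative of a zero-free function. -/
lemma norm_logDeriv_le_of_ne_zero {h : ℂ → ℂ} {R K : ℝ} (hR : 0 < R) (hh : Differentiable ℂ h)
    (hne : ∀ z ∈ Metric.ball (0:ℂ) R, h z ≠ 0)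
    (hK : ∀ z ∈ Metric.ball (0:ℂ) R, Real.log ‖h z‖ - Real.log ‖h 0‖ ≤ K) (hKpos : 0 < K)
    {w : ℂ} (hw : ‖w‖ ≤ R / 4) :
    ‖deriv h w / h w‖ ≤ 8 * K / R := by
  have hd : DifferentiableOn ℂ (fun z => deriv h z / h z) (Metric.ball 0 R) :=
    hh.deriv.differentiableOn.div hh.differentiableOn hne
  obtain ⟨φ, hφ0, hφ⟩ := hd.isExactOn_ball.with_val_at 0 0
  have h0m : (0:ℂ) ∈ Metric.ball (0:ℂ) R := Metric.mem_ball_self hR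
  have hexp : ∀ z ∈ Metric.ball (0:ℂ) R, h z = h 0 * Complex.exp (φ z) := by
    have hconst : ∀ z ∈ Metric.ball (0:ℂ) R, HasDerivAt (fun z => h z * Complex.exp (-φ z)) 0 z := by
      intro z hz
      have h1 := (hh z).hasDerivAt.mul ((hφ z hz).neg.cexp)
      convert! h1 using 1
      have := hne z hz
      field_simp
      ring
    intro z hz
    have h2 := (convex_ball (0:ℂ) R).is_const_of_fderivWithin_eq_zero (𝕜 := ℂ)
      (f := fun z => h z * Complex.exp (-φ z))
      (fun z hz => (hconst z hz).differentiableAt.differentiableWithinAt)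
      (fun z hz => by
        rw [fderivWithin_of_isOpen Metric.isOpen_ball hz]
        ext
        simpa using (hconst z hz).deriv) hz h0m
    simp only [hφ0, neg_zero, Complex.exp_zero, mul_one] at h2
    rw [← h2, mul_assoc, ← Complex.exp_add]
    simp
  have hre : MapsTo φ (Metric.ball 0 R) {z | z.re ≤ K} := by
    intro z hz
    have h3 := hK z hz
    rw [hexp z hz, norm_mul, Complex.norm_exp, Real.log_mul (norm_ne_zero_iff.2 (hne 0 h0m))
      (Real.exp_pos _).ne', Real.log_exp] at h3
    show (φ z).re ≤ K
    linarith
  have hφd : DifferentiableOn ℂ φ (Metric.ball 0 R) := fun z hz =>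
    (hφ z hz).differentiableAt.differentiableWithinAt
  have hφb : ∀ z, ‖z‖ ≤ R / 2 → ‖φ z‖ ≤ 2 * K := by
    intro z hz
    have h4 := Complex.borelCaratheodory_zero hKpos hφd hre hR
      (z := z) (by rw [mem_ball_zero_iff]; linarith) hφ0
    refine h4.trans ?_
    rw [div_le_iff₀ (by linarith)]
    nlinarith
  have hwm : w ∈ Metric.ball (0:ℂ) R := by rw [mem_ball_zero_iff]; linarith
  rw [← (hφ w hwm).deriv]
  have hsub : Metric.closedBall w (R/4) ⊆ Metric.ball 0 R := by
    intro z hz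
    rw [mem_closedBall_iff_norm] at hz
    rw [mem_ball_zero_iff]
    calc ‖z‖ = ‖(z - w) + w‖ := by ring_nf
      _ ≤ ‖z - w‖ + ‖w‖ := norm_add_le _ _
      _ < R := by linarith
  have := Complex.norm_deriv_le_of_forall_mem_sphere_norm_le (f := φ) (c := w) (R := R/4)
    (C := 2 * K) (by linarith)
    ((hφd.mono hsub).diffContOnCl_ball (subset_refl _)) (by
      intro z hz
      rw [mem_sphere_iff_norm] at hz
      apply hφb
      calc ‖z‖ = ‖(z - w) + w‖ := by ring_nf
        _ ≤ ‖z - w‖ + ‖w‖ := norm_add_le _ _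
        _ ≤ R/2 := by linarith)
  refine this.trans (le_of_eq ?_)
  field_simp
  ring

lemma circleIntegrable_log_norm_of_entire {f : ℂ → ℂ} (hf : Differentiable ℂ f) (c : ℂ) (r : ℝ) :
    CircleIntegrable (fun z => Real.log ‖f z‖) c r :=
  MeromorphicOn.circleIntegrable_log_norm fun z _ => (hf.analyticAt z).meromorphicAt

lemma norm_multiset_prod (S : Multiset ℂ) (φ : ℂ → ℂ) :
    ‖(S.map φ).prod‖ = (S.map fun a => ‖φ a‖).prod := by
  induction S using Multiset.induction with
  | empty => simp
  | cons a S ih => simp [ih]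

lemma exists_factorization_of_expGrowth {f : ℂ → ℂ} (hf : Differentiable ℂ f) (h0 : f 0 ≠ 0)
    (hgr : ExpGrowth f) :
    ∃ C : ℝ, 0 ≤ C ∧ ∀ R : ℝ, 1 ≤ R → ∃ (S : Multiset ℂ) (h : ℂ → ℂ), Differentiable ℂ h ∧
      (∀ a ∈ S, ‖a‖ ≤ R) ∧ (∀ z, f z = (S.map fun a => z - a).prod * h z) ∧
      (∀ z, ‖z‖ ≤ R → h z ≠ 0) ∧ (S.card : ℝ) ≤ C * R ∧
      ∀ z ∈ Metric.ball (0:ℂ) R, Real.log ‖h z‖ - Real.log ‖h 0‖ ≤ C * R * (1 + Real.log R) := by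
  obtain ⟨A, hA, hfA⟩ := hgr
  have hfp : 0 < ‖f 0‖ := norm_pos_iff.2 h0
  refine ⟨4 * A + |Real.log ‖f 0‖|, by positivity, fun R hR => ?_⟩
  set C := 4 * A + |Real.log ‖f 0‖| with hC
  have hR0 : 0 < R := by linarith
  have hlogR : 0 ≤ Real.log R := Real.log_nonneg hR
  have habs := neg_abs_le (Real.log ‖f 0‖)
  have habs' : |Real.log ‖f 0‖| ≤ |Real.log ‖f 0‖| * R := le_mul_of_one_le_right (abs_nonneg _) hR
  have hAR : A ≤ A * R := le_mul_of_one_le_right hA hR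
  have hJ : Real.circleAverage (fun z => Real.log ‖f z‖) 0 (3 * R) ≤ A * (1 + 3 * R) := by
    refine Real.circleAverage_mono_on_of_le_circle (circleIntegrable_log_norm_of_entire hf _ _) ?_
    intro z hz
    rw [abs_of_pos (by linarith), mem_sphere_zero_iff_norm] at hz
    rcases eq_or_ne (f z) 0 with h | h
    · rw [h, norm_zero, Real.log_zero]; positivity
    · rw [Real.log_le_iff_le_exp (norm_pos_iff.2 h)]
      simpa [hz] using hfA z
  have hcard : ∀ (S : Multiset ℂ) (h : ℂ → ℂ), Differentiable ℂ h →
      (∀ a ∈ S, a ∈ Metric.closedBall (0:ℂ) R) →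
      (∀ z, f z = (S.map fun a => z - a).prod * h z) → (S.card : ℝ) ≤ C * R := by
    intro S h hh hS hfac
    have h1 := log_norm_add_sum_le_circleAverage S (r := 3 * R) (by linarith)
      (fun a ha => by have := hS a ha; rw [mem_closedBall_zero_iff] at this; linarith)
      hf h0 hh hfac
    have h2 : (S.card : ℝ) ≤ (S.map fun a => Real.log (3 * R) - Real.log ‖a‖).sum := by
      have := Multiset.card_nsmul_le_sum (s := S.map fun a => Real.log (3 * R) - Real.log ‖a‖)
        (a := (1:ℝ)) (by
          intro x hx
          obtain ⟨a, ha, rfl⟩ := Multiset.mem_map.1 hx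
          have ha' := hS a ha
          rw [mem_closedBall_zero_iff] at ha'
          have h3 : Real.log ‖a‖ ≤ Real.log R := by
            rcases (norm_nonneg a).eq_or_lt with h | h
            · rw [← h, Real.log_zero]; exact hlogR
            · exact Real.log_le_log h ha'
          have h4 : (1:ℝ) ≤ Real.log 3 := by
            rw [Real.le_log_iff_exp_le (by norm_num)]
            have := Real.exp_one_lt_d9
            linarith
          rw [Real.log_mul (by norm_num) hR0.ne']
          linarith)
      simpa using this
    rw [hC]
    nlinarith
  obtain ⟨S, h, hh, hS, hfac, hne⟩ := exists_factorization hf hcard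
  refine ⟨S, h, hh, fun a ha => mem_closedBall_zero_iff.1 (hS a ha), hfac,
    fun z hz => hne z (mem_closedBall_zero_iff.2 hz), hcard S h hh hS hfac, fun z hz => ?_⟩
  have hSc := hcard S h hh hS hfac
  have hz' : ‖z‖ < R := mem_ball_zero_iff.1 hz
  have hhz : ‖h z‖ ≤ Real.exp (A * (2 + R)) := by
    refine Complex.norm_le_of_forall_mem_frontier_norm_le (U := Metric.ball (0:ℂ) (R + 1))
      Metric.isBounded_ball hh.diffContOnCl (fun w hw => ?_)
      (subset_closure (Metric.ball_subset_ball (by linarith) hz))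
    rw [frontier_ball _ (by linarith), mem_sphere_zero_iff_norm] at hw
    have h1 : (1:ℝ) ≤ ‖(S.map fun a => w - a).prod‖ := by
      rw [norm_multiset_prod]
      apply Multiset.one_le_prod
      intro x hx
      obtain ⟨a, ha, rfl⟩ := Multiset.mem_map.1 hx
      have h2 := mem_closedBall_zero_iff.1 (hS a ha)
      have h3 := norm_sub_norm_le w a
      linarith
    have h2 := hfA w
    rw [hfac w, norm_mul, hw] at h2
    calc ‖h w‖ = 1 * ‖h w‖ := (one_mul _).symm
      _ ≤ ‖(S.map fun a => w - a).prod‖ * ‖h w‖ := by gcongr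
      _ ≤ _ := h2
      _ = _ := by ring_nf
  have hh0p : 0 < ‖h 0‖ := norm_pos_iff.2 (hne 0 (by simp [hR0.le]))
  have hhzp : 0 < ‖h z‖ := norm_pos_iff.2 (hne z (by simpa using hz'.le))
  have h1 : Real.log ‖h z‖ ≤ A * (2 + R) := (Real.log_le_iff_le_exp hhzp).2 hhz
  have h2 : Real.log ‖f 0‖ ≤ S.card * Real.log R + Real.log ‖h 0‖ := by
    have h3 : ‖f 0‖ ≤ R ^ S.card * ‖h 0‖ := by
      rw [hfac 0, norm_mul, norm_multiset_prod]
      gcongr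
      have hpos : ∀ T : Multiset ℂ, (∀ a ∈ T, ‖a‖ ≤ R) →
          (T.map fun a => ‖(0:ℂ) - a‖).prod ≤ R ^ T.card := by
        intro T
        induction T using Multiset.induction with
        | empty => simp
        | cons a T ih =>
          intro hT
          simp only [Multiset.map_cons, Multiset.prod_cons, Multiset.card_cons, pow_succ']
          have h5 := ih fun b hb => hT b (Multiset.mem_cons_of_mem hb)
          have h6 := hT a (Multiset.mem_cons_self a T)
          have h7 : (0:ℝ) ≤ (T.map fun a => ‖(0:ℂ) - a‖).prod := by
            rw [← norm_multiset_prod]; exact norm_nonneg _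
          gcongr
          simpa using h6
      exact hpos S fun a ha => mem_closedBall_zero_iff.1 (hS a ha)
    rw [← Real.log_pow, ← Real.log_mul (by positivity) hh0p.ne']
    exact Real.log_le_log hfp h3
  have h3 : (S.card : ℝ) * Real.log R ≤ C * R * Real.log R := by gcongr
  have h4 : A * (2 + R) + |Real.log ‖f 0‖| ≤ C * R := by rw [hC]; nlinarith
  nlinarith

lemma exists_good_radius {Q : ℂ → ℂ} (hQ : Differentiable ℂ Q) (h0 : Q 0 ≠ 0)
    (hgr : ExpGrowth Q) :
    ∃ c : ℝ, 0 < c ∧ ∀ R : ℝ, 1 ≤ R → ∃ r, R ≤ r ∧ r ≤ 2 * R ∧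
      ∀ a, Q a = 0 → c ≤ |r - ‖a‖| := by
  obtain ⟨C, hC, hfac⟩ := exists_factorization_of_expGrowth hQ h0 hgr
  refine ⟨1 / (2 * (3 * C + 1)), by positivity, fun R hR => ?_⟩
  set c := 1 / (2 * (3 * C + 1)) with hc
  have hc1 : c ≤ 1 := by
    rw [hc, div_le_one (by positivity)]; linarith
  obtain ⟨S, h, -, hS, hQS, hne, hcard, -⟩ := hfac (3 * R) (by linarith)
  set N := S.card with hN
  have hN1 : (0:ℝ) < N + 1 := by positivity
  set p : ℕ → ℝ := fun i => R + i * (R / (N + 1)) with hp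
  by_contra! hcon
  have hpi : ∀ i ∈ Finset.range (N + 1), R ≤ p i ∧ p i ≤ 2 * R := by
    intro i hi
    have hi' : (i:ℝ) ≤ N + 1 := by
      have := Finset.mem_range.1 hi
      exact_mod_cast this.le
    have h1 : (i:ℝ) * (R / (N + 1)) ≤ (N + 1) * (R / (N + 1)) := by gcongr
    have h2 : ((N:ℝ) + 1) * (R / (N + 1)) = R := by field_simp
    have h3 : 0 ≤ (i:ℝ) * (R / (N + 1)) := by positivity
    simp only [hp]
    constructor <;> linarith
  have hbad : ∀ i ∈ Finset.range (N + 1), ∃ a ∈ S.toFinset, |p i - ‖a‖| < c := by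
    intro i hi
    obtain ⟨a, ha, hlt⟩ := hcon (p i) (hpi i hi).1 (hpi i hi).2
    refine ⟨a, ?_, hlt⟩
    have ha3 : ‖a‖ ≤ 3 * R := by
      have := (abs_lt.1 hlt).1
      linarith [(hpi i hi).2]
    rw [hQS a] at ha
    have := (mul_eq_zero.1 ha).resolve_right (hne a ha3)
    rw [Multiset.prod_eq_zero_iff] at this
    obtain ⟨b, hb, hab⟩ := Multiset.mem_map.1 this
    rw [sub_eq_zero.1 hab]
    exact Multiset.mem_toFinset.2 hb
  choose! φ hφ hφ' using hbad
  have hlt : S.toFinset.card < (Finset.range (N + 1)).card := by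
    rw [Finset.card_range]
    exact Nat.lt_succ_of_le (Multiset.toFinset_card_le S)
  obtain ⟨i, hi, j, hj, hij, heq⟩ := Finset.exists_ne_map_eq_of_card_lt_of_maps_to hlt
    (f := φ) (fun i hi => hφ i hi)
  have h1 := abs_lt.1 (hφ' i hi)
  have h2 := abs_lt.1 (hφ' j hj)
  rw [heq] at h1
  have h3 : |p i - p j| < 2 * c := by rw [abs_lt]; constructor <;> linarith
  have h4 : p i - p j = ((i:ℝ) - j) * (R / (N + 1)) := by simp only [hp]; ring
  have h5 : (1:ℝ) ≤ |(i:ℝ) - j| := by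
    have : (i:ℤ) - j ≠ 0 := by
      intro h; apply hij; omega
    have := Int.one_le_abs this
    exact_mod_cast this
  have h6 : 2 * c ≤ R / (N + 1) := by
    rw [hc, le_div_iff₀ hN1]
    have : 2 * (1 / (2 * (3 * C + 1))) * ((N:ℝ) + 1) = (N + 1) / (3 * C + 1) := by
      field_simp
    rw [this, div_le_iff₀ (by positivity)]
    nlinarith
  rw [h4, abs_mul, abs_of_pos (by positivity : 0 < R / ((N:ℝ) + 1))] at h3
  have h7 : R / ((N:ℝ) + 1) ≤ |(i:ℝ) - j| * (R / (N + 1)) :=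
    le_mul_of_one_le_left (by positivity) h5
  linarith

/-- Pointwise logarithmic derivative lemma on circles which stay away from the zeros. -/
lemma posLog_logDeriv_le {f : ℂ → ℂ} (hf : Differentiable ℂ f) (h0 : f 0 ≠ 0)
    (hgr : ExpGrowth f) {c : ℝ} (hc : 0 < c) :
    ∃ B : ℝ, 0 ≤ B ∧ ∀ r : ℝ, 1 ≤ r → (∀ a, f a = 0 → c ≤ |r - ‖a‖|) → ∀ z, ‖z‖ = r →
      Real.posLog ‖deriv f z / f z‖ ≤ B * (1 + Real.log r) := by
  obtain ⟨C, hC, hfac⟩ := exists_factorization_of_expGrowth hf h0 hgr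
  set D : ℝ := 4 * C / c + 40 * C + 8 with hD
  have hD1 : 1 ≤ D := by
    have : 0 ≤ 4 * C / c := by positivity
    rw [hD]; linarith
  have hlogD : 0 ≤ Real.log D := Real.log_nonneg hD1
  refine ⟨1 + Real.log D, by linarith, fun r hr hgood z hz => ?_⟩
  have hr0 : 0 < r := by linarith
  have hlogr : 0 ≤ Real.log r := Real.log_nonneg hr
  obtain ⟨S, h, hh, hS, hfS, hne, hcard, hlog⟩ := hfac (4 * r) (by linarith)
  have hlog4 : Real.log (4 * r) ≤ 4 * r := (Real.log_le_sub_one_of_pos (by linarith)).trans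
    (by linarith)
  have hlog4' : 0 ≤ Real.log (4 * r) := Real.log_nonneg (by linarith)
  have h1 := norm_logDeriv_le_of_ne_zero (R := 4 * r) (K := C * (4 * r) * (1 + Real.log (4 * r)) + 1)
    (by linarith) hh (fun w hw => hne w (mem_ball_zero_iff.1 hw).le)
    (fun w hw => (hlog w hw).trans (by linarith)) (by positivity) (w := z) (by rw [hz]; linarith)
  have h2 := norm_logDeriv_le_of_factorization S (z := z) hc (fun a ha => by
    have hfa : f a = 0 := by
      rw [hfS a, Multiset.prod_eq_zero (Multiset.mem_map.2 ⟨a, ha, sub_self a⟩), zero_mul]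
    have := hgood a hfa
    rw [← hz] at this
    exact this.trans (abs_norm_sub_norm_le z a)) hh hfS (hne z (by rw [hz]; linarith))
  have h3 : ‖deriv f z / f z‖ ≤ D * r := by
    refine h2.2.trans ?_
    have h4 : (S.card : ℝ) / c ≤ C * (4 * r) / c := by gcongr
    have h5 : 8 * (C * (4 * r) * (1 + Real.log (4 * r)) + 1) / (4 * r) =
        8 * C * (1 + Real.log (4 * r)) + 2 / r := by field_simp; ring
    have h6 : 2 / r ≤ 2 := by rw [div_le_iff₀ hr0]; linarith
    have h7 : C * Real.log (4 * r) ≤ C * (4 * r) := by gcongr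
    have h8 : C ≤ C * r := le_mul_of_one_le_right hC hr
    have h9 : C * (4 * r) / c = 4 * C / c * r := by ring
    rw [hD]
    nlinarith
  calc Real.posLog ‖deriv f z / f z‖ ≤ Real.posLog (D * r) :=
        Real.posLog_le_posLog (norm_nonneg _) h3
    _ = Real.log D + Real.log r := by
        rw [Real.posLog_eq_log, Real.log_mul (by positivity) hr0.ne']
        rw [abs_of_pos (by positivity)]
        nlinarith
    _ ≤ _ := by nlinarith

lemma circleIntegrable_posLog_norm_of_continuousOn {f : ℂ → ℂ} {r : ℝ}
    (hf : ContinuousOn f (Metric.sphere 0 |r|)) :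
    CircleIntegrable (fun z => Real.posLog ‖f z‖) 0 r :=
  (Real.continuous_posLog.comp_continuousOn hf.norm).circleIntegrable'

open InnerProductSpace in
lemma log_norm_le_three_mul_circleAverage {h : ℂ → ℂ} (hh : Differentiable ℂ h)
    (hne : ∀ z, h z ≠ 0) {r : ℝ} (hr : 0 < r) {w : ℂ} (hw : ‖w‖ < r / 2) :
    Real.log ‖h w‖ ≤ 3 * Real.circleAverage (fun z => Real.posLog ‖h z‖) 0 r := by
  have hu : HarmonicOnNhd (fun z => Real.log ‖h z‖) (Metric.closedBall 0 r) := fun z _ =>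
    (hh.analyticAt z).harmonicAt_log_norm (hne z)
  have hwb : w ∈ Metric.ball (0:ℂ) r := by rw [mem_ball_zero_iff]; linarith
  have h1 := hu.circleAverage_re_herglotzRieszKernel_smul hwb
  have hc : ContinuousOn (fun z => Real.log ‖h z‖) (Metric.sphere 0 |r|) := by
    rw [abs_of_pos hr]
    exact hu.continuousOn.mono Metric.sphere_subset_closedBall
  have hk : ContinuousOn (re ∘ herglotzRieszKernel 0 w) (Metric.sphere 0 |r|) :=
    Complex.continuous_re.comp_continuousOn (continuousOn_herglotzRieszKernel_sphere hwb)
  have hp := circleIntegrable_posLog_norm_of_continuousOn (r := r) hh.continuous.continuousOn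
  rw [← h1, ← smul_eq_mul, ← Real.circleAverage_smul]
  refine Real.circleAverage_mono (hk.smul hc).circleIntegrable' (hp.const_smul) fun z hz => ?_
  rw [abs_of_pos hr] at hz
  have h2 := le_re_herglotzRieszKernel hz hwb
  have h3 := re_herglotzRieszKernel_le hz hwb
  set k := ((z - 0 + (w - 0)) / ((z - 0) - (w - 0))).re with hkdef
  have hk0 : 0 ≤ k := by
    refine le_trans ?_ h2
    rw [sub_zero]
    apply div_nonneg <;> linarith [norm_nonneg w]
  have hk3 : k ≤ 3 := by
    refine h3.trans ?_
    rw [sub_zero, div_le_iff₀ (by linarith)]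
    linarith
  have h5 : Real.log ‖h z‖ ≤ Real.posLog ‖h z‖ := le_max_right _ _
  have h6 : (0:ℝ) ≤ Real.posLog ‖h z‖ := Real.posLog_nonneg
  show k * Real.log ‖h z‖ ≤ 3 * Real.posLog ‖h z‖
  nlinarith

/-- An entire function whose proximity function grows logarithmically is a polynomial. -/
lemma exists_polynomial_of_circleAverage_posLog_le {g : ℂ → ℂ} (hg : Differentiable ℂ g)
    (h0 : g 0 ≠ 0) {A : ℝ} (hA : 0 ≤ A)
    (hm : ∀ R : ℝ, 1 ≤ R → ∃ r, R ≤ r ∧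
      Real.circleAverage (fun z => Real.posLog ‖g z‖) 0 r ≤ A * (1 + Real.log r)) :
    ∃ p : Polynomial ℂ, ∀ z, g z = p.eval z := by
  choose! ρ hρ hρm using hm
  have hcard : ∀ (S : Multiset ℂ) (h : ℂ → ℂ), Differentiable ℂ h → (∀ a ∈ S, a ∈ (univ : Set ℂ)) →
      (∀ z, g z = (S.map fun a => z - a).prod * h z) → (S.card : ℝ) ≤ A := by
    intro S h hh _ hfac
    by_contra! hlt
    set E := ∑ a ∈ S.toFinset, ‖a‖ with hE
    have hSE : ∀ a ∈ S, ‖a‖ ≤ E := fun a ha =>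
      Finset.single_le_sum (f := fun a : ℂ => ‖a‖) (fun _ _ => norm_nonneg _)
        (Multiset.mem_toFinset.2 ha)
    have hE0 : 0 ≤ E := Finset.sum_nonneg fun _ _ => norm_nonneg _
    set B := A - Real.log ‖g 0‖ + (S.map fun a => Real.log ‖a‖).sum with hB
    have hbound : ∀ R : ℝ, 1 + E ≤ R → (S.card - A) * Real.log (ρ R) ≤ B := by
      intro R hR
      have hR1 : 1 ≤ R := by linarith
      have hr := hρ R hR1
      have hr0 : 0 < ρ R := by linarith
      have h1 := log_norm_add_sum_le_circleAverage S hr0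
        (fun a ha => by linarith [hSE a ha]) hg h0 hh hfac
      have h2 : Real.circleAverage (fun z => Real.log ‖g z‖) 0 (ρ R) ≤
          Real.circleAverage (fun z => Real.posLog ‖g z‖) 0 (ρ R) :=
        Real.circleAverage_mono (circleIntegrable_log_norm_of_entire hg _ _)
          (circleIntegrable_posLog_norm_of_continuousOn hg.continuous.continuousOn)
          fun z _ => le_max_right _ _
      have h3 : (S.map fun a => Real.log (ρ R) - Real.log ‖a‖).sum =
          S.card * Real.log (ρ R) - (S.map fun a => Real.log ‖a‖).sum := by
        rw [Multiset.sum_map_sub]; simp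
      have h4 := hρm R hR1
      rw [hB]
      linarith
    have hpos : 0 < S.card - A := by linarith
    set R := max (1 + E) (Real.exp ((B + 1) / (S.card - A))) with hR
    have h1 := hbound R (le_max_left _ _)
    have hR1 : 1 ≤ R := le_trans (by linarith) (le_max_left _ _)
    have h2 : (B + 1) / (S.card - A) ≤ Real.log (ρ R) := by
      rw [Real.le_log_iff_exp_le (by linarith [hρ R hR1])]
      exact (le_max_right _ _).trans (hρ R hR1)
    rw [div_le_iff₀ hpos] at h2
    linarith
  obtain ⟨S, h, hh, -, hfac, hne⟩ := exists_factorization hg hcard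
  replace hne : ∀ z, h z ≠ 0 := fun z => hne z (mem_univ z)
  set E := ∑ a ∈ S.toFinset, ‖a‖ with hE
  have hSE : ∀ a ∈ S, ‖a‖ ≤ E := fun a ha =>
    Finset.single_le_sum (f := fun a : ℂ => ‖a‖) (fun _ _ => norm_nonneg _)
      (Multiset.mem_toFinset.2 ha)
  have hE0 : 0 ≤ E := Finset.sum_nonneg fun _ _ => norm_nonneg _
  have hmh : ∀ R : ℝ, 1 + E ≤ R →
      Real.circleAverage (fun z => Real.posLog ‖h z‖) 0 (ρ R) ≤ A * (1 + Real.log (ρ R)) := by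
    intro R hR
    have hR1 : 1 ≤ R := by linarith
    refine le_trans ?_ (hρm R hR1)
    refine Real.circleAverage_mono
      (circleIntegrable_posLog_norm_of_continuousOn hh.continuous.continuousOn)
      (circleIntegrable_posLog_norm_of_continuousOn hg.continuous.continuousOn) fun z hz => ?_
    rw [abs_of_pos (by linarith [hρ R hR1]), mem_sphere_zero_iff_norm] at hz
    refine Real.posLog_le_posLog (norm_nonneg _) ?_
    have h1 : (1:ℝ) ≤ ‖(S.map fun a => z - a).prod‖ := by
      rw [norm_multiset_prod]
      apply Multiset.one_le_prod
      intro x hx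
      obtain ⟨a, ha, rfl⟩ := Multiset.mem_map.1 hx
      have h3 := norm_sub_norm_le z a
      linarith [hSE a ha, hρ R hR1]
    rw [hfac z, norm_mul]
    exact le_mul_of_one_le_left (norm_nonneg _) h1
  set L := |Real.log ‖h 0‖| with hL
  have hlim : Tendsto (fun R : ℝ => 16 * (3 * (A * (1 + Real.log (ρ R))) + L + 1) / ρ R)
      atTop (𝓝 0) := by
    have hρt : Tendsto ρ atTop atTop :=
      tendsto_atTop_mono' atTop ((eventually_ge_atTop 1).mono fun R hR => hρ R hR) tendsto_id
    have h1 : Tendsto (fun r : ℝ => 16 * (3 * (A * (1 + Real.log r)) + L + 1) / r) atTop (𝓝 0) := by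
      have h2 : Tendsto (fun r : ℝ => Real.log r / r) atTop (𝓝 0) :=
        Real.isLittleO_log_id_atTop.tendsto_div_nhds_zero
      have h3 : Tendsto (fun r : ℝ => r⁻¹) atTop (𝓝 0) := tendsto_inv_atTop_zero
      have h4 := (h2.const_mul (48 * A)).add (h3.const_mul (16 * (3 * A + L + 1)))
      simp only [mul_zero, add_zero] at h4
      refine h4.congr fun r => ?_
      ring
    exact h1.comp hρt
  have hderiv : ∀ w, deriv h w = 0 := by
    intro w
    have hle : ‖deriv h w / h w‖ ≤ 0 := by
      refine ge_of_tendsto hlim ?_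
      filter_upwards [eventually_ge_atTop (1 + E), eventually_ge_atTop (8 * ‖w‖)] with R hR hRw
      have hR1 : 1 ≤ R := by linarith
      have hr := hρ R hR1
      have hr0 : 0 < ρ R := by linarith
      have hlogr : 0 ≤ Real.log (ρ R) := Real.log_nonneg (by linarith)
      have h1 := norm_logDeriv_le_of_ne_zero (R := ρ R / 2)
        (K := 3 * (A * (1 + Real.log (ρ R))) + L + 1) (by linarith) hh (fun z _ => hne z)
        (fun z hz => by
          have h2 := log_norm_le_three_mul_circleAverage hh hne hr0 (mem_ball_zero_iff.1 hz)
          have h3 := hmh R hR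
          have h4 := neg_abs_le (Real.log ‖h 0‖)
          linarith) (by positivity) (w := w) (by linarith)
      refine h1.trans (le_of_eq ?_)
      field_simp
      ring
    have := norm_le_zero_iff.1 hle
    exact (div_eq_zero_iff.1 this).resolve_right (hne w)
  have hconst : ∀ z, h z = h 0 := fun z => is_const_of_deriv_eq_zero hh hderiv z 0
  refine ⟨(S.map fun a => Polynomial.X - Polynomial.C a).prod * Polynomial.C (h 0), fun z => ?_⟩
  rw [hfac z, hconst z, Polynomial.eval_mul, Polynomial.eval_C, Polynomial.eval_multiset_prod,
    Multiset.map_map]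
  congr 2
  refine Multiset.map_congr rfl fun a _ => ?_
  simp

lemma exists_logDeriv_polynomial_le {p : Polynomial ℂ} (hp : p ≠ 0) :
    ∃ R : ℝ, ∀ z : ℂ, R ≤ ‖z‖ →
      p.eval z ≠ 0 ∧ ‖deriv (fun w => p.eval w) z / p.eval z‖ ≤ 1 := by
  set S := p.roots with hS
  set E := ∑ a ∈ S.toFinset, ‖a‖ with hE
  refine ⟨E + S.card + 1, fun z hz => ?_⟩
  have hfac : ∀ z, p.eval z = (S.map fun a => z - a).prod * (fun _ => p.leadingCoeff) z := by
    intro z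
    conv_lhs => rw [(IsAlgClosed.splits p).eq_prod_roots]
    rw [Polynomial.eval_mul, Polynomial.eval_C, Polynomial.eval_multiset_prod, Multiset.map_map,
      mul_comm]
    congr 2
    refine Multiset.map_congr rfl fun a _ => ?_
    simp
  have h1 := norm_logDeriv_le_of_factorization S (z := z) (δ := S.card + 1) (by positivity)
    (fun a ha => by
      have h2 : ‖a‖ ≤ E := Finset.single_le_sum (f := fun a : ℂ => ‖a‖)
        (fun _ _ => norm_nonneg _) (Multiset.mem_toFinset.2 ha)
      have h3 := norm_sub_norm_le z a
      linarith) (f := fun w => p.eval w) (differentiable_const p.leadingCoeff) hfac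
    (Polynomial.leadingCoeff_ne_zero.2 hp)
  refine ⟨h1.1, h1.2.trans ?_⟩
  rw [deriv_const, zero_div, norm_zero, add_zero, div_le_one (by positivity)]
  linarith

/-- If the proximity function of an entire function is controlled by logarithmic derivatives of
finitely many entire functions of exponential type, then it is constant. -/
lemma eq_of_circleAverage_posLog_le_logDeriv {g : ℂ → ℂ} (hg : Differentiable ℂ g) (h0 : g 0 ≠ 0)
    (𝒢 : Finset (ℂ → ℂ)) (h𝒢 : ∀ f ∈ 𝒢, Differentiable ℂ f ∧ f 0 ≠ 0 ∧ ExpGrowth f)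
    (hpoly : (∃ p : Polynomial ℂ, ∀ z, g z = p.eval z) →
      ∀ f ∈ 𝒢, ∃ p : Polynomial ℂ, ∀ z, f z = p.eval z)
    {B₀ B₁ : ℝ} (hB₀ : 0 ≤ B₀) (hB₁ : 0 ≤ B₁)
    (hm : ∀ r σ : ℝ, 0 < r → 0 ≤ σ →
      (∀ f ∈ 𝒢, ∀ z, ‖z‖ = r → f z ≠ 0 ∧ Real.posLog ‖deriv f z / f z‖ ≤ σ) →
      Real.circleAverage (fun z => Real.posLog ‖g z‖) 0 r ≤ B₀ + B₁ * σ) (w : ℂ) :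
    g w = g 0 := by
  have hgpoly : ∃ p : Polynomial ℂ, ∀ z, g z = p.eval z := by
    set Q : ℂ → ℂ := fun z => ∏ f ∈ 𝒢, f z with hQdef
    have hQd : Differentiable ℂ Q := Differentiable.fun_finsetProd fun f hf => (h𝒢 f hf).1
    have hQ0 : Q 0 ≠ 0 := Finset.prod_ne_zero_iff.2 fun f hf => (h𝒢 f hf).2.1
    have hQe : ExpGrowth Q := ExpGrowth.prod 𝒢 fun f hf => (h𝒢 f hf).2.2
    obtain ⟨c, hc, hgood⟩ := exists_good_radius hQd hQ0 hQe
    have hB : ∀ f ∈ 𝒢, ∃ B : ℝ, 0 ≤ B ∧ ∀ r : ℝ, 1 ≤ r → (∀ a, f a = 0 → c ≤ |r - ‖a‖|) →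
        ∀ z, ‖z‖ = r → Real.posLog ‖deriv f z / f z‖ ≤ B * (1 + Real.log r) := fun f hf =>
      posLog_logDeriv_le (h𝒢 f hf).1 (h𝒢 f hf).2.1 (h𝒢 f hf).2.2 hc
    choose! B hB0 hB using hB
    have hsum0 : 0 ≤ ∑ f ∈ 𝒢, B f := Finset.sum_nonneg hB0
    refine exists_polynomial_of_circleAverage_posLog_le hg h0
      (A := B₀ + B₁ * ∑ f ∈ 𝒢, B f) (by positivity) fun R hR => ?_
    obtain ⟨r, hRr, -, hr⟩ := hgood R hR
    have hr1 : 1 ≤ r := hR.trans hRr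
    have hlog : 0 ≤ Real.log r := Real.log_nonneg hr1
    have hgf : ∀ f ∈ 𝒢, ∀ a, f a = 0 → c ≤ |r - ‖a‖| := fun f hf a ha =>
      hr a (Finset.prod_eq_zero hf ha)
    refine ⟨r, hRr, (hm r ((∑ f ∈ 𝒢, B f) * (1 + Real.log r)) (by linarith) (by positivity)
      fun f hf z hz => ⟨fun h => ?_, ?_⟩).trans ?_⟩
    · have := hgf f hf z h
      rw [hz, sub_self, abs_zero] at this
      linarith
    · refine (hB f hf r hr1 (hgf f hf) z hz).trans ?_
      gcongr
      exact Finset.single_le_sum hB0 hf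
    · nlinarith
  have hp := hpoly hgpoly
  obtain ⟨p, hpg⟩ := hgpoly
  by_cases hdeg : 0 < p.degree
  swap
  · rw [hpg, hpg, Polynomial.eq_C_of_degree_le_zero (not_lt.1 hdeg)]
    simp
  exfalso
  have hR : ∀ f ∈ 𝒢, ∃ R : ℝ, ∀ z : ℂ, R ≤ ‖z‖ → f z ≠ 0 ∧ ‖deriv f z / f z‖ ≤ 1 := by
    intro f hf
    obtain ⟨q, hq⟩ := hp f hf
    obtain rfl : f = fun z => q.eval z := funext hq
    refine exists_logDeriv_polynomial_le ?_
    rintro rfl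
    exact (h𝒢 _ hf).2.1 (by simp)
  choose! ρ hρ using hR
  have htend := p.tendsto_norm_atTop hdeg (tendsto_norm_cocompact_atTop (E := ℂ))
  obtain ⟨R, hRp⟩ : ∃ R : ℝ, ∀ z : ℂ, R ≤ ‖z‖ → Real.exp (B₀ + 1) ≤ ‖p.eval z‖ := by
    have h1 := htend.eventually_ge_atTop (Real.exp (B₀ + 1))
    rw [← Metric.cobounded_eq_cocompact, ← comap_norm_atTop, eventually_comap] at h1
    obtain ⟨R, hR⟩ := eventually_atTop.1 h1
    exact ⟨R, fun z hz => hR _ hz z rfl⟩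
  set r := 1 + |R| + ∑ f ∈ 𝒢, |ρ f| with hr
  have hs0 : 0 ≤ ∑ f ∈ 𝒢, |ρ f| := Finset.sum_nonneg fun _ _ => abs_nonneg _
  have hr0 : 0 < r := by positivity
  have h1 := hm r 0 hr0 le_rfl fun f hf z hz => by
    have h2 : |ρ f| ≤ ∑ f ∈ 𝒢, |ρ f| :=
      Finset.single_le_sum (f := fun f => |ρ f|) (fun _ _ => abs_nonneg _) hf
    have h3 := hρ f hf z (by linarith [le_abs_self (ρ f), abs_nonneg R])
    refine ⟨h3.1, le_of_eq ?_⟩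
    rw [Real.posLog_eq_zero_iff, abs_norm]
    exact h3.2
  have h2 : B₀ + 1 ≤ Real.circleAverage (fun z => Real.posLog ‖g z‖) 0 r := by
    rw [← Real.circleAverage_const (B₀ + 1) (0:ℂ) r]
    refine Real.circleAverage_mono (circleIntegrable_const _ _ _)
      (circleIntegrable_posLog_norm_of_continuousOn hg.continuous.continuousOn) fun z hz => ?_
    rw [abs_of_pos hr0, mem_sphere_zero_iff_norm] at hz
    have h3 := hRp z (by linarith [le_abs_self R])
    rw [← hpg] at h3
    have h4 : B₀ + 1 ≤ Real.log ‖g z‖ := by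
      rw [Real.le_log_iff_exp_le ((Real.exp_pos _).trans_le h3)]
      exact h3
    exact h4.trans (le_max_right _ _)
  linarith

lemma analyticOrderNatAt_le_iteratedDeriv_add {f : ℂ → ℂ} (hf : Differentiable ℂ f) {t : ℕ} {z₀ : ℂ}
    (h0 : iteratedDeriv t f z₀ ≠ 0) (z : ℂ) :
    analyticOrderNatAt f z ≤ analyticOrderNatAt (iteratedDeriv t f) z + t := by
  have hft := hf.iteratedDeriv_complex t
  have htop := analyticOrderAt_ne_top_of_entire hft h0 z
  have hf0 : analyticOrderAt f z ≠ ⊤ := by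
    intro h
    have h1 : ∀ N : ℕ, (N : ℕ∞) ≤ analyticOrderAt (iteratedDeriv t f) z := by
      intro N
      rw [natCast_le_analyticOrderAt_iff_iteratedDeriv_eq_zero (hft.analyticAt z)]
      intro i _
      rw [iteratedDeriv_eq_iterate, iteratedDeriv_eq_iterate, ← Function.iterate_add_apply,
        ← iteratedDeriv_eq_iterate]
      exact (natCast_le_analyticOrderAt_iff_iteratedDeriv_eq_zero (hf.analyticAt z)).1
        (h ▸ le_top : ((i + t + 1 : ℕ) : ℕ∞) ≤ _) _ (by omega)
    exact htop (ENat.eq_top_iff_forall_ge.2 h1)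
  by_contra! hlt
  have h1 : ((analyticOrderNatAt (iteratedDeriv t f) z + 1 : ℕ) : ℕ∞)
      ≤ analyticOrderAt (iteratedDeriv t f) z := by
    rw [natCast_le_analyticOrderAt_iff_iteratedDeriv_eq_zero (hft.analyticAt z)]
    intro i hi
    rw [iteratedDeriv_eq_iterate, iteratedDeriv_eq_iterate, ← Function.iterate_add_apply,
      ← iteratedDeriv_eq_iterate]
    refine (natCast_le_analyticOrderAt_iff_iteratedDeriv_eq_zero (hf.analyticAt z)).1
      (Nat.cast_analyticOrderNatAt hf0).le _ (by omega)
  rw [← Nat.cast_analyticOrderNatAt htop, Nat.cast_le] at h1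
  omega

lemma analyticOrderNatAt_finset_prod {ι : Type*} (s : Finset ι) {f : ι → ℂ → ℂ} {z : ℂ}
    (hf : ∀ i ∈ s, AnalyticAt ℂ (f i) z) (ht : ∀ i ∈ s, analyticOrderAt (f i) z ≠ ⊤) :
    analyticOrderNatAt (fun w => ∏ i ∈ s, f i w) z = ∑ i ∈ s, analyticOrderNatAt (f i) z ∧
      analyticOrderAt (fun w => ∏ i ∈ s, f i w) z ≠ ⊤ := by
  induction s using Finset.induction_on with
  | empty =>
    have h1 : analyticOrderAt (fun _ : ℂ => (1 : ℂ)) z = 0 :=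
      analyticAt_const.analyticOrderAt_eq_zero.2 one_ne_zero
    simp [analyticOrderNatAt, h1]
  | insert i s hi ih =>
    obtain ⟨h1, h2⟩ := ih (fun j hj => hf j (by simp [hj])) fun j hj => ht j (by simp [hj])
    have ha : AnalyticAt ℂ (fun w => ∏ i ∈ s, f i w) z :=
      Finset.analyticAt_fun_prod _ fun j hj => hf j (by simp [hj])
    have e : (fun w => ∏ j ∈ insert i s, f j w) = f i * fun w => ∏ j ∈ s, f j w := by
      ext w; simp [Finset.prod_insert hi]
    rw [e, analyticOrderNatAt_mul (hf i (by simp)) ha (ht i (by simp)) h2, h1,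
      Finset.sum_insert hi, analyticOrderAt_mul (hf i (by simp)) ha]
    exact ⟨rfl, by simp [ht i (by simp), h2]⟩

lemma differentiable_diffMonomial {g : ℂ → ℂ} (hg : Differentiable ℂ g) (n : ℕ) {k : ℕ}
    (nn tt : Fin k → ℕ) : Differentiable ℂ (diffMonomial n nn tt g) :=
  (hg.pow n).mul (Differentiable.fun_finsetProd fun j _ => (hg.pow (nn j)).iteratedDeriv_complex _)

lemma mul_analyticOrderNatAt_le_diffMonomial {g : ℂ → ℂ} (hg : Differentiable ℂ g) {n k : ℕ}
    {nn tt : Fin k → ℕ} {z₀ : ℂ} (h0 : g z₀ ≠ 0)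
    (hF : ∀ j, iteratedDeriv (tt j) (g ^ nn j) z₀ ≠ 0) (z : ℂ) :
    (n + ∑ j, nn j) * analyticOrderNatAt g z ≤
      analyticOrderNatAt (diffMonomial n nn tt g) z + (∑ j, tt j) * analyticOrderNatAt g z := by
  have hgt := analyticOrderAt_ne_top_of_entire hg h0 z
  have hFd : ∀ j, Differentiable ℂ (iteratedDeriv (tt j) (g ^ nn j)) := fun j =>
    (hg.pow (nn j)).iteratedDeriv_complex _
  obtain ⟨h1, h2⟩ := analyticOrderNatAt_finset_prod Finset.univ
    (fun j _ => (hFd j).analyticAt z) fun j _ => analyticOrderAt_ne_top_of_entire (hFd j) (hF j) z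
  have h3 : analyticOrderNatAt (diffMonomial n nn tt g) z =
      n * analyticOrderNatAt g z + ∑ j, analyticOrderNatAt (iteratedDeriv (tt j) (g ^ nn j)) z := by
    have e : diffMonomial n nn tt g =
        g ^ n * fun w => ∏ j, iteratedDeriv (tt j) (g ^ nn j) w := rfl
    rw [e, analyticOrderNatAt_mul ((hg.analyticAt z).pow n)
      (Finset.analyticAt_fun_prod _ fun j _ => (hFd j).analyticAt z)
      (analyticOrderAt_ne_top_of_entire (hg.pow n) (pow_ne_zero n h0) z) h2, h1,
      analyticOrderNatAt_pow (hg.analyticAt z), smul_eq_mul]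
  rcases Nat.eq_zero_or_pos (analyticOrderNatAt g z) with hμ | hμ
  · simp [hμ]
  have h4 : ∀ j, nn j * analyticOrderNatAt g z ≤
      analyticOrderNatAt (iteratedDeriv (tt j) (g ^ nn j)) z + tt j * analyticOrderNatAt g z := by
    intro j
    have := analyticOrderNatAt_le_iteratedDeriv_add (hg.pow (nn j)) (hF j) z
    rw [analyticOrderNatAt_pow (hg.analyticAt z), smul_eq_mul] at this
    nlinarith [Nat.zero_le (tt j)]
  have h5 := Finset.sum_le_sum fun j (_ : j ∈ Finset.univ) => h4 j
  rw [Finset.sum_add_distrib, ← Finset.sum_mul, ← Finset.sum_mul] at h5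
  rw [h3, add_mul]
  omega

lemma analyticOrderNatAt_sub_const_eq_zero {f : ℂ → ℂ} (hf : Differentiable ℂ f) {a z : ℂ}
    (h : f z ≠ a) : analyticOrderNatAt (fun w => f w - a) z = 0 := by
  rw [analyticOrderNatAt, ((hf.sub_const a).analyticAt z).analyticOrderAt_eq_zero.2
    (sub_ne_zero.2 h)]
  rfl

/-- The weighted count of zeros comparing `P'` with `P`, `g` and the functions `P - aᵢ`. -/
lemma weighted_order_nonneg {q : ℕ} {a : Fin q → ℂ} (ha : ∀ i, a i ≠ 0)
    (hinj : Function.Injective a) {l : Fin q → ℕ∞} {lam : Fin q → ℝ}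
    (hlam : ∀ i (m : ℕ), l i ≤ m → 1 ≤ lam i * m) {g P : ℂ → ℂ}
    (hP : Differentiable ℂ P) {z₀ : ℂ} (hP0 : deriv P z₀ ≠ 0) (hPa : ∀ i, P z₀ ≠ a i) (hq : 1 ≤ q)
    {d : ℝ} (hd : 1 ≤ d)
    (hord : ∀ z, d * analyticOrderNatAt g z ≤ analyticOrderNatAt P z)
    (hmult : ∀ i ξ, P ξ = a i → ∀ s : ℕ, (s : ℕ∞) < l i →
      iteratedDeriv s (fun w => P w - a i) ξ = 0) (z : ℂ) :
    0 ≤ (analyticOrderNatAt (deriv P) z : ℝ) + (q - 1) * analyticOrderNatAt P z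
      + (1 - q * d) * analyticOrderNatAt g z
      + ∑ i, (lam i - 1) * analyticOrderNatAt (fun w => P w - a i) z := by
  have hq' : (1 : ℝ) ≤ q := by exact_mod_cast hq
  have hord_z := hord z
  have hμ0 : (0 : ℝ) ≤ analyticOrderNatAt g z := by positivity
  by_cases hga : ∃ i, P z = a i
  · obtain ⟨i, hi⟩ := hga
    have hPz : analyticOrderNatAt P z = 0 := by
      simpa using analyticOrderNatAt_sub_const_eq_zero hP (a := 0) (z := z) (hi ▸ ha i)
    have hgz : analyticOrderNatAt g z = 0 := by
      rw [hPz] at hord_z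
      have : (analyticOrderNatAt g z : ℝ) ≤ 0 := by push_cast at hord_z; nlinarith
      exact_mod_cast le_antisymm this hμ0
    have hs : ∑ j, (lam j - 1) * (analyticOrderNatAt (fun w => P w - a j) z : ℝ) =
        (lam i - 1) * (analyticOrderNatAt (fun w => P w - a i) z : ℝ) := by
      refine Finset.sum_eq_single i (fun j _ hj => ?_) (by simp)
      rw [analyticOrderNatAt_sub_const_eq_zero hP fun h => hj (hinj (h.symm.trans hi))]
      simp
    have htop := analyticOrderAt_ne_top_of_entire (hP.sub_const (a i)) (sub_ne_zero.2 (hPa i)) z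
    have hli : l i ≤ (analyticOrderNatAt (fun w => P w - a i) z : ℕ) := by
      rw [Nat.cast_analyticOrderNatAt htop]
      refine ENat.forall_natCast_le_iff_le.1 fun N hN => ?_
      rw [natCast_le_analyticOrderAt_iff_iteratedDeriv_eq_zero ((hP.sub_const (a i)).analyticAt z)]
      exact fun s hs => hmult i z hi s (lt_of_lt_of_le (by exact_mod_cast hs) hN)
    have h1 := hlam i _ hli
    have h2 : analyticOrderNatAt (fun w => P w - a i) z ≤ analyticOrderNatAt (deriv P) z + 1 := by
      have := analyticOrderNatAt_le_iteratedDeriv_add (hP.sub_const (a i)) (t := 1) (z₀ := z₀)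
        (by simpa [iteratedDeriv_one] using hP0) z
      simpa [iteratedDeriv_one] using this
    have h3 : (analyticOrderNatAt (fun w => P w - a i) z : ℝ) ≤ analyticOrderNatAt (deriv P) z + 1 :=
      by exact_mod_cast h2
    rw [hs, hPz, hgz]
    push_cast
    linarith
  · push Not at hga
    have hs : ∑ j, (lam j - 1) * (analyticOrderNatAt (fun w => P w - a j) z : ℝ) = 0 :=
      Finset.sum_eq_zero fun j _ => by
        rw [analyticOrderNatAt_sub_const_eq_zero hP (hga j)]; simp
    have h2 : analyticOrderNatAt P z ≤ analyticOrderNatAt (deriv P) z + 1 := by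
      have := analyticOrderNatAt_le_iteratedDeriv_add hP (t := 1) (z₀ := z₀)
        (by simpa [iteratedDeriv_one] using hP0) z
      simpa [iteratedDeriv_one] using this
    have h3 : (analyticOrderNatAt P z : ℝ) ≤ analyticOrderNatAt (deriv P) z + 1 := by
      exact_mod_cast h2
    rw [hs]
    rcases Nat.eq_zero_or_pos (analyticOrderNatAt g z) with h | h
    · rw [h]; push_cast
      have : (0 : ℝ) ≤ analyticOrderNatAt (deriv P) z := by positivity
      have : (0 : ℝ) ≤ analyticOrderNatAt P z := by positivity
      nlinarith
    · have : (1 : ℝ) ≤ analyticOrderNatAt g z := by exact_mod_cast h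
      nlinarith

/-- A Jensen-type estimate for a function dominated by a combination of `log ‖fᵢ‖`. -/
lemma circleAverage_le_of_le_sub_sum {ι : Type*} (s : Finset ι) {f : ι → ℂ → ℂ} {c : ι → ℝ}
    (hf : ∀ i, Differentiable ℂ (f i)) (h0 : ∀ i, f i 0 ≠ 0)
    (hord : ∀ z, 0 ≤ ∑ i ∈ s, c i * (analyticOrderNatAt (f i) z : ℝ)) {r : ℝ} (hr : 0 < r)
    {φ : ℂ → ℝ} (hφ : CircleIntegrable φ 0 r) {A : ℝ}
    (h : ∀ z, ‖z‖ = r → φ z ≤ A - ∑ i ∈ s, c i * Real.log ‖f i z‖) :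
    Real.circleAverage φ 0 r ≤ A - ∑ i ∈ s, c i * Real.log ‖f i 0‖ := by
  have h1 := sum_circleAverage_log_norm_ge s hf h0 hord hr
  have hI : ∀ i, CircleIntegrable (fun z => c i * Real.log ‖f i z‖) 0 r := fun i =>
    (circleIntegrable_log_norm_of_entire (hf i) 0 r).const_fun_smul (a := c i)
  have hS : CircleIntegrable (fun z => ∑ i ∈ s, c i * Real.log ‖f i z‖) 0 r := by
    simpa only [Finset.sum_fn] using CircleIntegrable.sum s fun i _ => hI i
  have h2 : Real.circleAverage (fun z => ∑ i ∈ s, c i * Real.log ‖f i z‖) 0 r =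
      ∑ i ∈ s, c i * Real.circleAverage (fun z => Real.log ‖f i z‖) 0 r := by
    rw [Real.circleAverage_fun_sum fun i _ => hI i]
    refine Finset.sum_congr rfl fun i _ => ?_
    have := Real.circleAverage_fun_smul (a := c i) (f := fun z => Real.log ‖f i z‖) (c := 0) (R := r)
    simpa using this
  have h3 : Real.circleAverage φ 0 r ≤
      Real.circleAverage (fun z => A - ∑ i ∈ s, c i * Real.log ‖f i z‖) 0 r := by
    refine Real.circleAverage_mono hφ ((circleIntegrable_const A 0 r).sub hS) fun z hz => h z ?_
    simpa [abs_of_pos hr] using hz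
  have h4 : Real.circleAverage (fun z => A - ∑ i ∈ s, c i * Real.log ‖f i z‖) 0 r =
      A - ∑ i ∈ s, c i * Real.circleAverage (fun z => Real.log ‖f i z‖) 0 r := by
    rw [← h2, ← Real.circleAverage_const A 0 r,
      ← Real.circleAverage_sub (circleIntegrable_const A 0 r) hS, Real.circleAverage_const]
    rfl
  linarith

/-- Proximity to finitely many distinct values is controlled by proximity of the derivative
to zero. -/
lemma exists_sum_posLog_inv_sub_le {ι : Type*} [Fintype ι] {b : ι → ℂ}
    (hb : Function.Injective b) :
    ∃ C : ℝ, ∀ w w' : ℂ, w' ≠ 0 →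
      ∑ i, Real.posLog ‖(w - b i)⁻¹‖ ≤
        Real.posLog ‖w'⁻¹‖ + ∑ i, Real.posLog ‖w' / (w - b i)‖ + C := by
  obtain ⟨δ, hδ, hsep⟩ : ∃ δ > 0, ∀ i j, i ≠ j → δ ≤ ‖b i - b j‖ := by
    have h1 : ∀ p : ι × ι, ∀ᶠ δ in 𝓝[>] (0 : ℝ), p.1 ≠ p.2 → δ ≤ ‖b p.1 - b p.2‖ := by
      intro p
      by_cases h : p.1 = p.2
      · simp [h]
      · have : 0 < ‖b p.1 - b p.2‖ := norm_pos_iff.2 (sub_ne_zero.2 fun h' => h (hb h'))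
        filter_upwards [nhdsWithin_le_nhds (Iic_mem_nhds this)] with δ hδ _ using hδ
    obtain ⟨δ, h2, h3⟩ := ((eventually_all.2 h1).and self_mem_nhdsWithin).exists
    exact ⟨δ, h3, fun i j => h2 (i, j)⟩
  refine ⟨∑ _i : ι, Real.posLog (2 / δ), fun w w' hw' => ?_⟩
  have hnear : ∀ i, Real.posLog ‖(w - b i)⁻¹‖ ≤
      Real.posLog ‖w'⁻¹‖ + Real.posLog ‖w' / (w - b i)‖ := by
    intro i
    have e : (w - b i)⁻¹ = w'⁻¹ * (w' / (w - b i)) := by field_simp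
    conv_lhs => rw [e, norm_mul]
    exact Real.posLog_mul
  have hfar : ∀ i, δ / 2 ≤ ‖w - b i‖ → Real.posLog ‖(w - b i)⁻¹‖ ≤ Real.posLog (2 / δ) := by
    intro i hi
    refine Real.posLog_le_posLog (norm_nonneg _) ?_
    rw [norm_inv, ← inv_div]
    exact inv_anti₀ (by positivity) hi
  have hp : ∀ x, 0 ≤ Real.posLog x := fun x => Real.posLog_nonneg
  by_cases h : ∃ i, ‖w - b i‖ < δ / 2
  · obtain ⟨i₀, hi₀⟩ := h
    have h2 : ∀ i, Real.posLog ‖(w - b i)⁻¹‖ ≤ (if i = i₀ then Real.posLog ‖w'⁻¹‖ else 0) +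
        Real.posLog ‖w' / (w - b i)‖ + Real.posLog (2 / δ) := by
      intro i
      by_cases hi : i = i₀
      · rw [if_pos hi]; linarith [hnear i, hp (2 / δ)]
      · rw [if_neg hi]
        have h3 := hsep i i₀ hi
        have h4 : ‖b i - b i₀‖ ≤ ‖w - b i₀‖ + ‖w - b i‖ := by
          have : b i - b i₀ = (w - b i₀) - (w - b i) := by ring
          rw [this]; exact norm_sub_le _ _
        linarith [hfar i (by linarith), hp ‖w' / (w - b i)‖]
    refine (Finset.sum_le_sum fun i _ => h2 i).trans_eq ?_
    simp [Finset.sum_add_distrib]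
  · push Not at h
    have h2 : ∑ i, Real.posLog ‖(w - b i)⁻¹‖ ≤ ∑ _i : ι, Real.posLog (2 / δ) :=
      Finset.sum_le_sum fun i _ => hfar i (h i)
    have h3 : 0 ≤ ∑ i, Real.posLog ‖w' / (w - b i)‖ := Finset.sum_nonneg fun i _ => hp _
    linarith [hp ‖w'⁻¹‖]

lemma log_norm_iteratedDeriv_le {F : ℂ → ℂ} {z : ℂ} {σ : ℝ} {t : ℕ}
    (h : ∀ s ≤ t, iteratedDeriv s F z ≠ 0)
    (hs : ∀ s < t, Real.posLog ‖deriv (iteratedDeriv s F) z / iteratedDeriv s F z‖ ≤ σ) :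
    Real.log ‖iteratedDeriv t F z‖ ≤ Real.log ‖F z‖ + t * σ := by
  induction t with
  | zero => simp
  | succ t ih =>
    have h1 := ih (fun s hs => h s (by omega)) fun s h => hs s (by omega)
    have h2 := hs t (by omega)
    rw [← iteratedDeriv_succ] at h2
    have h3 : Real.log ‖iteratedDeriv (t + 1) F z / iteratedDeriv t F z‖ ≤ σ :=
      (le_max_right _ _).trans h2
    rw [norm_div, Real.log_div (norm_ne_zero_iff.2 (h _ le_rfl))
      (norm_ne_zero_iff.2 (h t (by omega)))] at h3
    push_cast
    linarith

lemma log_norm_diffMonomial_le {g : ℂ → ℂ} {n k : ℕ} {nn tt : Fin k → ℕ} {z : ℂ} {σ : ℝ}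
    (hg : g z ≠ 0) (h : ∀ j, ∀ s ≤ tt j, iteratedDeriv s (g ^ nn j) z ≠ 0)
    (hs : ∀ j, ∀ s ≤ tt j, Real.posLog
      ‖deriv (iteratedDeriv s (g ^ nn j)) z / iteratedDeriv s (g ^ nn j) z‖ ≤ σ) :
    Real.log ‖diffMonomial n nn tt g z‖ ≤
      (n + ∑ j, (nn j : ℝ)) * Real.log ‖g z‖ + (∑ j, (tt j : ℝ)) * σ := by
  have h1 : Real.log ‖diffMonomial n nn tt g z‖ =
      n * Real.log ‖g z‖ + ∑ j, Real.log ‖iteratedDeriv (tt j) (g ^ nn j) z‖ := by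
    rw [diffMonomial, norm_mul, norm_pow, norm_prod, Real.log_mul (by simp [hg])
      (Finset.prod_ne_zero_iff.2 fun j _ => norm_ne_zero_iff.2 (h j _ le_rfl)), Real.log_pow,
      Real.log_prod fun j _ => norm_ne_zero_iff.2 (h j _ le_rfl)]
  have h2 : ∀ j, Real.log ‖iteratedDeriv (tt j) (g ^ nn j) z‖ ≤
      nn j * Real.log ‖g z‖ + tt j * σ := by
    intro j
    have := log_norm_iteratedDeriv_le (h j) fun s hlt => hs j s hlt.le
    rwa [Pi.pow_apply, norm_pow, Real.log_pow] at this
  have h3 := Finset.sum_le_sum fun j (_ : j ∈ Finset.univ) => h2 j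
  rw [Finset.sum_add_distrib, ← Finset.sum_mul, ← Finset.sum_mul] at h3
  rw [h1, add_mul]
  linarith

lemma posPart_le_of_le_linear {u p M S : ℝ} (hM : 0 ≤ M) (hS : 0 ≤ S) (h : p ≤ M * u + S) :
    max 0 p ≤ M * max 0 u + S ∧ M * max 0 (-u) - S ≤ max 0 (-p) := by
  have h1 : M * u ≤ M * max 0 u := mul_le_mul_of_nonneg_left (le_max_right _ _) hM
  constructor
  · exact max_le (add_nonneg (mul_nonneg hM (le_max_left _ _)) hS) (by linarith)
  · rcases le_total 0 (-u) with hu | hu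
    · rw [max_eq_right hu]; linarith [le_max_right 0 (-p)]
    · rw [max_eq_left hu]; linarith [le_max_left 0 (-p)]

lemma max_zero_sub_max_zero_neg (x : ℝ) : max 0 x - max 0 (-x) = x := by
  rcases le_total 0 x with h | h
  · rw [max_eq_right h, max_eq_left (by linarith)]; ring
  · rw [max_eq_left h, max_eq_right (by linarith)]; ring

lemma posPart_balance {q : ℕ} {lam pp : Fin q → ℝ} (hlam0 : ∀ i, 0 ≤ lam i)
    (hlam1 : ∀ i, lam i ≤ 1) {u p p' σ C c d M T : ℝ} (hM : 0 ≤ M) (hT : 0 ≤ T) (hσ : 0 ≤ σ)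
    (hc : 0 ≤ c) (hdM : d ≤ M) (hA : p ≤ M * u + T * σ)
    (h1 : max 0 (-p) + ∑ i, max 0 (-pp i) ≤ max 0 (-p') + (q + 1) * σ + C)
    (h2 : max 0 p' ≤ max 0 p + σ) (h3 : ∀ i, max 0 p ≤ max 0 (pp i) + c) :
    (q * d - 1 - (∑ i, lam i) * M) * max 0 u ≤
      (C + q * c + (q + 2 + (q + ∑ i, lam i) * T) * σ) -
        (p' + (q - 1) * p + (1 - q * d) * u + ∑ i, (lam i - 1) * pp i) := by
  obtain ⟨hA1, hA2⟩ := posPart_le_of_le_linear hM (mul_nonneg hT hσ) hA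
  have hp := max_zero_sub_max_zero_neg p
  have hp' := max_zero_sub_max_zero_neg p'
  have hu := max_zero_sub_max_zero_neg u
  have hV : 0 ≤ max 0 (-u) := le_max_left _ _
  have hΛ : 0 ≤ ∑ i, lam i := Finset.sum_nonneg fun i _ => hlam0 i
  have hS : ∑ i, (lam i - 1) * pp i ≤
      ((∑ i, lam i) - q) * max 0 p + q * c + ∑ i, max 0 (-pp i) := by
    have h4 : ∀ i, (lam i - 1) * pp i ≤ lam i * max 0 p - max 0 p + c + max 0 (-pp i) := by
      intro i
      have e := max_zero_sub_max_zero_neg (pp i)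
      have h5 : 0 ≤ max 0 (-pp i) := le_max_left _ _
      have h6 := mul_le_mul_of_nonneg_left (h3 i) (sub_nonneg.2 (hlam1 i))
      have h7 := mul_nonneg (hlam0 i) h5
      have h8 := mul_nonneg (hlam0 i) hc
      have e2 : (lam i - 1) * pp i = (lam i - 1) * max 0 (pp i) - (lam i - 1) * max 0 (-pp i) := by
        rw [← mul_sub, e]
      linarith
    refine (Finset.sum_le_sum fun i _ => h4 i).trans_eq ?_
    simp only [Finset.sum_add_distrib, Finset.sum_sub_distrib, ← Finset.sum_mul,
      Finset.sum_const, Finset.card_univ, Fintype.card_fin, nsmul_eq_mul]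
    ring
  have hq : (0 : ℝ) ≤ q := by positivity
  have h9 := mul_le_mul_of_nonneg_left hA1 hΛ
  have h10 := mul_le_mul_of_nonneg_left hA2 hq
  have h11 := mul_nonneg (mul_nonneg hq (sub_nonneg.2 hdM)) hV
  have e1 : (q - 1) * p = (q - 1) * (max 0 p) - (q - 1) * max 0 (-p) := by rw [← mul_sub, hp]
  have e2 : (1 - q * d) * u = (1 - q * d) * max 0 u - (1 - q * d) * max 0 (-u) := by
    rw [← mul_sub, hu]
  rw [e1, e2]
  linarith

/-- A pointwise variant of `eq_of_circleAverage_posLog_le_logDeriv` allowing error terms that are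
combinations of `log ‖fᵢ‖` with non-negative total order. -/
lemma eq_of_posLog_le_sub_sum {g : ℂ → ℂ} (hg : Differentiable ℂ g) (h0 : g 0 ≠ 0)
    (𝒢 : Finset (ℂ → ℂ)) (h𝒢 : ∀ f ∈ 𝒢, Differentiable ℂ f ∧ f 0 ≠ 0 ∧ ExpGrowth f)
    (hpoly : (∃ p : Polynomial ℂ, ∀ z, g z = p.eval z) →
      ∀ f ∈ 𝒢, ∃ p : Polynomial ℂ, ∀ z, f z = p.eval z)
    {ι : Type*} [Fintype ι] {f : ι → ℂ → ℂ} {c : ι → ℝ} (hf : ∀ i, Differentiable ℂ (f i))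
    (hf0 : ∀ i, f i 0 ≠ 0) (hord : ∀ z, 0 ≤ ∑ i, c i * (analyticOrderNatAt (f i) z : ℝ))
    {κ A B : ℝ} (hκ : 0 < κ) (hB : 0 ≤ B)
    (hm : ∀ (z : ℂ) (σ : ℝ), 0 ≤ σ →
      (∀ f ∈ 𝒢, f z ≠ 0 ∧ Real.posLog ‖deriv f z / f z‖ ≤ σ) →
      κ * Real.posLog ‖g z‖ ≤ A + B * σ - ∑ i, c i * Real.log ‖f i z‖) (w : ℂ) :
    g w = g 0 := by
  refine eq_of_circleAverage_posLog_le_logDeriv hg h0 𝒢 h𝒢 hpoly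
    (B₀ := |A - ∑ i, c i * Real.log ‖f i 0‖| / κ) (B₁ := B / κ) (by positivity) (by positivity)
    (fun r σ hr hσ hgood => ?_) w
  have hI := circleIntegrable_posLog_norm_of_continuousOn (r := r) hg.continuous.continuousOn
  have h1 := circleAverage_le_of_le_sub_sum Finset.univ hf hf0 hord hr
    (hI.const_fun_smul (a := κ)) (A := A + B * σ) fun z hz => hm z σ hσ fun f hf => hgood f hf z hz
  have h2 : Real.circleAverage (fun z => κ • Real.posLog ‖g z‖) 0 r =
      κ * Real.circleAverage (fun z => Real.posLog ‖g z‖) 0 r :=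
    Real.circleAverage_fun_smul
  rw [h2] at h1
  rw [div_mul_eq_mul_div, ← add_div, le_div_iff₀ hκ]
  linarith [le_abs_self (A - ∑ i, c i * Real.log ‖f i 0‖)]

lemma polynomial_deriv {f : ℂ → ℂ} (hf : ∃ p : Polynomial ℂ, ∀ z, f z = p.eval z) :
    ∃ p : Polynomial ℂ, ∀ z, deriv f z = p.eval z := by
  obtain ⟨p, hp⟩ := hf
  exact ⟨p.derivative, fun z => by rw [funext hp, Polynomial.deriv]⟩

lemma polynomial_iteratedDeriv_pow {g : ℂ → ℂ} (hg : ∃ p : Polynomial ℂ, ∀ z, g z = p.eval z)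
    (m t : ℕ) : ∃ p : Polynomial ℂ, ∀ z, iteratedDeriv t (g ^ m) z = p.eval z := by
  induction t with
  | zero =>
    obtain ⟨p, hp⟩ := hg
    exact ⟨p ^ m, fun z => by simp [hp]⟩
  | succ t ih => rw [iteratedDeriv_succ]; exact polynomial_deriv ih

lemma polynomial_diffMonomial {g : ℂ → ℂ} (hg : ∃ p : Polynomial ℂ, ∀ z, g z = p.eval z) (n : ℕ)
    {k : ℕ} (nn tt : Fin k → ℕ) :
    ∃ p : Polynomial ℂ, ∀ z, diffMonomial n nn tt g z = p.eval z := by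
  choose p hp using fun j => polynomial_iteratedDeriv_pow hg (nn j) (tt j)
  obtain ⟨p₀, hp₀⟩ := hg
  exact ⟨p₀ ^ n * ∏ j, p j, fun z => by
    simp [diffMonomial, hp, hp₀, Polynomial.eval_prod]⟩

lemma ExpGrowth.diffMonomial {g : ℂ → ℂ} (hd : Differentiable ℂ g) (hg : ExpGrowth g) (n : ℕ)
    {k : ℕ} (nn tt : Fin k → ℕ) : ExpGrowth (diffMonomial n nn tt g) :=
  (hg.pow n).mul (ExpGrowth.prod _ fun j _ => (hg.pow (nn j)).iteratedDeriv (hd.pow _) (tt j))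

/-- The functions `g`, `P = diffMonomial n nn tt g` and the derivatives of the powers `g ^ nn j` up
to order `tt j`. -/
def monomialFactors (n : ℕ) {k : ℕ} (nn tt : Fin k → ℕ) (g : ℂ → ℂ) : Finset (ℂ → ℂ) :=
  insert g (insert (diffMonomial n nn tt g) (Finset.univ.biUnion fun j =>
    (Finset.range (tt j + 1)).image fun s => iteratedDeriv s (g ^ nn j)))

section
variable {n k : ℕ} {nn tt : Fin k → ℕ} {g : ℂ → ℂ}

lemma self_mem_monomialFactors : g ∈ monomialFactors n nn tt g := by simp [monomialFactors]

lemma diffMonomial_mem_monomialFactors : diffMonomial n nn tt g ∈ monomialFactors n nn tt g := by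
  simp [monomialFactors]

lemma iteratedDeriv_mem_monomialFactors {j : Fin k} {s : ℕ} (hs : s ≤ tt j) :
    iteratedDeriv s (g ^ nn j) ∈ monomialFactors n nn tt g := by
  refine Finset.mem_insert_of_mem (Finset.mem_insert_of_mem (Finset.mem_biUnion.2
    ⟨j, Finset.mem_univ j, Finset.mem_image_of_mem _ (Finset.mem_range.2 (by omega))⟩))

lemma diffMonomial_ne_zero {z : ℂ} (h0 : g z ≠ 0)
    (hF : ∀ j, ∀ s ≤ tt j, iteratedDeriv s (g ^ nn j) z ≠ 0) : diffMonomial n nn tt g z ≠ 0 :=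
  mul_ne_zero (pow_ne_zero _ h0) (Finset.prod_ne_zero_iff.2 fun j _ => hF j _ le_rfl)

lemma monomialFactors_spec (hg : Differentiable ℂ g) (hexp : ExpGrowth g) (h0 : g 0 ≠ 0)
    (hF : ∀ j, ∀ s ≤ tt j, iteratedDeriv s (g ^ nn j) 0 ≠ 0) {f : ℂ → ℂ}
    (hf : f ∈ monomialFactors n nn tt g) : (Differentiable ℂ f ∧ f 0 ≠ 0 ∧ ExpGrowth f) ∧
      ((∃ p : Polynomial ℂ, ∀ z, g z = p.eval z) → ∃ p : Polynomial ℂ, ∀ z, f z = p.eval z) := by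
  simp only [monomialFactors, Finset.mem_insert, Finset.mem_biUnion, Finset.mem_image,
    Finset.mem_univ, true_and, Finset.mem_range] at hf
  rcases hf with rfl | rfl | ⟨j, s, hs, rfl⟩
  · exact ⟨⟨hg, h0, hexp⟩, id⟩
  · exact ⟨⟨differentiable_diffMonomial hg n nn tt, diffMonomial_ne_zero h0 hF,
      hexp.diffMonomial hg n nn tt⟩, fun h => polynomial_diffMonomial h n nn tt⟩
  · exact ⟨⟨(hg.pow _).iteratedDeriv_complex s, hF j s (by omega),
      (hexp.pow _).iteratedDeriv (hg.pow _) s⟩, fun h => polynomial_iteratedDeriv_pow h _ _⟩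

lemma log_norm_diffMonomial_le_of_monomialFactors {z : ℂ} {σ : ℝ}
    (h : ∀ f ∈ monomialFactors n nn tt g, f z ≠ 0 ∧ Real.posLog ‖deriv f z / f z‖ ≤ σ) :
    Real.log ‖diffMonomial n nn tt g z‖ ≤
      (n + ∑ j, (nn j : ℝ)) * Real.log ‖g z‖ + (∑ j, (tt j : ℝ)) * σ :=
  log_norm_diffMonomial_le (h _ self_mem_monomialFactors).1
    (fun _ _ hs => (h _ (iteratedDeriv_mem_monomialFactors hs)).1)
    fun _ _ hs => (h _ (iteratedDeriv_mem_monomialFactors hs)).2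

lemma mul_analyticOrderNatAt_le_diffMonomial_real (hg : Differentiable ℂ g) (h0 : g 0 ≠ 0)
    (hF : ∀ j, ∀ s ≤ tt j, iteratedDeriv s (g ^ nn j) 0 ≠ 0) (z : ℂ) :
    ((n + ∑ j, (nn j : ℝ)) - ∑ j, (tt j : ℝ)) * analyticOrderNatAt g z ≤
      analyticOrderNatAt (diffMonomial n nn tt g) z := by
  have h1 := mul_analyticOrderNatAt_le_diffMonomial (n := n) hg h0 (fun j => hF j _ le_rfl) z
  have h2 : (((n + ∑ j, nn j) * analyticOrderNatAt g z : ℕ) : ℝ) ≤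
      (analyticOrderNatAt (diffMonomial n nn tt g) z + (∑ j, tt j) * analyticOrderNatAt g z : ℕ) :=
    Nat.cast_le.2 h1
  push_cast at h2
  linarith

/-- The case of a constant differential monomial. -/
lemma eq_of_diffMonomial_const (hg : Differentiable ℂ g) (hexp : ExpGrowth g) (h0 : g 0 ≠ 0)
    (hF : ∀ j, ∀ s ≤ tt j, iteratedDeriv s (g ^ nn j) 0 ≠ 0)
    (hlt : ∑ j, (tt j : ℝ) < n + ∑ j, (nn j : ℝ))
    (hconst : ∀ z, diffMonomial n nn tt g z = diffMonomial n nn tt g 0) (w : ℂ) : g w = g 0 := by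
  set M := n + ∑ j, (nn j : ℝ) with hM
  set T := ∑ j, (tt j : ℝ) with hT
  have hT0 : 0 ≤ T := Finset.sum_nonneg fun _ _ => Nat.cast_nonneg _
  set P := diffMonomial n nn tt g with hP
  refine eq_of_posLog_le_sub_sum hg h0 (monomialFactors n nn tt g)
    (fun f hf => (monomialFactors_spec hg hexp h0 hF hf).1)
    (fun h f hf => (monomialFactors_spec hg hexp h0 hF hf).2 h)
    (f := ![P, g]) (c := ![1, -(M - T)]) ?_ ?_ ?_ (κ := M - T) (A := max 0 (Real.log ‖P 0‖)) (B := T)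
    (by linarith) hT0 ?_ w
  · intro i; fin_cases i
    exacts [differentiable_diffMonomial hg n nn tt, hg]
  · intro i; fin_cases i
    exacts [diffMonomial_ne_zero h0 hF, h0]
  · intro z
    have := mul_analyticOrderNatAt_le_diffMonomial_real hg h0 hF z (n := n)
    simp only [Fin.sum_univ_two, Matrix.cons_val_zero, Matrix.cons_val_one]
    linarith
  · intro z σ hσ h
    have h1 := log_norm_diffMonomial_le_of_monomialFactors h
    rw [← hP, ← hM, ← hT] at h1
    obtain ⟨-, h2⟩ := posPart_le_of_le_linear (by linarith) (mul_nonneg hT0 hσ) h1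
    simp only [Fin.sum_univ_two, Matrix.cons_val_zero, Matrix.cons_val_one]
    have h3 := max_zero_sub_max_zero_neg (Real.log ‖P z‖)
    have h4 := max_zero_sub_max_zero_neg (Real.log ‖g z‖)
    have h5 : 0 ≤ max 0 (-Real.log ‖g z‖) := le_max_left _ _
    rw [hconst z] at h2 h3 ⊢
    change (M - T) * max 0 (Real.log ‖g z‖) ≤ _
    have h6 := mul_nonneg hT0 h5
    have h7 : (M - T) * Real.log ‖g z‖ = (M - T) * max 0 (Real.log ‖g z‖) -
        (M - T) * max 0 (-Real.log ‖g z‖) := by rw [← mul_sub, h4]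
    linarith

end

lemma posLog_norm_le_sub_add (w b : ℂ) :
    Real.posLog ‖w‖ ≤ Real.posLog ‖w - b‖ + (Real.posLog ‖b‖ + Real.log 2) := by
  have := Real.posLog_norm_add_le (w - b) b
  rw [sub_add_cancel] at this
  linarith

/-- The second main theorem type estimate forcing `g` to be constant. -/
lemma eq_of_diffMonomial_multiplicity {q : ℕ} (hq : 1 ≤ q) {a : Fin q → ℂ} (ha : ∀ i, a i ≠ 0)
    (hinj : Function.Injective a) {l : Fin q → ℕ∞} {lam : Fin q → ℝ} (hlam0 : ∀ i, 0 ≤ lam i)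
    (hlam1 : ∀ i, lam i ≤ 1) (hlam : ∀ i (m : ℕ), l i ≤ m → 1 ≤ lam i * m)
    {n k : ℕ} {nn tt : Fin k → ℕ} {g : ℂ → ℂ} (hg : Differentiable ℂ g) (hexp : ExpGrowth g)
    (hd : ∑ j, (tt j : ℝ) + 1 ≤ n + ∑ j, (nn j : ℝ))
    (hκ : 0 < q * ((n + ∑ j, (nn j : ℝ)) - ∑ j, (tt j : ℝ)) - 1 -
      (∑ i, lam i) * (n + ∑ j, (nn j : ℝ)))
    (hmult : ∀ i ξ, diffMonomial n nn tt g ξ = a i → ∀ s : ℕ, (s : ℕ∞) < l i →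
      iteratedDeriv s (fun w => diffMonomial n nn tt g w - a i) ξ = 0)
    (h0 : g 0 ≠ 0) (hF : ∀ j, ∀ s ≤ tt j, iteratedDeriv s (g ^ nn j) 0 ≠ 0)
    (hP0 : deriv (diffMonomial n nn tt g) 0 ≠ 0) (hPa : ∀ i, diffMonomial n nn tt g 0 ≠ a i)
    (w : ℂ) : g w = g 0 := by
  set M := n + ∑ j, (nn j : ℝ) with hM
  set T := ∑ j, (tt j : ℝ) with hT
  have hT0 : 0 ≤ T := Finset.sum_nonneg fun _ _ => Nat.cast_nonneg _
  have hΛ0 : 0 ≤ ∑ i, lam i := Finset.sum_nonneg fun i _ => hlam0 i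
  have hPd := differentiable_diffMonomial hg n nn tt
  have hPe := hexp.diffMonomial hg n nn tt
  set 𝒢 : Finset (ℂ → ℂ) := monomialFactors n nn tt g ∪
    insert (deriv (diffMonomial n nn tt g))
      (Finset.univ.image fun i z => diffMonomial n nn tt g z - a i) with h𝒢
  have hmem : ∀ f ∈ 𝒢, (Differentiable ℂ f ∧ f 0 ≠ 0 ∧ ExpGrowth f) ∧
      ((∃ p : Polynomial ℂ, ∀ z, g z = p.eval z) → ∃ p : Polynomial ℂ, ∀ z, f z = p.eval z) := by
    intro f hf
    simp only [h𝒢, Finset.mem_union, Finset.mem_insert, Finset.mem_image, Finset.mem_univ,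
      true_and] at hf
    rcases hf with hf | rfl | ⟨i, rfl⟩
    · exact monomialFactors_spec hg hexp h0 hF hf
    · exact ⟨⟨hPd.deriv, hP0, hPe.deriv hPd⟩, fun h => polynomial_deriv (polynomial_diffMonomial h _ _ _)⟩
    · refine ⟨⟨hPd.sub_const _, sub_ne_zero.2 (hPa i), hPe.sub (expGrowth_const _)⟩, fun h => ?_⟩
      obtain ⟨p, hp⟩ := polynomial_diffMonomial h n nn tt
      exact ⟨p - Polynomial.C (a i), fun z => by simp [hp]⟩
  have hsub : monomialFactors n nn tt g ⊆ 𝒢 := Finset.subset_union_left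
  have hmemP' : deriv (diffMonomial n nn tt g) ∈ 𝒢 := by simp [h𝒢]
  have hmema : ∀ i, (fun z => diffMonomial n nn tt g z - a i) ∈ 𝒢 := fun i =>
    Finset.mem_union_right _ (Finset.mem_insert_of_mem (Finset.mem_image_of_mem _ (Finset.mem_univ i)))
  have hord := mul_analyticOrderNatAt_le_diffMonomial_real hg h0 hF (n := n)
  rw [← hM, ← hT] at hord
  set P := diffMonomial n nn tt g with hP
  obtain ⟨C, hC⟩ := exists_sum_posLog_inv_sub_le
    (b := fun i : Option (Fin q) => i.elim 0 a) (by
      rintro (_ | i) (_ | j) h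
      · rfl
      · exact absurd h.symm (ha j)
      · exact absurd h (ha i)
      · exact congrArg some (hinj h))
  set c := ∑ i, (Real.posLog ‖a i‖ + Real.log 2) with hc
  have hterm : ∀ i, 0 ≤ Real.posLog ‖a i‖ + Real.log 2 := fun i =>
    add_nonneg Real.posLog_nonneg (Real.log_nonneg (by norm_num))
  have hc0 : 0 ≤ c := Finset.sum_nonneg fun i _ => hterm i
  refine eq_of_posLog_le_sub_sum hg h0 𝒢 (fun f hf => (hmem f hf).1)
    (fun h f hf => (hmem f hf).2 h) (ι := Fin 3 ⊕ Fin q)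
    (f := Sum.elim ![deriv P, P, g] fun i z => P z - a i)
    (c := Sum.elim ![1, (q : ℝ) - 1, 1 - q * (M - T)] fun i => lam i - 1)
    ?_ ?_ ?_ hκ (A := C + q * c) (B := q + 2 + (q + ∑ i, lam i) * T) (by positivity) ?_ w
  · rintro (i | i)
    · fin_cases i
      exacts [hPd.deriv, hPd, hg]
    · exact hPd.sub_const _
  · rintro (i | i)
    · fin_cases i
      exacts [hP0, diffMonomial_ne_zero h0 hF, h0]
    · exact sub_ne_zero.2 (hPa i)
  · intro z
    have := weighted_order_nonneg ha hinj hlam hPd hP0 hPa hq (d := M - T) (by linarith)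
      hord hmult z
    simp only [Fintype.sum_sum_type, Fin.sum_univ_three, Sum.elim_inl, Sum.elim_inr,
      Matrix.cons_val_zero, Matrix.cons_val_one, Matrix.cons_val]
    linarith
  · intro z σ hσ h
    have hA := log_norm_diffMonomial_le_of_monomialFactors fun f hf => h f (hsub hf)
    rw [← hP, ← hM, ← hT] at hA
    have hPz := h P (hsub diffMonomial_mem_monomialFactors)
    have hP'z := h _ hmemP'
    have haz := fun i => h _ (hmema i)
    have e1 : ∀ x : ℂ, Real.posLog ‖x⁻¹‖ = max 0 (-Real.log ‖x‖) := fun x => by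
      rw [norm_inv, ← Real.log_inv]; rfl
    have h1 := hC (P z) (deriv P z) hP'z.1
    simp only [Fintype.sum_option, Option.elim_none, Option.elim_some, sub_zero, e1] at h1
    have h2 : Real.posLog ‖deriv P z‖ ≤ Real.posLog ‖P z‖ + σ := by
      have e : deriv P z = P z * (deriv P z / P z) := by field_simp [hPz.1]
      conv_lhs => rw [e, norm_mul]
      exact Real.posLog_mul.trans (by linarith [hPz.2])
    have h3 : ∑ i, Real.posLog ‖deriv P z / (P z - a i)‖ ≤ q * σ := by
      refine (Finset.sum_le_sum fun i _ => ?_).trans_eq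
        (by rw [Finset.sum_const, Finset.card_univ, Fintype.card_fin, nsmul_eq_mul])
      have := (haz i).2
      rwa [deriv_sub_const] at this
    have h4 := posPart_balance (pp := fun i => Real.log ‖P z - a i‖) hlam0 hlam1
      (u := Real.log ‖g z‖) (p := Real.log ‖P z‖) (p' := Real.log ‖deriv P z‖)
      (σ := σ) (C := C) (c := c) (d := M - T) (M := M) (T := T) (by linarith) hT0 hσ hc0
      (by linarith) hA (by linarith [hPz.2]) h2 fun i => by
        have h5 := posLog_norm_le_sub_add (P z) (a i)
        have h6 : Real.posLog ‖a i‖ + Real.log 2 ≤ c :=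
          Finset.single_le_sum (f := fun i => Real.posLog ‖a i‖ + Real.log 2)
            (fun i _ => hterm i) (Finset.mem_univ i)
        exact h5.trans (by simpa [Real.posLog] using h6)
    simp only [Fintype.sum_sum_type, Fin.sum_univ_three, Sum.elim_inl, Sum.elim_inr,
      Matrix.cons_val_zero, Matrix.cons_val_one, Matrix.cons_val]
    refine h4.trans (le_of_eq ?_)
    ring

lemma exists_polynomial_of_iteratedDeriv_eq_zero {h : ℂ → ℂ} (hh : Differentiable ℂ h) {s : ℕ}
    (hs : ∀ z, iteratedDeriv s h z = 0) : ∃ p : Polynomial ℂ, ∀ z, h z = p.eval z := by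
  have hs' : ∀ i, s ≤ i → ∀ z, iteratedDeriv i h z = 0 := by
    intro i hi
    induction i, hi using Nat.le_induction with
    | base => exact hs
    | succ i _ ih => intro z; rw [iteratedDeriv_succ, funext ih]; simp
  refine ⟨∑ i ∈ Finset.range s,
    Polynomial.C ((i.factorial : ℂ)⁻¹ * iteratedDeriv i h 0) * Polynomial.X ^ i, fun z => ?_⟩
  have h1 := Complex.hasSum_taylorSeries_of_entire hh 0 z
  have h2 := hasSum_sum_of_ne_finset_zero (L := SummationFilter.unconditional ℕ) (s := Finset.range s)
    (f := fun i : ℕ => (i.factorial : ℂ)⁻¹ • (z - 0) ^ i • iteratedDeriv i h 0) fun i hi => by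
      rw [hs' i (by simpa using hi)]; simp
  rw [h1.unique h2]
  simp only [Polynomial.eval_finsetSum, Polynomial.eval_mul, Polynomial.eval_C, Polynomial.eval_pow,
    Polynomial.eval_X, smul_eq_mul, sub_zero]
  exact Finset.sum_congr rfl fun i _ => by ring

/-- A derivative of order at most `m` of the `m`-th power of a non-constant entire function does
not vanish identically. -/
lemma exists_iteratedDeriv_pow_ne_zero {g : ℂ → ℂ} (hg : Differentiable ℂ g)
    (h0 : deriv g 0 ≠ 0) {m s : ℕ} (hm : m ≠ 0) (hs : s ≤ m) :
    ∃ z, iteratedDeriv s (g ^ m) z ≠ 0 := by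
  by_contra! hzero
  have hgm : Differentiable ℂ (g ^ m) := hg.pow m
  obtain ⟨p, hp⟩ := exists_polynomial_of_iteratedDeriv_eq_zero hgm hzero
  by_cases hdeg : p.degree = 0
  · obtain ⟨c, hc⟩ : ∃ c, p = Polynomial.C c := ⟨_, Polynomial.eq_C_of_degree_eq_zero hdeg⟩
    have hc0 : c ≠ 0 := by
      rintro rfl
      simp [hc] at hdeg
    have h1 : ∀ z, g z ^ m = c := fun z => by simpa [hc] using hp z
    have h2 : HasDerivAt (fun z => g z ^ m) (m * g 0 ^ (m - 1) * deriv g 0) 0 :=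
      (hg 0).hasDerivAt.fun_pow m
    rw [funext h1] at h2
    have h3 := h2.unique (hasDerivAt_const 0 c)
    have hg0 : g 0 ≠ 0 := fun h => hc0 (by rw [← h1 0, h, zero_pow hm])
    simp [hm, hg0, h0] at h3
  · obtain ⟨z, hz⟩ := IsAlgClosed.exists_root p hdeg
    have hgz : g z = 0 := by
      have := hp z
      rw [hz, Pi.pow_apply] at this
      exact pow_eq_zero_iff hm |>.1 this
    have h1 : (m : ℕ∞) ≤ analyticOrderAt (g ^ m) z := by
      rw [analyticOrderAt_pow (hg.analyticAt z), nsmul_eq_mul]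
      have : analyticOrderAt g z ≠ 0 := (hg.analyticAt z).analyticOrderAt_ne_zero.2 hgz
      exact le_mul_of_one_le_right (by simp) (Order.one_le_iff_ne_zero.2 this)
    rw [natCast_le_analyticOrderAt_iff_iteratedDeriv_eq_zero (hgm.analyticAt z)] at h1
    have h2 : analyticOrderAt (g ^ m) z = ⊤ := by
      refine ENat.eq_top_iff_forall_ge.2 fun N => ?_
      rw [natCast_le_analyticOrderAt_iff_iteratedDeriv_eq_zero (hgm.analyticAt z)]
      intro i _
      rcases lt_or_ge i m with hi | hi
      · exact h1 i hi
      · obtain ⟨e, rfl⟩ := Nat.exists_eq_add_of_le' (hs.trans hi)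
        rw [iteratedDeriv_eq_iterate, Function.iterate_add_apply, ← iteratedDeriv_eq_iterate,
          ← iteratedDeriv_eq_iterate, show iteratedDeriv s (g ^ m) = fun _ => 0 from funext hzero]
        simp
    have h3 : ∀ w, g w = 0 := by
      by_contra! h
      obtain ⟨w, hw⟩ := h
      exact analyticOrderAt_ne_top_of_entire hgm (z₀ := w) (pow_ne_zero m hw) z h2
    exact h0 (by rw [show g = fun _ => 0 from funext h3]; simp)

lemma eventually_ne_zero_of_entire {f : ℂ → ℂ} (hf : Differentiable ℂ f) (h : ∃ z, f z ≠ 0) :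
    ∀ᶠ z in 𝓝[≠] (0 : ℂ), f z ≠ 0 := by
  obtain ⟨z₀, hz₀⟩ := h
  refine (hf.analyticAt 0).eventually_eq_zero_or_eventually_ne_zero.resolve_left fun h => ?_
  exact analyticOrderAt_ne_top_of_entire hf hz₀ 0 (analyticOrderAt_eq_top.2 h)

lemma diffMonomial_comp_add_const (n : ℕ) {k : ℕ} (nn tt : Fin k → ℕ) (g : ℂ → ℂ) (c : ℂ) :
    diffMonomial n nn tt (fun z => g (z + c)) = fun z => diffMonomial n nn tt g (z + c) := by
  ext z
  have h : ∀ m, (fun z => g (z + c)) ^ m = fun z => (g ^ m) (z + c) := fun m => rfl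
  simp only [diffMonomial, h, iteratedDeriv_comp_add_const]

lemma ExpGrowth.comp_add_const {f : ℂ → ℂ} (hf : ExpGrowth f) (c : ℂ) :
    ExpGrowth fun z => f (z + c) := by
  obtain ⟨A, hA, h⟩ := hf
  refine ⟨A * (1 + ‖c‖), by positivity, fun z => (h _).trans (Real.exp_le_exp.2 ?_)⟩
  rw [mul_assoc]
  refine mul_le_mul_of_nonneg_left ?_ hA
  nlinarith [norm_add_le z c, mul_nonneg (norm_nonneg c) (norm_nonneg z)]

/-- There is no non-constant entire function of exponential type satisfying the multiplicity
condition. -/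
lemma deriv_eq_zero_of_diffMonomial_multiplicity {q : ℕ} (hq : 1 ≤ q) {a : Fin q → ℂ}
    (ha : ∀ i, a i ≠ 0) (hinj : Function.Injective a) {l : Fin q → ℕ∞} {lam : Fin q → ℝ}
    (hlam0 : ∀ i, 0 ≤ lam i) (hlam1 : ∀ i, lam i ≤ 1) (hlam : ∀ i (m : ℕ), l i ≤ m → 1 ≤ lam i * m)
    {n k : ℕ} {nn tt : Fin k → ℕ} (hnn : ∀ j, nn j ≠ 0) (hnt : ∀ j, tt j ≤ nn j)
    {g : ℂ → ℂ} (hg : Differentiable ℂ g) (hexp : ExpGrowth g)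
    (hd : ∑ j, (tt j : ℝ) + 1 ≤ n + ∑ j, (nn j : ℝ))
    (hκ : 0 < q * ((n + ∑ j, (nn j : ℝ)) - ∑ j, (tt j : ℝ)) - 1 -
      (∑ i, lam i) * (n + ∑ j, (nn j : ℝ)))
    (hmult : ∀ i ξ, diffMonomial n nn tt g ξ = a i → ∀ s : ℕ, (s : ℕ∞) < l i →
      iteratedDeriv s (fun w => diffMonomial n nn tt g w - a i) ξ = 0) : deriv g 0 = 0 := by
  by_contra h0
  have hconst : ¬ ∀ z w, g z = g w := fun h => h0 (by
    rw [show g = fun _ => g 0 from funext fun z => h z 0]; simp)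
  have hPd := differentiable_diffMonomial hg n nn tt
  have hg0 : ∃ z, g z ≠ 0 := by
    by_contra! h
    exact hconst fun z w => by rw [h, h]
  have hev := (eventually_ne_zero_of_entire hg hg0).and (eventually_all.2 fun j =>
    (Finset.range (tt j + 1)).eventually_all.2 fun s hs =>
      eventually_ne_zero_of_entire ((hg.pow (nn j)).iteratedDeriv_complex s)
        (exists_iteratedDeriv_pow_ne_zero hg h0 (hnn j)
          ((Nat.lt_succ_iff.1 (Finset.mem_range.1 hs)).trans (hnt j))))
  have hexp' := fun c => hexp.comp_add_const c
  have hpow : ∀ (c : ℂ) m, (fun z => g (z + c)) ^ m = fun z => (g ^ m) (z + c) := fun c m => rfl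
  have hgc : ∀ c, Differentiable ℂ fun z => g (z + c) := fun c =>
    hg.comp (differentiable_id.add_const c)
  have hend : ∀ c, ¬ ∀ w, g (w + c) = g (0 + c) := fun c h => hconst fun z w => by
    have h1 := h (z - c)
    have h2 := h (w - c)
    rw [sub_add_cancel] at h1 h2
    rw [h1, h2]
  by_cases hP : ∀ z, deriv (diffMonomial n nn tt g) z = 0
  · obtain ⟨c, hc1, hc2⟩ := hev.exists
    refine hend c (eq_of_diffMonomial_const (hgc c) (hexp' c) (by simpa using hc1)
      (fun j s hs => ?_) (n := n) (nn := nn) (tt := tt) (by linarith) fun z => ?_)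
    · rw [hpow, iteratedDeriv_comp_add_const]
      simp only [zero_add]
      exact hc2 j s (Finset.mem_range.2 (by omega))
    · rw [diffMonomial_comp_add_const]
      exact is_const_of_deriv_eq_zero hPd hP _ _
  · push Not at hP
    have hPa : ∀ i, ∃ z, diffMonomial n nn tt g z - a i ≠ 0 := by
      intro i
      by_contra! h
      obtain ⟨z, hz⟩ := hP
      exact hz (by
        rw [show diffMonomial n nn tt g = fun _ => a i from funext fun z => sub_eq_zero.1 (h z)]
        simp)
    obtain ⟨c, ⟨hc1, hc2⟩, hc3, hc4⟩ := (hev.and ((eventually_ne_zero_of_entire hPd.deriv hP).and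
      (eventually_all.2 fun i => eventually_ne_zero_of_entire (hPd.sub_const (a i)) (hPa i)))).exists
    refine hend c (eq_of_diffMonomial_multiplicity hq ha hinj hlam0 hlam1 hlam (hgc c) (hexp' c)
      (n := n) (nn := nn) (tt := tt) hd hκ ?_ (by simpa using hc1)
      (fun j s hs => ?_) ?_ fun i => ?_)
    · intro i ξ hξ s hs
      rw [diffMonomial_comp_add_const] at hξ ⊢
      have := hmult i (ξ + c) hξ s hs
      rwa [iteratedDeriv_comp_add_const s (fun w => diffMonomial n nn tt g w - a i) c]
    · rw [hpow, iteratedDeriv_comp_add_const]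
      simp only [zero_add]
      exact hc2 j s (Finset.mem_range.2 (by omega))
    · rwa [diffMonomial_comp_add_const, deriv_comp_add_const, zero_add]
    · rw [diffMonomial_comp_add_const]
      simp only [zero_add]
      exact sub_ne_zero.1 (hc4 i)

/-- Conversion of the numerical hypothesis from `ℝ≥0∞` to `ℝ`. -/
lemma exists_real_weights {q : ℕ} {l : Fin q → ℕ∞} (hl : ∀ i, 2 ≤ l i) {R : ℝ}
    (h : ∑ i, ((l i : ℝ≥0∞))⁻¹ < ENNReal.ofReal R) :
    ∃ lam : Fin q → ℝ, (∀ i, 0 ≤ lam i) ∧ (∀ i, lam i ≤ 1) ∧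
      (∀ i (m : ℕ), l i ≤ m → 1 ≤ lam i * m) ∧ ∑ i, lam i < R := by
  have hle : ∀ i, ((l i : ℝ≥0∞))⁻¹ ≤ 1 := fun i => by
    rw [ENNReal.inv_le_one]
    exact_mod_cast le_trans (by norm_num : (1 : ℕ∞) ≤ 2) (hl i)
  have hfin : ∀ i, ((l i : ℝ≥0∞))⁻¹ ≠ ⊤ := fun i => ne_top_of_le_ne_top ENNReal.one_ne_top (hle i)
  refine ⟨fun i => ((l i : ℝ≥0∞)⁻¹).toReal, fun i => ENNReal.toReal_nonneg, fun i => ?_,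
    fun i m hm => ?_, ?_⟩
  · simpa using ENNReal.toReal_mono ENNReal.one_ne_top (hle i)
  · have hlt : l i ≠ ⊤ := ne_top_of_le_ne_top (ENat.natCast_ne_top m) hm
    obtain ⟨N, hN⟩ := ENat.ne_top_iff_exists.1 hlt
    have h2 := hl i
    simp only [← hN] at hm h2 ⊢
    have hNm : N ≤ m := by exact_mod_cast hm
    have hN2 : 2 ≤ N := by exact_mod_cast h2
    have hN0 : (0 : ℝ) < N := by exact_mod_cast (by omega : 0 < N)
    simp only [ENat.toENNReal_coe, ENNReal.toReal_inv, ENNReal.toReal_natCast]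
    rw [inv_mul_eq_div, one_le_div hN0]
    exact_mod_cast hNm
  · rw [← ENNReal.toReal_sum fun i _ => hfin i]
    exact (ENNReal.lt_ofReal_iff_toReal_lt (ENNReal.sum_ne_top.2 fun i _ => hfin i)).1 h

/-- **Dethloff et al.'s normality criterion for holomorphic functions.** -/
theorem dethloff_normality_holomorphic (q : ℕ) (hq : 1 ≤ q)
    (a : Fin q → ℂ) (ha_ne : ∀ i, a i ≠ 0) (ha_inj : Function.Injective a)
    (l : Fin q → ℕ∞) (n : ℕ) (k : ℕ) (hk : 1 ≤ k)
    (nn tt : Fin k → ℕ) (hnn : ∀ j, 1 ≤ nn j) (htt : ∀ j, 1 ≤ tt j)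
    (D : Set ℂ) (hD : IsOpen D) (hDconn : IsConnected D)
    (𝓕 : Set (ℂ → ℂ)) (hholo : ∀ f ∈ 𝓕, DifferentiableOn ℂ f D)
    -- hypothesis (a)
    (hnt : ∀ j, tt j ≤ nn j) (hl : ∀ i, 2 ≤ l i)
    -- hypothesis (b)
    (hsum : ∑ i, ((l i : ℝ≥0∞))⁻¹ <
      ENNReal.ofReal (((q : ℝ) * n - 1 + ∑ j, (q : ℝ) * ((nn j : ℝ) - (tt j : ℝ))) /
        ((n : ℝ) + ∑ j, (nn j : ℝ))))
    -- multiplicity hypothesis: all zeros of fⁿ(f^{n₁})^{(t₁)}⋯(f^{n_k})^{(t_k)} − aᵢ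
    -- have multiplicity at least lᵢ
    (hmult : ∀ f ∈ 𝓕, ∀ i : Fin q, ∀ z ∈ D,
      (f z) ^ n * (∏ j, iteratedDeriv (tt j) (f ^ (nn j)) z) - a i = 0 →
        (l i).map (fun x : ℕ => (x : ℤ)) ≤
          merOrder (fun w => (f w) ^ n * (∏ j, iteratedDeriv (tt j) (f ^ (nn j)) w) - a i) z) :
    NormalFamilyOnHolo 𝓕 D := by
  have hk0 : 0 < ∑ j, (nn j : ℝ) := by
    have : Nonempty (Fin k) := ⟨⟨0, hk⟩⟩
    exact Finset.sum_pos (fun j _ => by exact_mod_cast hnn j) Finset.univ_nonempty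
  have hM : 0 < (n : ℝ) + ∑ j, (nn j : ℝ) := by positivity
  obtain ⟨lam, hlam0, hlam1, hlam, hlt⟩ := exists_real_weights hl hsum
  rw [lt_div_iff₀ hM, ← Finset.mul_sum, Finset.sum_sub_distrib] at hlt
  have hΛ : 0 ≤ ∑ i, lam i := Finset.sum_nonneg fun i _ => hlam0 i
  have hκ : 0 < q * ((n + ∑ j, (nn j : ℝ)) - ∑ j, (tt j : ℝ)) - 1 -
      (∑ i, lam i) * (n + ∑ j, (nn j : ℝ)) := by linarith
  have hTM : ∑ j, (tt j : ℝ) < n + ∑ j, (nn j : ℝ) := by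
    have hq0 : (0 : ℝ) ≤ q := q.cast_nonneg
    have := mul_nonneg hΛ hM.le
    by_contra! hle
    nlinarith
  have hd : ∑ j, (tt j : ℝ) + 1 ≤ n + ∑ j, (nn j : ℝ) := by
    have h1 : ∑ j, tt j < n + ∑ j, nn j := by exact_mod_cast hTM
    exact_mod_cast h1
  refine normalFamilyOnHolo_of_seq hD hholo fun f hf => ?_
  by_contra hnot
  obtain ⟨g, hg, hg0, hgb, hgm⟩ := exists_entire_of_not_normal a l hl hTM hD
    hDconn.isPreconnected (fun j => hholo _ (hf j)) (fun m i z hz => hmult _ (hf m) i z hz) hnot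
  exact hg0 (deriv_eq_zero_of_diffMonomial_multiplicity hq ha_ne ha_inj hlam0 hlam1 hlam
    (fun j => Nat.one_le_iff_ne_zero.1 (hnn j)) hnt hg (expGrowth_of_spherical_deriv_le hg hg0 (by norm_num) hgb)
    hd hκ hgm)

end
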